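/- (Full convergence of the numerical solution under the uniqueness assumption) Assume (A0) and (A1′) and let T > 0. Let u = (u^α) be the unique viscosity solution of (HJ)-(CI) on [0,T)×J. Then for any sequence ε = (Δt, Δx) → 0 satisfying the CFL condition (CFL′), the numerical solutions (U^{α,n}_i) of the scheme (NS) with initial condition U^{α,0}_i = u₀^α(iΔx) converge locally uniformly to u: for every compact set K ⊂ [0,T)×J, sup{|u^α(nΔt, iΔx) − U^{α,n}_i| : (nΔt, iΔx e_α) ∈ K} → 0 as ε → 0. -/

import Mathlib

open Set Filter

/-- Assumption (A1) for a single Hamiltonian: `H` is `C¹`, coercive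
(`H p → +∞` as `|p| → +∞`), non-increasing on `(-∞, p₀]` and non-decreasing on `[p₀, +∞)`. -/
def A1cond (H : ℝ → ℝ) (p₀ : ℝ) : Prop :=
  ContDiff ℝ 1 H ∧ Tendsto H (cocompact ℝ) atTop ∧
    AntitoneOn H (Iic p₀) ∧ MonotoneOn H (Ici p₀)

/-- The non-increasing envelope `H⁻` of `H` with turning point `p₀`. -/
noncomputable def Hm (H : ℝ → ℝ) (p₀ : ℝ) (p : ℝ) : ℝ :=
  if p ≤ p₀ then H p else H p₀

/-- The non-decreasing envelope `H⁺` of `H` with turning point `p₀`. -/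
noncomputable def Hp (H : ℝ → ℝ) (p₀ : ℝ) (p : ℝ) : ℝ :=
  if p ≤ p₀ then H p₀ else H p

/-- One time step of the numerical scheme (NS) on the junction:
`V` (the values at time `n+1`) is computed from `U` (the values at time `n`).
For `i ≥ 1` on each branch `α` the update uses
`max (H⁺_α(p_{i,-}), H⁻_α(p_{i,+}))`; at the junction point `i = 0` all branches share a
common value and the update uses `max_β H⁻_β(p^β_{0,+})`. -/
def SchemeStep {N : ℕ} (H : Fin N → ℝ → ℝ) (p₀ : Fin N → ℝ) (Δx Δt : ℝ)
    (U V : Fin N → ℕ → ℝ) : Prop :=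
  (∀ (α : Fin N) (i : ℕ), 1 ≤ i →
      V α i = U α i - Δt * max (Hp (H α) (p₀ α) ((U α i - U α (i - 1)) / Δx))
        (Hm (H α) (p₀ α) ((U α (i + 1) - U α i) / Δx))) ∧
  (∀ α β : Fin N, U α 0 = U β 0) ∧
  (∀ α : Fin N, V α 0 = U α 0 - Δt *
      sSup (Set.range fun β : Fin N => Hm (H β) (p₀ β) ((U β 1 - U β 0) / Δx)))

/-- The numerical scheme (NS): `U α n i` is the value on branch `α` at time step `n`
and grid point `i`. -/
def SchemeNS {N : ℕ} (H : Fin N → ℝ → ℝ) (p₀ : Fin N → ℝ) (Δx Δt : ℝ)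
    (U : Fin N → ℕ → ℕ → ℝ) : Prop :=
  ∀ n : ℕ, SchemeStep H p₀ Δx Δt (fun α i => U α n i) (fun α i => U α (n + 1) i)

/-- Viscosity subsolution of the Hamilton–Jacobi equation (HJ) on the junction, on
`J_T = (0,T) × J`. The junction is encoded by the family of branch restrictions
`u α t x` (`x ≥ 0`), sharing a common value at the junction point `x = 0`. -/
def IsViscSubSol {N : ℕ} (T : ℝ) (H : Fin N → ℝ → ℝ) (p₀ : Fin N → ℝ)
    (u : Fin N → ℝ → ℝ → ℝ) : Prop :=
  (∀ α, UpperSemicontinuousOn (fun q : ℝ × ℝ => u α q.1 q.2) (Ico 0 T ×ˢ Ici 0)) ∧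
  (∀ (α β : Fin N) (t : ℝ), u α t 0 = u β t 0) ∧
  (∀ φ : Fin N → ℝ → ℝ → ℝ,
    (∀ α, ContDiffOn ℝ 1 (fun q : ℝ × ℝ => φ α q.1 q.2) (Ioo 0 T ×ˢ Ici 0)) →
    (∀ (α β : Fin N) (t : ℝ), φ α t 0 = φ β t 0) →
    (∀ (β : Fin N) (t x : ℝ), t ∈ Ioo 0 T → 0 ≤ x → u β t x ≤ φ β t x) →
    ((∀ (α : Fin N) (t x : ℝ), t ∈ Ioo 0 T → 0 < x → u α t x = φ α t x →
        deriv (fun s => φ α s x) t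
          + H α (derivWithin (fun y => φ α t y) (Ici 0) x) ≤ 0) ∧
     (∀ t : ℝ, t ∈ Ioo 0 T → (∀ α : Fin N, u α t 0 = φ α t 0) → ∀ α : Fin N,
        deriv (fun s => φ α s 0) t
          + sSup (Set.range fun β : Fin N =>
              Hm (H β) (p₀ β) (derivWithin (fun y => φ β t y) (Ici 0) 0)) ≤ 0)))

/-- Viscosity supersolution of (HJ) on the junction, on `J_T = (0,T) × J`. -/
def IsViscSuperSol {N : ℕ} (T : ℝ) (H : Fin N → ℝ → ℝ) (p₀ : Fin N → ℝ)
    (u : Fin N → ℝ → ℝ → ℝ) : Prop :=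
  (∀ α, LowerSemicontinuousOn (fun q : ℝ × ℝ => u α q.1 q.2) (Ico 0 T ×ˢ Ici 0)) ∧
  (∀ (α β : Fin N) (t : ℝ), u α t 0 = u β t 0) ∧
  (∀ φ : Fin N → ℝ → ℝ → ℝ,
    (∀ α, ContDiffOn ℝ 1 (fun q : ℝ × ℝ => φ α q.1 q.2) (Ioo 0 T ×ˢ Ici 0)) →
    (∀ (α β : Fin N) (t : ℝ), φ α t 0 = φ β t 0) →
    (∀ (β : Fin N) (t x : ℝ), t ∈ Ioo 0 T → 0 ≤ x → φ β t x ≤ u β t x) →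
    ((∀ (α : Fin N) (t x : ℝ), t ∈ Ioo 0 T → 0 < x → u α t x = φ α t x →
        0 ≤ deriv (fun s => φ α s x) t
          + H α (derivWithin (fun y => φ α t y) (Ici 0) x)) ∧
     (∀ t : ℝ, t ∈ Ioo 0 T → (∀ α : Fin N, u α t 0 = φ α t 0) → ∀ α : Fin N,
        0 ≤ deriv (fun s => φ α s 0) t
          + sSup (Set.range fun β : Fin N =>
              Hm (H β) (p₀ β) (derivWithin (fun y => φ β t y) (Ici 0) 0)))))

/-- Viscosity subsolution of (HJ)-(CI): subsolution of (HJ) on `J_T` with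
`u(0,·) ≤ u₀` on `J`. -/
def IsViscSubSolCI {N : ℕ} (T : ℝ) (H : Fin N → ℝ → ℝ) (p₀ : Fin N → ℝ)
    (u₀ : Fin N → ℝ → ℝ) (u : Fin N → ℝ → ℝ → ℝ) : Prop :=
  IsViscSubSol T H p₀ u ∧ ∀ (α : Fin N) (x : ℝ), 0 ≤ x → u α 0 x ≤ u₀ α x

/-- Viscosity supersolution of (HJ)-(CI): supersolution of (HJ) on `J_T` with
`u(0,·) ≥ u₀` on `J`. -/
def IsViscSuperSolCI {N : ℕ} (T : ℝ) (H : Fin N → ℝ → ℝ) (p₀ : Fin N → ℝ)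
    (u₀ : Fin N → ℝ → ℝ) (u : Fin N → ℝ → ℝ → ℝ) : Prop :=
  IsViscSuperSol T H p₀ u ∧ ∀ (α : Fin N) (x : ℝ), 0 ≤ x → u₀ α x ≤ u α 0 x

/-- Viscosity solution of (HJ)-(CI) on `[0,T) × J`. -/
def IsViscSolCI {N : ℕ} (T : ℝ) (H : Fin N → ℝ → ℝ) (p₀ : Fin N → ℝ)
    (u₀ : Fin N → ℝ → ℝ) (u : Fin N → ℝ → ℝ → ℝ) : Prop :=
  IsViscSubSolCI T H p₀ u₀ u ∧ IsViscSuperSolCI T H p₀ u₀ u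

/-- Assumption (A0): Lipschitz initial data on each branch, with a common value at the
junction point. -/
def A0cond {N : ℕ} (u₀ : Fin N → ℝ → ℝ) : Prop :=
  (∀ α, ∃ C : NNReal, LipschitzOnWith C (u₀ α) (Ici 0)) ∧
  (∀ α β : Fin N, u₀ α 0 = u₀ β 0)

/-- Assumption (A1′): each `H_α` is the Legendre–Fenchel transform of a uniformly convex
`C²` Lagrangian `L_α`, and `H⁻_α`, `H⁺_α` are the corresponding one-sided transforms. -/
def A1primeCond {N : ℕ} (H : Fin N → ℝ → ℝ) (p₀ : Fin N → ℝ) : Prop :=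
  ∃ (γ : ℝ) (L : Fin N → ℝ → ℝ), 0 < γ ∧
    (∀ α, ContDiff ℝ 2 (L α)) ∧
    (∀ (α : Fin N) (q : ℝ), γ ≤ deriv (deriv (L α)) q) ∧
    (∀ (α : Fin N) (p : ℝ), H α p = sSup (Set.range fun q : ℝ => p * q - L α q)) ∧
    (∀ (α : Fin N) (p : ℝ),
      Hm (H α) (p₀ α) p = sSup ((fun q : ℝ => p * q - L α q) '' Iic 0)) ∧
    (∀ (α : Fin N) (p : ℝ),
      Hp (H α) (p₀ α) p = sSup ((fun q : ℝ => p * q - L α q) '' Ici 0))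

/-- The CFL condition (CFL′) for the scheme (NS): `Δx/Δt` dominates `|H'_α|` on
`[p̲_α, p̄_α]`, where `p̲_α, p̄_α` are determined by the level `-m⁰`,
`m⁰ = inf_{β,i} W^{β,0}_i`. -/
def CFLprime {N : ℕ} (H : Fin N → ℝ → ℝ) (p₀ : Fin N → ℝ) (Δx Δt : ℝ)
    (U : Fin N → ℕ → ℕ → ℝ) : Prop :=
  ∀ α : Fin N, ∀ p ∈ Icc
      (sInf {p : ℝ | Hm (H α) (p₀ α) p =
        -(sInf (Set.range fun q : Fin N × ℕ => (U q.1 1 q.2 - U q.1 0 q.2) / Δt))})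
      (sSup {p : ℝ | Hp (H α) (p₀ α) p =
        -(sInf (Set.range fun q : Fin N × ℕ => (U q.1 1 q.2 - U q.1 0 q.2) / Δt))}),
    |deriv (H α) p| ≤ Δx / Δt

open scoped Topology

/-- A convex Hamiltonian `H` together with its strongly convex Lagrangian `L`: the Legendre
duality between the two and the regularity that the convergence proof uses. -/
structure LegendreDual (γ : ℝ) (L H : ℝ → ℝ) (p₀ : ℝ) : Prop where
  pos : 0 < γ
  contDiff_lagrangian : ContDiff ℝ 2 L
  strong_tangent : ∀ a b, L a + deriv L a * (b - a) + γ / 2 * (b - a) ^ 2 ≤ L b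
  contDiff_ham : ContDiff ℝ 1 H
  antitone : AntitoneOn H (Iic p₀)
  monotone : MonotoneOn H (Ici p₀)
  fenchel : ∀ p q, p * q - L q ≤ H p
  ham_le : ∀ p B, (∀ q, p * q - L q ≤ B) → H p ≤ B
  fenchel_neg : ∀ p q, q ≤ 0 → p * q - L q ≤ Hm H p₀ p
  fenchel_pos : ∀ p q, 0 ≤ q → p * q - L q ≤ Hp H p₀ p

lemma strong_tangent_of_deriv2_ge {γ : ℝ} {L : ℝ → ℝ} (hL : ContDiff ℝ 2 L)
    (h : ∀ q, γ ≤ deriv (deriv L) q) (a b : ℝ) :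
    L a + deriv L a * (b - a) + γ / 2 * (b - a) ^ 2 ≤ L b := by
  have hL1 : Differentiable ℝ L := hL.differentiable (by norm_num)
  have hL2 : Differentiable ℝ (deriv L) :=
    (hL.iterate_deriv' 1 1).differentiable (by norm_num)
  set G : ℝ → ℝ := fun q => L q - γ / 2 * q ^ 2 with hG
  have hd : ∀ q, HasDerivAt G (deriv L q - γ * q) q := fun q => by
    refine ((hL1 q).hasDerivAt.fun_sub ((hasDerivAt_pow 2 q).const_mul (γ / 2))).congr_deriv ?_
    push_cast
    ring
  have hd' : deriv G = fun q => deriv L q - γ * q := funext fun q => (hd q).deriv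
  have hd2 : ∀ q, HasDerivAt (deriv G) (deriv (deriv L) q - γ) q := fun q => by
    rw [hd']
    exact ((hL2 q).hasDerivAt.fun_sub ((hasDerivAt_id' q).const_mul γ)).congr_deriv (by ring)
  have hconv : ConvexOn ℝ univ G := by
    refine convexOn_of_deriv2_nonneg convex_univ
      (fun q _ => (hd q).continuousAt.continuousWithinAt)
      (fun q _ => (hd q).differentiableAt.differentiableWithinAt)
      (fun q _ => (hd2 q).differentiableAt.differentiableWithinAt) fun q _ => ?_
    simp only [Function.iterate_succ, Function.iterate_zero, Function.comp, id]
    rw [(hd2 q).deriv]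
    linarith [h q]
  have key : G a + (deriv L a - γ * a) * (b - a) ≤ G b := by
    rcases lt_trichotomy a b with hab | hab | hab
    · have := hconv.le_slope_of_hasDerivAt (mem_univ a) (mem_univ b) hab (hd a)
      rw [slope_def_field, le_div_iff₀ (by linarith)] at this
      linarith
    · subst hab; simp
    · have := hconv.slope_le_of_hasDerivAt (mem_univ b) (mem_univ a) hab (hd a)
      rw [slope_def_field, div_le_iff₀ (by linarith)] at this
      linarith
  simp only [hG] at key
  nlinarith [key]

lemma legendreDual_of_A1 {N : ℕ} {H : Fin N → ℝ → ℝ} {p₀ : Fin N → ℝ}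
    (hA1 : ∀ α, A1cond (H α) (p₀ α)) (hA1' : A1primeCond H p₀) :
    ∃ (γ : ℝ) (L : Fin N → ℝ → ℝ), ∀ α, LegendreDual γ (L α) (H α) (p₀ α) := by
  obtain ⟨γ, L, hγ, hL, hL2, hH, hHm, hHp⟩ := hA1'
  refine ⟨γ, L, fun α => ?_⟩
  have ht := strong_tangent_of_deriv2_ge (hL α) (hL2 α)
  have hb : ∀ p q, p * q - L α q ≤ (p - deriv (L α) 0) ^ 2 / (2 * γ) - L α 0 := fun p q => by
    have h1 := ht 0 q
    have h2 : (p - deriv (L α) 0) * q - γ / 2 * q ^ 2 ≤ (p - deriv (L α) 0) ^ 2 / (2 * γ) := by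
      rw [le_div_iff₀ (by positivity)]
      nlinarith [sq_nonneg (p - deriv (L α) 0 - γ * q)]
    nlinarith
  have hbs : ∀ p (s : Set ℝ), BddAbove ((fun q : ℝ => p * q - L α q) '' s) := fun p s =>
    ⟨_, by rintro _ ⟨q, -, rfl⟩; exact hb p q⟩
  obtain ⟨h1, -, h3, h4⟩ := hA1 α
  refine ⟨hγ, hL α, ht, h1, h3, h4, fun p q => ?_, fun p B h => ?_, fun p q hq => ?_,
    fun p q hq => ?_⟩
  · rw [hH α p, ← image_univ]
    exact le_csSup (hbs p _) ⟨q, mem_univ _, rfl⟩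
  · rw [hH α p]
    exact csSup_le (range_nonempty _) (by rintro _ ⟨q, rfl⟩; exact h q)
  · rw [hHm α p]
    exact le_csSup (hbs p _) ⟨q, hq, rfl⟩
  · rw [hHp α p]
    exact le_csSup (hbs p _) ⟨q, hq, rfl⟩

namespace LegendreDual

variable {γ : ℝ} {L H : ℝ → ℝ} {p₀ : ℝ}

lemma min_le (h : LegendreDual γ L H p₀) (p : ℝ) : H p₀ ≤ H p := by
  rcases le_total p p₀ with hp | hp
  · exact h.antitone hp (mem_Iic.2 le_rfl) hp
  · exact h.monotone (mem_Ici.2 le_rfl) hp hp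

lemma Hm_le (h : LegendreDual γ L H p₀) (p : ℝ) : Hm H p₀ p ≤ H p := by
  unfold Hm; split_ifs
  exacts [le_rfl, h.min_le p]

lemma Hp_le (h : LegendreDual γ L H p₀) (p : ℝ) : Hp H p₀ p ≤ H p := by
  unfold Hp; split_ifs
  exacts [h.min_le p, le_rfl]

lemma le_Hm (h : LegendreDual γ L H p₀) (p : ℝ) : H p₀ ≤ Hm H p₀ p := by
  unfold Hm; split_ifs
  exacts [h.min_le p, le_rfl]

lemma le_Hp (h : LegendreDual γ L H p₀) (p : ℝ) : H p₀ ≤ Hp H p₀ p := by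
  unfold Hp; split_ifs
  exacts [le_rfl, h.min_le p]

lemma ham_le_of_Hm_Hp {p B : ℝ} (hm : Hm H p₀ p ≤ B) (hp : Hp H p₀ p ≤ B) : H p ≤ B := by
  unfold Hm at hm; unfold Hp at hp
  split_ifs at hm hp <;> assumption

lemma convex_comb (h : LegendreDual γ L H p₀) {θ : ℝ} (h0 : 0 ≤ θ) (h1 : θ ≤ 1) (p r : ℝ) :
    H ((1 - θ) * p + θ * r) ≤ (1 - θ) * H p + θ * H r := by
  refine h.ham_le _ _ fun q => ?_
  have h2 := mul_le_mul_of_nonneg_left (h.fenchel p q) (sub_nonneg.2 h1)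
  have h3 := mul_le_mul_of_nonneg_left (h.fenchel r q) h0
  nlinarith

lemma ham_hasDerivAt (h : LegendreDual γ L H p₀) (p : ℝ) : HasDerivAt H (deriv H p) p :=
  (h.contDiff_ham.differentiable one_ne_zero p).hasDerivAt

lemma ham_tangent (h : LegendreDual γ L H p₀) (a p : ℝ) :
    H a + deriv H a * (p - a) ≤ H p := by
  have hconv : ConvexOn ℝ univ H := ⟨convex_univ, fun x _ y _ a b ha hb hab => by
    have := h.convex_comb hb (by linarith) x y
    have ha' : 1 - b = a := by linarith
    rw [ha'] at this
    simpa using this⟩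
  rcases lt_trichotomy a p with hab | hab | hab
  · have := hconv.le_slope_of_hasDerivAt (mem_univ a) (mem_univ p) hab (h.ham_hasDerivAt a)
    rw [slope_def_field, le_div_iff₀ (by linarith)] at this
    linarith
  · subst hab; simp
  · have := hconv.slope_le_of_hasDerivAt (mem_univ p) (mem_univ a) hab (h.ham_hasDerivAt a)
    rw [slope_def_field, div_le_iff₀ (by linarith)] at this
    linarith

lemma deriv_nonneg (h : LegendreDual γ L H p₀) {a : ℝ} (ha : p₀ < a) : 0 ≤ deriv H a := by
  have h1 := h.ham_tangent a p₀
  have h2 := h.min_le a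
  by_contra hc
  nlinarith [mul_pos_of_neg_of_neg (not_le.1 hc) (sub_neg.2 ha)]

lemma deriv_nonpos (h : LegendreDual γ L H p₀) {a : ℝ} (ha : a ≤ p₀) : deriv H a ≤ 0 := by
  by_contra hc
  push Not at hc
  rcases ha.eq_or_lt with rfl | ha
  · have h0 : IsLocalMin H a := Filter.Eventually.of_forall h.min_le
    linarith [h0.deriv_eq_zero]
  · have h1 := h.ham_tangent a p₀
    have h2 := h.min_le a
    nlinarith [mul_pos hc (sub_pos.2 ha)]

/-- The non-decreasing part of `H` has a nonnegative supporting slope at every point, bounded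
by the derivative of `H`. -/
lemma exists_slope_Hp (h : LegendreDual γ L H p₀) (a : ℝ) :
    ∃ q, 0 ≤ q ∧ q ≤ |deriv H a| ∧ ∀ p, Hp H p₀ a + q * (p - a) ≤ Hp H p₀ p := by
  rcases le_or_gt a p₀ with ha | ha
  · refine ⟨0, le_rfl, abs_nonneg _, fun p => ?_⟩
    have : Hp H p₀ a = H p₀ := if_pos ha
    simpa [this] using h.le_Hp p
  · have hq := h.deriv_nonneg ha
    refine ⟨deriv H a, hq, le_abs_self _, fun p => ?_⟩
    have h1 : Hp H p₀ a = H a := if_neg ha.not_ge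
    rw [h1]
    unfold Hp; split_ifs with hp
    · have := h.ham_tangent a p₀
      nlinarith [mul_le_mul_of_nonneg_left hp hq]
    · exact h.ham_tangent a p

lemma exists_slope_Hm (h : LegendreDual γ L H p₀) (a : ℝ) :
    ∃ q, q ≤ 0 ∧ -q ≤ |deriv H a| ∧ ∀ p, Hm H p₀ a + q * (p - a) ≤ Hm H p₀ p := by
  rcases le_or_gt a p₀ with ha | ha
  · have hq := h.deriv_nonpos ha
    refine ⟨deriv H a, hq, neg_le_abs _, fun p => ?_⟩
    have h1 : Hm H p₀ a = H a := if_pos ha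
    rw [h1]
    unfold Hm; split_ifs with hp
    · exact h.ham_tangent a p
    · have := h.ham_tangent a p₀
      nlinarith [mul_le_mul_of_nonpos_left (not_le.1 hp).le hq]
  · refine ⟨0, le_rfl, by simp, fun p => ?_⟩
    have : Hm H p₀ a = H p₀ := if_neg ha.not_ge
    simpa [this] using h.le_Hm p

/-- For bounded momenta, only bounded velocities matter in the Legendre transform. -/
lemma ham_le_of_bounded (h : LegendreDual γ L H p₀) {P p B : ℝ} (hp : |p| ≤ P)
    (hB : ∀ q, |q| ≤ 2 * (P + |deriv L 0|) / γ → p * q - L q ≤ B) : H p ≤ B := by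
  have hγ := h.pos
  have hP : 0 ≤ P := (abs_nonneg p).trans hp
  refine h.ham_le _ _ fun q => ?_
  by_cases hq : |q| ≤ 2 * (P + |deriv L 0|) / γ
  · exact hB q hq
  · push Not at hq
    rw [div_lt_iff₀ hγ] at hq
    have h0 := hB 0 (by simp only [abs_zero]; positivity)
    have h1 := h.strong_tangent 0 q
    have h2 : p * q ≤ P * |q| := by
      calc p * q ≤ |p * q| := le_abs_self _
        _ = |p| * |q| := abs_mul _ _
        _ ≤ P * |q| := by gcongr
    have h3 : -(deriv L 0 * q) ≤ |deriv L 0| * |q| := by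
      rw [← abs_mul]; exact neg_le_abs _
    have h4 : q ^ 2 = |q| * |q| := by rw [← sq, sq_abs]
    nlinarith [abs_nonneg q, mul_le_mul_of_nonneg_left hq.le (abs_nonneg q)]

/-- Momenta with bounded energy are bounded. -/
lemma exists_bound_of_ham_le (h : LegendreDual γ L H p₀) (M : ℝ) :
    ∃ P, 0 ≤ P ∧ ∀ p, H p ≤ M → |p| ≤ P := by
  refine ⟨max 0 (max (M + L 1) (M + L (-1))), le_max_left _ _, fun p hp => ?_⟩
  have h1 := h.fenchel p 1
  have h2 := h.fenchel p (-1)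
  refine (abs_le'.2 ⟨?_, ?_⟩).trans (le_max_right _ _)
  · exact le_max_of_le_left (by linarith)
  · exact le_max_of_le_right (by linarith)

end LegendreDual

/-- A family of continuous functions on `[0,T) × [0,∞)` has a common `C¹` minorant on
`(0,T) × [0,∞)`. -/
lemma exists_contDiffOn_minorant {N : ℕ} {T : ℝ} {v : Fin N → ℝ → ℝ → ℝ}
    (hv : ∀ α, ContinuousOn (fun q : ℝ × ℝ => v α q.1 q.2) (Ico 0 T ×ˢ Ici 0)) :
    ∃ g : ℝ → ℝ → ℝ, ContDiffOn ℝ 1 (fun q : ℝ × ℝ => g q.1 q.2) (Iio T ×ˢ univ) ∧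
      ∀ α t x, t ∈ Ioo 0 T → 0 ≤ x → g t x ≤ v α t x := by
  have hloc : ∀ r : ℝ, ∃ B : ℝ, ∀ α t x, t ∈ Ioo 0 T → 0 ≤ x → 1 / (T - t) + x ≤ r →
      B ≤ v α t x := by
    intro r
    have h1 : ∀ α, ∃ B : ℝ, ∀ t x, t ∈ Ioo 0 T → 0 ≤ x → 1 / (T - t) + x ≤ r →
        B ≤ v α t x := by
      intro α
      by_cases hr : 0 < r
      · have hK : IsCompact (Icc (0 : ℝ) (T - 1 / r) ×ˢ Icc (0 : ℝ) r) :=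
          isCompact_Icc.prod isCompact_Icc
        have hsub : Icc (0 : ℝ) (T - 1 / r) ×ˢ Icc (0 : ℝ) r ⊆ Ico 0 T ×ˢ Ici 0 := by
          rintro ⟨t, x⟩ ⟨ht, hx⟩
          have : 0 < 1 / r := by positivity
          exact ⟨⟨ht.1, by linarith [ht.2]⟩, hx.1⟩
        obtain ⟨B, hB⟩ := (hK.image_of_continuousOn ((hv α).mono hsub)).bddBelow
        refine ⟨B, fun t x ht hx htx => hB ⟨(t, x), ⟨⟨ht.1.le, ?_⟩, hx, ?_⟩, rfl⟩⟩
        · have h0 : 0 < T - t := by linarith [ht.2]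
          have h2 : 1 / (T - t) ≤ r := by linarith
          have := one_div_le_one_div_of_le (by positivity) h2
          rw [one_div_one_div] at this
          simp only
          linarith
        · have : 0 < 1 / (T - t) := by
            have h0 : 0 < T - t := by linarith [ht.2]
            positivity
          simp only
          linarith
      · refine ⟨0, fun t x ht hx htx => absurd ?_ hr⟩
        have : 0 < 1 / (T - t) := by
          have h0 : 0 < T - t := by linarith [ht.2]
          positivity
        linarith
    choose B hB using h1
    obtain ⟨b, hb⟩ := (Set.finite_range B).bddBelow
    exact ⟨b, fun α t x ht hx htx => (hb ⟨α, rfl⟩).trans (hB α t x ht hx htx)⟩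
  obtain ⟨G, hG⟩ := exists_contMDiffMap_forall_mem_convex_of_local_const
    (I := modelWithCornersSelf ℝ ℝ) (n := 1) (M := ℝ) (F := ℝ)
    (t := fun r => {c : ℝ | ∀ α t x, t ∈ Ioo 0 T → 0 ≤ x → 1 / (T - t) + x ≤ r → c ≤ v α t x})
    (fun r => by
      intro c hc d hd a b ha hb hab α t x ht hx htx
      have h1 := hc α t x ht hx htx
      have h2 := hd α t x ht hx htx
      simp only [smul_eq_mul]
      have h3 : v α t x = a * v α t x + b * v α t x := by rw [← add_mul, hab, one_mul]
      rw [h3]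
      gcongr)
    (fun r => by
      obtain ⟨B, hB⟩ := hloc (r + 1)
      refine ⟨B, ?_⟩
      filter_upwards [Iio_mem_nhds (show r < r + 1 by linarith)] with s hs α t x ht hx htx
      exact hB α t x ht hx (htx.trans (le_of_lt hs)))
  refine ⟨fun t x => G (1 / (T - t) + x), ?_, fun α t x ht hx => hG _ α t x ht hx le_rfl⟩
  have hG1 : ContDiff ℝ 1 (G : ℝ → ℝ) := G.contMDiff.contDiff
  refine hG1.comp_contDiffOn (ContDiffOn.add ?_ contDiff_snd.contDiffOn)
  refine contDiffOn_const.div (contDiffOn_const.sub contDiff_fst.contDiffOn) ?_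
  rintro ⟨t, x⟩ ⟨ht, -⟩
  exact (sub_pos.2 ht).ne'

/-- A local test function from below can be replaced by a global one. -/
lemma exists_global_test {N : ℕ} {T : ℝ} {v : Fin N → ℝ → ℝ → ℝ}
    (hv : ∀ α, ContinuousOn (fun q : ℝ × ℝ => v α q.1 q.2) (Ico 0 T ×ˢ Ici 0))
    (P : ℝ × ℝ) (S : Fin N → Prop) (φ : Fin N → ℝ → ℝ → ℝ)
    (hφ : ∀ α, S α → ContDiffAt ℝ 1 (fun q : ℝ × ℝ => φ α q.1 q.2) P)
    (hle : ∀ α, S α → ∀ᶠ q : ℝ × ℝ in 𝓝 P, 0 ≤ q.2 → φ α q.1 q.2 ≤ v α q.1 q.2)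
    (hjunc : ∀ᶠ q : ℝ × ℝ in 𝓝 P, q.2 = 0 →
      ∀ α β, S α ∧ S β ∧ φ α q.1 q.2 = φ β q.1 q.2) :
    ∃ ψ : Fin N → ℝ → ℝ → ℝ,
      (∀ α, ContDiffOn ℝ 1 (fun q : ℝ × ℝ => ψ α q.1 q.2) (Ioo 0 T ×ˢ Ici 0)) ∧
      (∀ (α β : Fin N) (t : ℝ), ψ α t 0 = ψ β t 0) ∧
      (∀ (α : Fin N) (t x : ℝ), t ∈ Ioo 0 T → 0 ≤ x → ψ α t x ≤ v α t x) ∧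
      ∀ α, S α → (fun q : ℝ × ℝ => ψ α q.1 q.2) =ᶠ[𝓝 P] fun q => φ α q.1 q.2 := by
  classical
  obtain ⟨g, hg, hgv⟩ := exists_contDiffOn_minorant hv
  have hO : ∀ᶠ q : ℝ × ℝ in 𝓝 P,
      (∀ α, S α → ContDiffAt ℝ 1 (fun q : ℝ × ℝ => φ α q.1 q.2) q) ∧
      (∀ α, S α → 0 ≤ q.2 → φ α q.1 q.2 ≤ v α q.1 q.2) ∧
      (q.2 = 0 → ∀ α β, S α ∧ S β ∧ φ α q.1 q.2 = φ β q.1 q.2) := by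
    refine Eventually.and ?_ (Eventually.and ?_ hjunc)
    · rw [eventually_all]
      intro α
      by_cases hα : S α
      · filter_upwards [(hφ α hα).eventually (by simp)] with q hq _ using hq
      · exact Eventually.of_forall fun q h => absurd h hα
    · rw [eventually_all]
      intro α
      by_cases hα : S α
      · filter_upwards [hle α hα] with q hq _ using hq
      · exact Eventually.of_forall fun q h => absurd h hα
  obtain ⟨r, hr, hrO⟩ := Metric.eventually_nhds_iff_ball.1 hO
  let χ : ContDiffBump P := ⟨r / 4, r / 2, by positivity, by linarith⟩
  have hχ : ∀ q : ℝ × ℝ, q ∉ Metric.ball P r → (fun q => χ q) =ᶠ[𝓝 q] fun _ => 0 := by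
    intro q hq
    have : q ∉ tsupport χ := by
      rw [χ.tsupport_eq]
      intro h
      refine hq (Metric.closedBall_subset_ball ?_ h)
      show r / 2 < r
      linarith
    exact notMem_tsupport_iff_eventuallyEq.1 this
  refine ⟨fun α t x => if S α then χ (t, x) * φ α t x + (1 - χ (t, x)) * g t x else g t x,
    fun α => ?_, fun α β t => ?_, fun α t x ht hx => ?_, fun α hα => ?_⟩
  · have hg' : ContDiffOn ℝ 1 (fun q : ℝ × ℝ => g q.1 q.2) (Ioo 0 T ×ˢ Ici 0) :=
      hg.mono (prod_mono (fun t ht => ht.2) (subset_univ _))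
    by_cases hα : S α
    · simp only [if_pos hα]
      refine ContDiffOn.add (ContDiff.contDiffOn (contDiff_iff_contDiffAt.2 fun q => ?_))
        ((contDiffOn_const.sub χ.contDiff.contDiffOn).mul hg')
      by_cases hq : q ∈ Metric.ball P r
      · exact χ.contDiff.contDiffAt.mul ((hrO q hq).1 α hα)
      · have : (fun q : ℝ × ℝ => χ (q.1, q.2) * φ α q.1 q.2) =ᶠ[𝓝 q] fun _ => 0 := by
          filter_upwards [hχ q hq] with p hp
          simp [hp]
        exact contDiffAt_const.congr_of_eventuallyEq this
    · simpa only [if_neg hα] using hg'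
  · by_cases hq : ((t, 0) : ℝ × ℝ) ∈ Metric.ball P r
    · obtain ⟨h1, h2, h3⟩ := (hrO _ hq).2.2 rfl α β
      simp only [if_pos h1, if_pos h2]
      rw [h3]
    · have : χ (t, 0) = 0 := (hχ _ hq).eq_of_nhds
      simp [this]
  · have hgx := hgv α t x ht hx
    by_cases hα : S α
    · simp only [if_pos hα]
      have h0 := χ.nonneg (x := (t, x))
      have h1 := χ.le_one (x := (t, x))
      by_cases hq : ((t, x) : ℝ × ℝ) ∈ Metric.ball P r
      · have h2 := (hrO _ hq).2.1 α hα hx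
        simp only at h2
        have h3 := mul_le_mul_of_nonneg_left h2 h0
        have h4 := mul_le_mul_of_nonneg_left hgx (sub_nonneg.2 h1)
        linarith
      · have : χ (t, x) = 0 := (hχ _ hq).eq_of_nhds
        simpa [this] using hgx
    · simpa only [if_neg hα] using hgx
  · simp only [if_pos hα]
    filter_upwards [χ.eventuallyEq_one] with q hq
    have : χ (q.1, q.2) = 1 := hq
    simp [this]

lemma eventuallyEq_slice_left {f g : ℝ → ℝ → ℝ} {P : ℝ × ℝ}
    (h : (fun q : ℝ × ℝ => f q.1 q.2) =ᶠ[𝓝 P] fun q => g q.1 q.2) :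
    (fun s => f s P.2) =ᶠ[𝓝 P.1] fun s => g s P.2 := by
  have hc : Tendsto (fun s : ℝ => (s, P.2)) (𝓝 P.1) (𝓝 P) :=
    (Continuous.prodMk_left P.2).tendsto' _ _ rfl
  exact hc.eventually h

lemma eventuallyEq_slice_right {f g : ℝ → ℝ → ℝ} {P : ℝ × ℝ}
    (h : (fun q : ℝ × ℝ => f q.1 q.2) =ᶠ[𝓝 P] fun q => g q.1 q.2) :
    (fun y => f P.1 y) =ᶠ[𝓝 P.2] fun y => g P.1 y := by
  have hc : Tendsto (fun y : ℝ => (P.1, y)) (𝓝 P.2) (𝓝 P) :=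
    (Continuous.prodMk_right P.1).tendsto' _ _ rfl
  exact hc.eventually h

lemma IsViscSolCI.continuousOn {N : ℕ} {T : ℝ} {H : Fin N → ℝ → ℝ} {p₀ : Fin N → ℝ}
    {u₀ : Fin N → ℝ → ℝ} {u : Fin N → ℝ → ℝ → ℝ} (hu : IsViscSolCI T H p₀ u₀ u) (α : Fin N) :
    ContinuousOn (fun q : ℝ × ℝ => u α q.1 q.2) (Ico 0 T ×ˢ Ici 0) :=
  continuousOn_iff_lower_upperSemicontinuousOn.2 ⟨hu.2.1.1 α, hu.1.1.1 α⟩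

lemma IsViscSolCI.initial {N : ℕ} {T : ℝ} {H : Fin N → ℝ → ℝ} {p₀ : Fin N → ℝ}
    {u₀ : Fin N → ℝ → ℝ} {u : Fin N → ℝ → ℝ → ℝ} (hu : IsViscSolCI T H p₀ u₀ u) (α : Fin N)
    {x : ℝ} (hx : 0 ≤ x) : u α 0 x = u₀ α x :=
  le_antisymm (hu.1.2 α x hx) (hu.2.2 α x hx)

/-- Local test functions from above at interior points of a branch. -/
lemma IsViscSolCI.sub_interior {N : ℕ} {T : ℝ} {H : Fin N → ℝ → ℝ} {p₀ : Fin N → ℝ}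
    {u₀ : Fin N → ℝ → ℝ} {u : Fin N → ℝ → ℝ → ℝ} (hu : IsViscSolCI T H p₀ u₀ u) {α : Fin N}
    {t x a b : ℝ} (ht : t ∈ Ioo 0 T) (hx : 0 < x) {φ : ℝ → ℝ → ℝ}
    (hφ : ContDiffAt ℝ 1 (fun q : ℝ × ℝ => φ q.1 q.2) (t, x))
    (hle : ∀ᶠ q : ℝ × ℝ in 𝓝 (t, x), u α q.1 q.2 ≤ φ q.1 q.2) (heq : u α t x = φ t x)
    (ha : HasDerivAt (fun s => φ s x) a t) (hb : HasDerivAt (fun y => φ t y) b x) :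
    a + H α b ≤ 0 := by
  obtain ⟨ψ, h1, h2, h3, h4⟩ := exists_global_test (T := T) (v := fun α t x => -u α t x)
    (fun β => (hu.continuousOn β).neg) (t, x) (fun β => β = α)
    (fun _ t x => -φ t x) (fun β _ => hφ.neg)
    (fun β hβ => by subst hβ; filter_upwards [hle] with q hq _ using neg_le_neg hq)
    (by
      have : ∀ᶠ q : ℝ × ℝ in 𝓝 (t, x), 0 < q.2 :=
        continuous_snd.continuousAt.eventually (Ioi_mem_nhds hx)
      filter_upwards [this] with q hq hq0
      exact absurd hq0 hq.ne')
  have h5 := h4 α rfl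
  have h6 := eventuallyEq_slice_left (f := ψ α) (g := fun s y => -φ s y) h5
  have h7 := eventuallyEq_slice_right (f := ψ α) (g := fun s y => -φ s y) h5
  have hψa : HasDerivAt (fun s => -ψ α s x) a t := ha.congr_of_eventuallyEq (by
    filter_upwards [h6] with s hs
    rw [hs, neg_neg])
  have hψb : HasDerivAt (fun y => -ψ α t y) b x := hb.congr_of_eventuallyEq (by
    filter_upwards [h7] with s hs
    rw [hs, neg_neg])
  have key := (hu.1.1.2.2 (fun α t x => -ψ α t x) (fun β => (h1 β).neg)
    (fun β β' s => by rw [h2 β β' s])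
    (fun β s y hs hy => by linarith [h3 β s y hs hy])).1 α t x ht hx
    (by have := h5.eq_of_nhds; simp only at this; rw [this, neg_neg, heq])
  rwa [hψa.deriv, hψb.hasDerivWithinAt.derivWithin (uniqueDiffOn_Ici _ x hx.le)] at key

/-- Local test functions from below at interior points of a branch. -/
lemma IsViscSolCI.super_interior {N : ℕ} {T : ℝ} {H : Fin N → ℝ → ℝ} {p₀ : Fin N → ℝ}
    {u₀ : Fin N → ℝ → ℝ} {u : Fin N → ℝ → ℝ → ℝ} (hu : IsViscSolCI T H p₀ u₀ u) {α : Fin N}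
    {t x a b : ℝ} (ht : t ∈ Ioo 0 T) (hx : 0 < x) {φ : ℝ → ℝ → ℝ}
    (hφ : ContDiffAt ℝ 1 (fun q : ℝ × ℝ => φ q.1 q.2) (t, x))
    (hle : ∀ᶠ q : ℝ × ℝ in 𝓝 (t, x), φ q.1 q.2 ≤ u α q.1 q.2) (heq : u α t x = φ t x)
    (ha : HasDerivAt (fun s => φ s x) a t) (hb : HasDerivAt (fun y => φ t y) b x) :
    0 ≤ a + H α b := by
  obtain ⟨ψ, h1, h2, h3, h4⟩ := exists_global_test (T := T) (v := u)
    hu.continuousOn (t, x) (fun β => β = α) (fun _ => φ) (fun β _ => hφ)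
    (fun β hβ => by subst hβ; filter_upwards [hle] with q hq _ using hq)
    (by
      have : ∀ᶠ q : ℝ × ℝ in 𝓝 (t, x), 0 < q.2 :=
        continuous_snd.continuousAt.eventually (Ioi_mem_nhds hx)
      filter_upwards [this] with q hq hq0
      exact absurd hq0 hq.ne')
  have h5 := h4 α rfl
  have hψa := ha.congr_of_eventuallyEq (eventuallyEq_slice_left h5)
  have hψb := hb.congr_of_eventuallyEq (eventuallyEq_slice_right h5)
  have key := (hu.2.1.2.2 ψ h1 h2 h3).1 α t x ht hx (heq.trans h5.eq_of_nhds.symm)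
  rwa [hψa.deriv, hψb.hasDerivWithinAt.derivWithin (uniqueDiffOn_Ici _ x hx.le)] at key

/-- Local test functions from below at the junction point. -/
lemma IsViscSolCI.super_junction {N : ℕ} (hN : 1 ≤ N) {T : ℝ} {H : Fin N → ℝ → ℝ}
    {p₀ : Fin N → ℝ} {u₀ : Fin N → ℝ → ℝ} {u : Fin N → ℝ → ℝ → ℝ}
    (hu : IsViscSolCI T H p₀ u₀ u) {t : ℝ} {a b : Fin N → ℝ} (ht : t ∈ Ioo 0 T)
    {φ : Fin N → ℝ → ℝ → ℝ}
    (hφ : ∀ α, ContDiffAt ℝ 1 (fun q : ℝ × ℝ => φ α q.1 q.2) (t, 0))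
    (hle : ∀ α, ∀ᶠ q : ℝ × ℝ in 𝓝 (t, 0), 0 ≤ q.2 → φ α q.1 q.2 ≤ u α q.1 q.2)
    (hjunc : ∀ α β, ∀ᶠ s in 𝓝 t, φ α s 0 = φ β s 0)
    (heq : ∀ α, u α t 0 = φ α t 0) (ha : ∀ α, HasDerivAt (fun s => φ α s 0) (a α) t)
    (hb : ∀ α, HasDerivAt (fun y => φ α t y) (b α) 0) :
    ∃ α, 0 ≤ a α + Hm (H α) (p₀ α) (b α) := by
  obtain ⟨ψ, h1, h2, h3, h4⟩ := exists_global_test (T := T) (v := u)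
    hu.continuousOn (t, 0) (fun _ => True) φ (fun β _ => hφ β)
    (fun β _ => hle β)
    (by
      have : ∀ᶠ s in 𝓝 t, ∀ α β, φ α s 0 = φ β s 0 :=
        eventually_all.2 fun α => eventually_all.2 fun β => hjunc α β
      filter_upwards [(continuous_fst.tendsto' (t, (0 : ℝ)) t rfl).eventually this]
        with q hq hq0 α β
      rw [hq0]
      exact ⟨trivial, trivial, hq α β⟩)
  have hψa := fun α => (ha α).congr_of_eventuallyEq (eventuallyEq_slice_left (h4 α trivial))
  have hψb := fun α => (hb α).congr_of_eventuallyEq (eventuallyEq_slice_right (h4 α trivial))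
  have hd : ∀ α, derivWithin (fun y => ψ α t y) (Ici 0) 0 = b α := fun α =>
    (hψb α).hasDerivWithinAt.derivWithin (uniqueDiffOn_Ici _ 0 (mem_Ici.2 le_rfl))
  have : Nonempty (Fin N) := ⟨⟨0, hN⟩⟩
  obtain ⟨β, hβ⟩ := (range_nonempty fun β : Fin N => Hm (H β) (p₀ β) (b β)).csSup_mem
    (finite_range _)
  have key := (hu.2.1.2.2 ψ h1 h2 h3).2 t ht
    (fun α => (heq α).trans (h4 α trivial).eq_of_nhds.symm) β
  simp only [hd] at key
  rw [← hβ, (hψa β).deriv] at key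
  exact ⟨β, key⟩

/-- The dynamic programming inequality along straight lines inside one branch. -/
lemma IsViscSolCI.le_add_lagrangian_of_pos {N : ℕ} {T : ℝ} {H : Fin N → ℝ → ℝ} {p₀ : Fin N → ℝ}
    {u₀ : Fin N → ℝ → ℝ} {u : Fin N → ℝ → ℝ → ℝ} (hu : IsViscSolCI T H p₀ u₀ u)
    {γ : ℝ} {L : Fin N → ℝ → ℝ} {α : Fin N} (hL : LegendreDual γ (L α) (H α) (p₀ α))
    {s t x y : ℝ} (hs : 0 ≤ s) (hst : s < t) (ht : t < T) (hx : 0 < x) (hy : 0 < y) :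
    u α t x ≤ u α s y + (t - s) * L α ((x - y) / (t - s)) := by
  by_contra! hlt
  have hts : 0 < t - s := sub_pos.2 hst
  set q := (x - y) / (t - s) with hq
  have hqx : y + q * (t - s) = x := by rw [hq]; field_simp; ring
  obtain ⟨d, hd0, hd⟩ : ∃ d, 0 < d ∧ u α s y + (t - s) * L α q + 4 * d ≤ u α t x :=
    ⟨(u α t x - (u α s y + (t - s) * L α q)) / 4, by linarith, by linarith⟩
  obtain ⟨σ, hσ0, hσ⟩ : ∃ σ, 0 < σ ∧ (t - s) * σ = d := ⟨d / (t - s), by positivity, by field_simp⟩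
  obtain ⟨t2, ht2, ht2T, hX2⟩ : ∃ t2, t < t2 ∧ t2 < T ∧ 0 < x + q * (t2 - t) := by
    have h1 : ∀ᶠ t2 in 𝓝 t, 0 < x + q * (t2 - t) :=
      (show Continuous fun t2 => x + q * (t2 - t) by fun_prop).continuousAt.eventually
        (Ioi_mem_nhds (by simpa using hx))
    have h2 : ∀ᶠ t2 in 𝓝[>] t, t < t2 := self_mem_nhdsWithin
    obtain ⟨t2, h3, h4, h5⟩ :=
      (h2.and (((eventually_lt_nhds ht).and h1).filter_mono nhdsWithin_le_nhds)).exists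
    exact ⟨t2, h3, h4, h5⟩
  have hcont := hu.continuousOn α
  obtain ⟨r, hr0, hry, hrX, hr⟩ : ∃ r, 0 < r ∧ r < y ∧ r < x + q * (t2 - t) ∧
      ∀ z, |z| ≤ r → u α s (y + z) ≤ u α s y + d := by
    have h1 : ContinuousAt (fun z : ℝ => u α s (y + z)) 0 := by
      have h2 : ContinuousOn (fun z : ℝ => u α s (y + z)) (Ioi (-y)) :=
        hcont.comp (f := fun z : ℝ => (s, y + z)) (by fun_prop) fun z hz =>
          ⟨⟨hs, hst.trans ht⟩, by have := mem_Ioi.1 hz; show 0 ≤ y + z; linarith⟩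
      exact h2.continuousAt (Ioi_mem_nhds (by linarith))
    have h3 : ∀ᶠ z in 𝓝 (0 : ℝ), u α s (y + z) ≤ u α s y + d :=
      (h1.eventually (Iio_mem_nhds (show u α s (y + 0) < u α s y + d by
        rw [add_zero]; linarith))).mono fun z hz => le_of_lt hz
    obtain ⟨r, hr, hr'⟩ := Metric.eventually_nhds_iff_ball.1 h3
    refine ⟨min (r / 2) (min (y / 2) ((x + q * (t2 - t)) / 2)), by positivity, ?_, ?_, ?_⟩
    · exact ((min_le_right _ _).trans (min_le_left _ _)).trans_lt (by linarith)
    · exact ((min_le_right _ _).trans (min_le_right _ _)).trans_lt (by linarith)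
    · intro z hz
      refine hr' z ?_
      rw [mem_ball_zero_iff, Real.norm_eq_abs]
      exact (hz.trans (min_le_left _ _)).trans_lt (by linarith)
  have hXpos : ∀ τ ∈ Icc s t2, r < y + q * (τ - s) := by
    intro τ hτ
    rcases le_total 0 q with h | h
    · nlinarith [hτ.1]
    · nlinarith [hτ.2, hqx]
  set K : Set (ℝ × ℝ) := Icc s t2 ×ˢ Icc (-r) r with hK
  have hKc : IsCompact K := isCompact_Icc.prod isCompact_Icc
  have hmaps : MapsTo (fun P : ℝ × ℝ => (P.1, y + q * (P.1 - s) + P.2)) K (Ico 0 T ×ˢ Ici 0) :=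
    fun P hP => ⟨⟨hs.trans hP.1.1, hP.1.2.trans_lt ht2T⟩, by
      have := hXpos _ hP.1
      show 0 ≤ y + q * (P.1 - s) + P.2
      linarith [hP.2.1]⟩
  have hG : ContinuousOn (fun P : ℝ × ℝ => u α P.1 (y + q * (P.1 - s) + P.2)
      - (P.1 - s) * (L α q + σ)) K :=
    (hcont.comp (f := fun P : ℝ × ℝ => (P.1, y + q * (P.1 - s) + P.2)) (by fun_prop) hmaps).sub
      (by fun_prop)
  obtain ⟨B, hB⟩ := hKc.exists_bound_of_continuousOn hG
  have hB' : ∀ P ∈ K, u α P.1 (y + q * (P.1 - s) + P.2) - (P.1 - s) * (L α q + σ) ≤ B :=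
    fun P hP => (abs_le.1 (hB P hP)).2
  have hBs : -B ≤ u α s y := by
    have := (abs_le.1 (hB (s, 0) ⟨⟨le_rfl, by linarith⟩, ⟨by simp [hr0.le], hr0.le⟩⟩)).1
    simpa using this
  have hB0 : 0 ≤ B := (norm_nonneg _).trans
    (hB (s, 0) ⟨⟨le_rfl, by linarith⟩, ⟨by simp [hr0.le], hr0.le⟩⟩)
  obtain ⟨A, hA⟩ : ∃ A, A * r ^ 2 = 2 * B := ⟨2 * B / r ^ 2, by field_simp⟩
  have hA0 : 0 ≤ A := by
    by_contra! h
    nlinarith [pow_pos hr0 2]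
  obtain ⟨m, hm0, hm⟩ : ∃ m, 0 ≤ m ∧ d * (m * (t2 - t)) = 2 * B :=
    ⟨2 * B / (d * (t2 - t)), by
      have := sub_pos.2 ht2
      positivity, by
      have := (sub_pos.2 ht2).ne'
      field_simp⟩
  set Θ : ℝ × ℝ → ℝ := fun P => u α P.1 (y + q * (P.1 - s) + P.2) - (P.1 - s) * (L α q + σ)
    - A * P.2 ^ 2 - d * Real.exp (m * (P.1 - t)) with hΘ
  have hΘc : ContinuousOn Θ K := (hG.sub (by fun_prop)).sub (by fun_prop)
  obtain ⟨⟨τ, z⟩, hPK, hmax⟩ := hKc.exists_isMaxOn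
    ⟨(s, 0), ⟨⟨le_rfl, by linarith⟩, ⟨by simp [hr0.le], hr0.le⟩⟩⟩ hΘc
  have hbig : u α s y + 2 * d ≤ Θ (τ, z) := by
    have h1 := hmax (show ((t, 0) : ℝ × ℝ) ∈ K from
      ⟨⟨hst.le, ht2.le⟩, ⟨by simp [hr0.le], hr0.le⟩⟩)
    have h2 : Θ (t, 0) = u α t x - (t - s) * L α q - (t - s) * σ - d := by
      simp only [hΘ, add_zero, hqx, sub_self, mul_zero, Real.exp_zero]
      ring
    simp only [mem_ofPred_eq] at h1
    linarith
  have hexp : ∀ τ, 0 < d * Real.exp (m * (τ - t)) := fun τ => by positivity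
  have hGP := hB' _ hPK
  have hΘP : Θ (τ, z) = u α τ (y + q * (τ - s) + z) - (τ - s) * (L α q + σ)
    - A * z ^ 2 - d * Real.exp (m * (τ - t)) := rfl
  simp only at hGP
  have hAz : 0 ≤ A * z ^ 2 := by positivity
  have hτs : s < τ := by
    refine lt_of_le_of_ne hPK.1.1 fun h => ?_
    have h1 := hr z (abs_le.2 hPK.2)
    subst h
    have := hexp s
    simp only [sub_self, mul_zero, zero_mul, add_zero] at hΘP
    linarith
  have hτ2 : τ < t2 := by
    refine lt_of_le_of_ne hPK.1.2 fun h => ?_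
    subst h
    have h1 := mul_le_mul_of_nonneg_left (Real.add_one_le_exp (m * (τ - t))) hd0.le
    linarith
  have hzr : z ^ 2 ≠ r ^ 2 := by
    intro h
    rw [h] at hΘP
    have := hexp τ
    linarith
  have hz1 : -r < z := lt_of_le_of_ne hPK.2.1 fun h => hzr (by rw [← h]; ring)
  have hz2 : z < r := lt_of_le_of_ne hPK.2.2 fun h => hzr (by rw [h])
  set φ : ℝ → ℝ → ℝ := fun τ' x' => Θ (τ, z) + ((τ' - s) * (L α q + σ)
    + A * (x' - (y + q * (τ' - s))) ^ 2 + d * Real.exp (m * (τ' - t))) with hφ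
  have hx0 : 0 < y + q * (τ - s) + z := by linarith [hXpos τ hPK.1]
  have key := hu.sub_interior (α := α) (t := τ) (x := y + q * (τ - s) + z)
    (φ := φ) (a := (L α q + σ) + A * (2 * z * -q) + d * (Real.exp (m * (τ - t)) * m))
    (b := A * (2 * z)) ⟨hs.trans_lt hτs, hτ2.trans ht2T⟩ hx0
    (by
      simp only [hφ]
      exact ContDiff.contDiffAt (by fun_prop)) ?_ ?_ ?_ ?_
  · have h1 := hL.fenchel (A * (2 * z)) q
    have h2 : 0 ≤ d * (Real.exp (m * (τ - t)) * m) := by positivity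
    nlinarith
  · have h1 : ∀ᶠ P : ℝ × ℝ in 𝓝 (τ, y + q * (τ - s) + z), P.1 ∈ Ioo s t2 :=
      continuous_fst.continuousAt.eventually (Ioo_mem_nhds hτs hτ2)
    have h2 : ∀ᶠ P : ℝ × ℝ in 𝓝 (τ, y + q * (τ - s) + z), P.2 - (y + q * (P.1 - s)) ∈ Ioo (-r) r :=
      (show Continuous fun P : ℝ × ℝ => P.2 - (y + q * (P.1 - s)) by
        fun_prop).continuousAt.eventually (Ioo_mem_nhds (by simpa using hz1) (by simpa using hz2))
    filter_upwards [h1, h2] with P hP1 hP2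
    have := hmax (show ((P.1, P.2 - (y + q * (P.1 - s))) : ℝ × ℝ) ∈ K from
      ⟨Ioo_subset_Icc_self hP1, Ioo_subset_Icc_self hP2⟩)
    simp only [mem_ofPred_eq, hΘ, add_sub_cancel] at this
    simp only [hφ, hΘ]
    linarith
  · simp only [hφ, hΘP]
    ring
  · have e1 : HasDerivAt (fun τ' : ℝ => (τ' - s) * (L α q + σ)) (L α q + σ) τ := by
      simpa using ((hasDerivAt_id' τ).sub_const s).mul_const (L α q + σ)
    have e2 : HasDerivAt (fun τ' : ℝ => y + q * (τ - s) + z - (y + q * (τ' - s))) (-q) τ := by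
      simpa using ((((hasDerivAt_id' τ).sub_const s).const_mul q).const_add y).const_sub
        (y + q * (τ - s) + z)
    have e3 : HasDerivAt (fun τ' : ℝ => d * Real.exp (m * (τ' - t)))
        (d * (Real.exp (m * (τ - t)) * m)) τ := by
      simpa using ((((hasDerivAt_id' τ).sub_const t).const_mul m).exp).const_mul d
    refine (((e1.add ((e2.pow 2).const_mul A)).add e3).const_add (Θ (τ, z))).congr_deriv ?_
    push_cast
    ring
  · have e2 : HasDerivAt (fun x' : ℝ => x' - (y + q * (τ - s))) 1 (y + q * (τ - s) + z) :=
      (hasDerivAt_id' _).sub_const _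
    refine (((((e2.pow 2).const_mul A).const_add ((τ - s) * (L α q + σ))).add_const
      (d * Real.exp (m * (τ - t)))).const_add (Θ (τ, z))).congr_deriv ?_
    push_cast
    ring

lemma IsViscSolCI.le_add_lagrangian {N : ℕ} {T : ℝ} {H : Fin N → ℝ → ℝ} {p₀ : Fin N → ℝ}
    {u₀ : Fin N → ℝ → ℝ} {u : Fin N → ℝ → ℝ → ℝ} (hu : IsViscSolCI T H p₀ u₀ u)
    {γ : ℝ} {L : Fin N → ℝ → ℝ} {α : Fin N} (hL : LegendreDual γ (L α) (H α) (p₀ α))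
    {s t x y : ℝ} (hs : 0 ≤ s) (hst : s < t) (ht : t < T) (hx : 0 ≤ x) (hy : 0 ≤ y) :
    u α t x ≤ u α s y + (t - s) * L α ((x - y) / (t - s)) := by
  have hlim : ∀ τ z, 0 ≤ τ → τ < T → 0 ≤ z →
      Tendsto (fun h : ℝ => u α τ (z + h)) (𝓝[>] 0) (𝓝 (u α τ z)) := by
    intro τ z hτ hτT hz
    have h1 : ContinuousOn (fun h : ℝ => u α τ (z + h)) (Ici 0) :=
      (hu.continuousOn α).comp (f := fun h : ℝ => (τ, z + h)) (by fun_prop) fun h hh =>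
        ⟨⟨hτ, hτT⟩, by have := mem_Ici.1 hh; show 0 ≤ z + h; linarith⟩
    have h2 := (h1 0 (mem_Ici.2 le_rfl)).tendsto
    rw [add_zero] at h2
    exact h2.mono_left (nhdsWithin_mono _ Ioi_subset_Ici_self)
  refine le_of_tendsto_of_tendsto (hlim t x (hs.trans hst.le) ht hx)
    ((hlim s y hs (hst.trans ht) hy).add_const _) ?_
  filter_upwards [self_mem_nhdsWithin] with h hh
  have hh0 : 0 < h := hh
  have := hu.le_add_lagrangian_of_pos hL (x := x + h) (y := y + h) hs hst ht
    (by linarith) (by linarith)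
  rwa [add_sub_add_right_eq_sub] at this

/-- Discrete space derivative of a grid function. -/
noncomputable def spaceSlope {N : ℕ} (U : Fin N → ℕ → ℕ → ℝ) (Δx : ℝ) (α : Fin N) (n i : ℕ) : ℝ :=
  (U α n (i + 1) - U α n i) / Δx

/-- Discrete time derivative of a grid function. -/
noncomputable def timeSlope {N : ℕ} (U : Fin N → ℕ → ℕ → ℝ) (Δt : ℝ) (α : Fin N) (n i : ℕ) : ℝ :=
  (U α (n + 1) i - U α n i) / Δt

section Level

variable {f : ℝ → ℝ} {c ℓ : ℝ}

lemma level_sInf (hf : Continuous f) (ha : Antitone f) (hc : ∃ p ≤ c, f p = ℓ)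
    (hb : BddBelow {p | f p = ℓ}) :
    f (sInf {p | f p = ℓ}) = ℓ ∧ sInf {p | f p = ℓ} ≤ c ∧
      ∀ p, f p ≤ ℓ → sInf {p | f p = ℓ} ≤ p := by
  obtain ⟨p, hpc, hp⟩ := hc
  have hmem : sInf {p | f p = ℓ} ∈ {p | f p = ℓ} :=
    (isClosed_eq hf continuous_const).csInf_mem ⟨p, hp⟩ hb
  refine ⟨hmem, (csInf_le hb hp).trans hpc, fun r hr => ?_⟩
  by_contra! hlt
  have h1 : ℓ ≤ f r := hmem.symm.le.trans (ha hlt.le)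
  exact hlt.not_ge (csInf_le hb (le_antisymm hr h1))

lemma level_sSup (hf : Continuous f) (ha : Monotone f) (hc : ∃ p ≥ c, f p = ℓ)
    (hb : BddAbove {p | f p = ℓ}) :
    f (sSup {p | f p = ℓ}) = ℓ ∧ c ≤ sSup {p | f p = ℓ} ∧
      ∀ p, f p ≤ ℓ → p ≤ sSup {p | f p = ℓ} := by
  obtain ⟨p, hpc, hp⟩ := hc
  have hmem : sSup {p | f p = ℓ} ∈ {p | f p = ℓ} :=
    (isClosed_eq hf continuous_const).csSup_mem ⟨p, hp⟩ hb
  refine ⟨hmem, hpc.le.trans (le_csSup hb hp), fun r hr => ?_⟩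
  by_contra! hlt
  have h1 : ℓ ≤ f r := hmem.symm.le.trans (ha hlt.le)
  exact hlt.not_ge (le_csSup hb (le_antisymm hr h1))

end Level

namespace LegendreDual

variable {γ : ℝ} {L H : ℝ → ℝ} {p₀ : ℝ}

lemma Hm_eq (H : ℝ → ℝ) (p₀ p : ℝ) : Hm H p₀ p = H (min p p₀) := by
  unfold Hm
  split_ifs with h
  · rw [min_eq_left h]
  · rw [min_eq_right (le_of_not_ge h)]

lemma Hp_eq (H : ℝ → ℝ) (p₀ p : ℝ) : Hp H p₀ p = H (max p p₀) := by
  unfold Hp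
  split_ifs with h
  · rw [max_eq_right h]
  · rw [max_eq_left (le_of_not_ge h)]

lemma antitone_Hm (h : LegendreDual γ L H p₀) : Antitone (Hm H p₀) := fun p r hpr => by
  rw [Hm_eq, Hm_eq]
  exact h.antitone (mem_Iic.2 (min_le_right _ _)) (mem_Iic.2 (min_le_right _ _)) (min_le_min_right _ hpr)

lemma monotone_Hp (h : LegendreDual γ L H p₀) : Monotone (Hp H p₀) := fun p r hpr => by
  rw [Hp_eq, Hp_eq]
  exact h.monotone (mem_Ici.2 (le_max_right _ _)) (mem_Ici.2 (le_max_right _ _)) (max_le_max_right _ hpr)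

lemma continuous_Hm (h : LegendreDual γ L H p₀) : Continuous (Hm H p₀) := by
  rw [show Hm H p₀ = fun p => H (min p p₀) from funext (Hm_eq H p₀)]
  exact h.contDiff_ham.continuous.comp (by fun_prop)

lemma continuous_Hp (h : LegendreDual γ L H p₀) : Continuous (Hp H p₀) := by
  rw [show Hp H p₀ = fun p => H (max p p₀) from funext (Hp_eq H p₀)]
  exact h.contDiff_ham.continuous.comp (by fun_prop)

lemma sInf_level_Hm (h : LegendreDual γ L H p₀) {ℓ : ℝ} (hℓ : H p₀ ≤ ℓ) :
    Hm H p₀ (sInf {p | Hm H p₀ p = ℓ}) = ℓ ∧ sInf {p | Hm H p₀ p = ℓ} ≤ p₀ ∧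
      ∀ p, Hm H p₀ p ≤ ℓ → sInf {p | Hm H p₀ p = ℓ} ≤ p := by
  obtain ⟨P, hP, hPH⟩ := h.exists_bound_of_ham_le ℓ
  refine level_sInf h.continuous_Hm h.antitone_Hm ?_ ⟨min (-P) p₀, fun p hp => ?_⟩
  · have h1 : -P - 1 ≤ p₀ := by linarith [(abs_le.1 (hPH p₀ hℓ)).1]
    have h2 : ℓ ≤ H (-P - 1) := by
      by_contra! h3
      linarith [(abs_le.1 (hPH _ h3.le)).1]
    obtain ⟨p, hp, hpe⟩ := intermediate_value_Icc' h1 h.contDiff_ham.continuous.continuousOn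
      ⟨hℓ, h2⟩
    exact ⟨p, hp.2, by rw [Hm, if_pos hp.2, hpe]⟩
  · rcases le_total p p₀ with hpp | hpp
    · have hp' : Hm H p₀ p = ℓ := hp
      rw [Hm, if_pos hpp] at hp'
      exact (_root_.min_le_left _ _).trans (abs_le.1 (hPH p hp'.le)).1
    · exact (min_le_right _ _).trans hpp

lemma sSup_level_Hp (h : LegendreDual γ L H p₀) {ℓ : ℝ} (hℓ : H p₀ ≤ ℓ) :
    Hp H p₀ (sSup {p | Hp H p₀ p = ℓ}) = ℓ ∧ p₀ ≤ sSup {p | Hp H p₀ p = ℓ} ∧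
      ∀ p, Hp H p₀ p ≤ ℓ → p ≤ sSup {p | Hp H p₀ p = ℓ} := by
  obtain ⟨P, hP, hPH⟩ := h.exists_bound_of_ham_le ℓ
  refine level_sSup h.continuous_Hp h.monotone_Hp ?_ ⟨max P p₀, fun p hp => ?_⟩
  · have h1 : p₀ ≤ P + 1 := by linarith [(abs_le.1 (hPH p₀ hℓ)).2]
    have h2 : ℓ ≤ H (P + 1) := by
      by_contra! h3
      linarith [(abs_le.1 (hPH _ h3.le)).2]
    obtain ⟨p, hp, hpe⟩ := intermediate_value_Icc h1 h.contDiff_ham.continuous.continuousOn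
      ⟨hℓ, h2⟩
    exact ⟨p, hp.1, by rw [Hp_eq, max_eq_left hp.1, hpe]⟩
  · rcases le_total p p₀ with hpp | hpp
    · exact hpp.trans (le_max_right _ _)
    · have hp' : Hp H p₀ p = ℓ := hp
      rw [Hp_eq, max_eq_left hpp] at hp'
      exact (abs_le.1 (hPH p hp'.le)).2.trans (le_max_left _ _)

end LegendreDual

namespace SchemeNS

variable {N : ℕ} {H : Fin N → ℝ → ℝ} {p₀ : Fin N → ℝ} {Δx Δt : ℝ} {U : Fin N → ℕ → ℕ → ℝ}

lemma timeSlope_succ (hU : SchemeNS H p₀ Δx Δt U) (hΔt : 0 < Δt) (α : Fin N) (n i : ℕ) :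
    timeSlope U Δt α n (i + 1) = -max (Hp (H α) (p₀ α) (spaceSlope U Δx α n i))
      (Hm (H α) (p₀ α) (spaceSlope U Δx α n (i + 1))) := by
  have h := (hU n).1 α (i + 1) (by omega)
  simp only [Nat.add_sub_cancel] at h
  rw [timeSlope, h, spaceSlope, spaceSlope]
  field_simp
  ring

lemma timeSlope_zero (hU : SchemeNS H p₀ Δx Δt U) (hΔt : 0 < Δt) (α : Fin N) (n : ℕ) :
    timeSlope U Δt α n 0 =
      -sSup (range fun β : Fin N => Hm (H β) (p₀ β) (spaceSlope U Δx β n 0)) := by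
  have h := (hU n).2.2 α
  simp only at h
  simp only [timeSlope, h, spaceSlope, zero_add]
  field_simp
  ring

lemma Hm_le_timeSlope (hU : SchemeNS H p₀ Δx Δt U) (hΔt : 0 < Δt) (α : Fin N) (n i : ℕ) :
    Hm (H α) (p₀ α) (spaceSlope U Δx α n i) ≤ -timeSlope U Δt α n i := by
  cases i with
  | zero =>
    rw [hU.timeSlope_zero hΔt, neg_neg]
    exact le_csSup (finite_range _).bddAbove ⟨α, rfl⟩
  | succ i =>
    rw [hU.timeSlope_succ hΔt, neg_neg]
    exact le_max_right _ _

lemma Hp_le_timeSlope (hU : SchemeNS H p₀ Δx Δt U) (hΔt : 0 < Δt) (α : Fin N) (n i : ℕ) :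
    Hp (H α) (p₀ α) (spaceSlope U Δx α n i) ≤ -timeSlope U Δt α n (i + 1) := by
  rw [hU.timeSlope_succ hΔt, neg_neg]
  exact le_max_left _ _

lemma le_timeSlope (hU : SchemeNS H p₀ Δx Δt U) (hΔt : 0 < Δt) {n : ℕ} {B : ℝ}
    (hm : ∀ α i, Hm (H α) (p₀ α) (spaceSlope U Δx α n i) ≤ B)
    (hp : ∀ α i, Hp (H α) (p₀ α) (spaceSlope U Δx α n i) ≤ B) (α : Fin N) (i : ℕ) :
    -B ≤ timeSlope U Δt α n i := by
  cases i with
  | zero =>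
    rw [hU.timeSlope_zero hΔt, neg_le_neg_iff]
    refine csSup_le ⟨_, α, rfl⟩ ?_
    rintro _ ⟨β, rfl⟩
    exact hm β 0
  | succ i =>
    rw [hU.timeSlope_succ hΔt, neg_le_neg_iff]
    exact max_le (hp α i) (hm α _)

lemma spaceSlope_succ (hΔx : 0 < Δx) (hΔt : 0 < Δt) (α : Fin N) (n i : ℕ) :
    spaceSlope U Δx α (n + 1) i = spaceSlope U Δx α n i +
      Δt / Δx * (timeSlope U Δt α n (i + 1) - timeSlope U Δt α n i) := by
  unfold spaceSlope timeSlope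
  field_simp
  ring

/-- Discrete gradient estimates: under the CFL condition the scheme propagates the bound on
the Hamiltonian satisfied by the initial data. -/
lemma gradient_estimates {γ : ℝ} {L : Fin N → ℝ → ℝ}
    (hL : ∀ α, LegendreDual γ (L α) (H α) (p₀ α)) (hΔx : 0 < Δx) (hΔt : 0 < Δt)
    (hU : SchemeNS H p₀ Δx Δt U) (hCFL : CFLprime H p₀ Δx Δt U) {M : ℝ}
    (hM : ∀ α i, H α (spaceSlope U Δx α 0 i) ≤ M) (n : ℕ) (α : Fin N) (i : ℕ) :
    H α (spaceSlope U Δx α n i) ≤ M ∧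
      |deriv (H α) (spaceSlope U Δx α n i)| ≤ Δx / Δt ∧
      -M ≤ timeSlope U Δt α n i ∧ timeSlope U Δt α n i ≤ -H α (p₀ α) := by
  set S := range fun q : Fin N × ℕ => (U q.1 1 q.2 - U q.1 0 q.2) / Δt with hS
  have hSM : ∀ w ∈ S, -M ≤ w := by
    rintro _ ⟨⟨β, j⟩, rfl⟩
    exact hU.le_timeSlope hΔt (fun β j => ((hL β).Hm_le _).trans (hM β j))
      (fun β j => ((hL β).Hp_le _).trans (hM β j)) β j
  set ℓ := -sInf S with hℓ
  have hℓM : ℓ ≤ M := by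
    have := le_csInf (range_nonempty_iff_nonempty.2 ⟨(α, i)⟩) hSM
    linarith
  have hW0 : ∀ β j, -ℓ ≤ timeSlope U Δt β 0 j := fun β j => by
    rw [hℓ, neg_neg]
    exact csInf_le ⟨_, hSM⟩ ⟨(β, j), rfl⟩
  have hℓ0 : ∀ β, H β (p₀ β) ≤ ℓ := fun β => by
    have h1 := hU.Hm_le_timeSlope hΔt β 0 0
    linarith [hW0 β 0, (hL β).le_Hm (spaceSlope U Δx β 0 0)]
  have hlo := fun β => (hL β).sInf_level_Hm (hℓ0 β)
  have hhi := fun β => (hL β).sSup_level_Hp (hℓ0 β)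
  set a := fun β => sInf {p | Hm (H β) (p₀ β) p = ℓ} with ha
  set b := fun β => sSup {p | Hp (H β) (p₀ β) p = ℓ} with hb
  have hcfl : ∀ β, ∀ p ∈ Icc (a β) (b β), |deriv (H β) p| ≤ Δx / Δt := hCFL
  have hrate : ∀ n, (∀ β j, spaceSlope U Δx β n j ∈ Icc (a β) (b β)) →
      ∀ β j, -ℓ ≤ timeSlope U Δt β n j := fun n h β j =>
    hU.le_timeSlope hΔt (fun β j => ((hL β).antitone_Hm (h β j).1).trans (hlo β).1.le)
      (fun β j => ((hL β).monotone_Hp (h β j).2).trans (hhi β).1.le) β j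
  have hmem : ∀ n β j, spaceSlope U Δx β n j ∈ Icc (a β) (b β) := by
    intro n
    induction n with
    | zero =>
      intro β j
      have h1 := hU.Hm_le_timeSlope hΔt β 0 j
      have h2 := hU.Hp_le_timeSlope hΔt β 0 j
      exact ⟨(hlo β).2.2 _ (by linarith [hW0 β j]), (hhi β).2.2 _ (by linarith [hW0 β (j + 1)])⟩
    | succ n ih =>
      intro β j
      have hp := ih β j
      have hab : a β ≤ b β := (hlo β).2.1.trans (hhi β).2.1
      have h1 := hU.Hm_le_timeSlope hΔt β n j
      have h2 := hU.Hp_le_timeSlope hΔt β n j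
      have h3 := hrate n ih β j
      have h4 := hrate n ih β (j + 1)
      obtain ⟨q, -, hq, hqs⟩ := (hL β).exists_slope_Hm (a β)
      obtain ⟨r, -, hr, hrs⟩ := (hL β).exists_slope_Hp (b β)
      have hq' := hq.trans (hcfl β _ ⟨le_rfl, hab⟩)
      have hr' := hr.trans (hcfl β _ ⟨hab, le_rfl⟩)
      have h5 := hqs (spaceSlope U Δx β n j)
      have h6 := hrs (spaceSlope U Δx β n j)
      have e1 : Hm (H β) (p₀ β) (a β) = ℓ := (hlo β).1
      have e2 : Hp (H β) (p₀ β) (b β) = ℓ := (hhi β).1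
      rw [e1] at h5
      rw [e2] at h6
      have hlam : Δt / Δx * (Δx / Δt) = 1 := by field_simp
      have hlam0 : 0 ≤ Δt / Δx := by positivity
      have h7 := mul_le_mul_of_nonneg_right hq' (sub_nonneg.2 hp.1)
      have h8 := mul_le_mul_of_nonneg_right hr' (sub_nonneg.2 hp.2)
      rw [spaceSlope_succ hΔx hΔt]
      constructor
      · have h9 : -(Δx / Δt * (spaceSlope U Δx β n j - a β)) ≤
            timeSlope U Δt β n (j + 1) - timeSlope U Δt β n j := by linarith
        have h10 := mul_le_mul_of_nonneg_left h9 hlam0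
        rw [mul_neg, ← mul_assoc, hlam] at h10
        linarith
      · have h9 : timeSlope U Δt β n (j + 1) - timeSlope U Δt β n j ≤
            Δx / Δt * (b β - spaceSlope U Δx β n j) := by linarith
        have h10 := mul_le_mul_of_nonneg_left h9 hlam0
        rw [← mul_assoc, hlam] at h10
        linarith
  have hp := hmem n α i
  refine ⟨LegendreDual.ham_le_of_Hm_Hp (p₀ := p₀ α) ?_ ?_, hcfl α _ hp, ?_, ?_⟩
  · exact ((hL α).antitone_Hm hp.1).trans ((hlo α).1.le.trans hℓM)
  · exact ((hL α).monotone_Hp hp.2).trans ((hhi α).1.le.trans hℓM)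
  · linarith [hrate n (hmem n) α i]
  · linarith [hU.Hm_le_timeSlope hΔt α n i, (hL α).le_Hm (spaceSlope U Δx α n i)]

lemma slope_mul_add_timeSlope_le_of_nonpos {γ : ℝ} {L : Fin N → ℝ → ℝ}
    (hL : ∀ α, LegendreDual γ (L α) (H α) (p₀ α)) (hΔt : 0 < Δt)
    (hU : SchemeNS H p₀ Δx Δt U) (α : Fin N) (n i : ℕ) {q : ℝ} (hq : q ≤ 0) :
    timeSlope U Δt α n i + q * spaceSlope U Δx α n i ≤ L α q := by
  linarith [hU.Hm_le_timeSlope hΔt α n i, (hL α).fenchel_neg (spaceSlope U Δx α n i) q hq]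

lemma slope_mul_add_timeSlope_le_of_nonneg {γ : ℝ} {L : Fin N → ℝ → ℝ}
    (hL : ∀ α, LegendreDual γ (L α) (H α) (p₀ α)) (hΔt : 0 < Δt)
    (hU : SchemeNS H p₀ Δx Δt U) (α : Fin N) (n i : ℕ) {q : ℝ} (hq : 0 ≤ q) :
    timeSlope U Δt α n (i + 1) + q * spaceSlope U Δx α n i ≤ L α q := by
  linarith [hU.Hp_le_timeSlope hΔt α n i, (hL α).fenchel_pos (spaceSlope U Δx α n i) q hq]

end SchemeNS

/-- Average of `f` over the box `[t, t + η] × [x, x + ε]`. -/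
noncomputable def boxAvg (η ε : ℝ) (f : ℝ → ℝ → ℝ) (t x : ℝ) : ℝ :=
  (η * ε)⁻¹ * ∫ s in (0 : ℝ)..η, ∫ y in (0 : ℝ)..ε, f (t + s) (x + y)

/-- Time derivative of `boxAvg`. -/
noncomputable def boxAvgT (η ε : ℝ) (f : ℝ → ℝ → ℝ) (t x : ℝ) : ℝ :=
  (η * ε)⁻¹ * ∫ y in (0 : ℝ)..ε, (f (t + η) (x + y) - f t (x + y))

/-- Space derivative of `boxAvg`. -/
noncomputable def boxAvgX (η ε : ℝ) (f : ℝ → ℝ → ℝ) (t x : ℝ) : ℝ :=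
  (η * ε)⁻¹ * ∫ s in (0 : ℝ)..η, (f (t + s) (x + ε) - f (t + s) x)

lemma hasDerivAt_integral_shift {g : ℝ → ℝ} (hg : Continuous g) (h x : ℝ) :
    HasDerivAt (fun x => ∫ y in (0 : ℝ)..h, g (x + y)) (g (x + h) - g x) x := by
  have h1 : ∀ a, HasDerivAt (fun x => ∫ y in (0 : ℝ)..x, g y) (g a) a := fun a =>
    intervalIntegral.integral_hasDerivAt_right (hg.intervalIntegrable _ _)
      (hg.stronglyMeasurableAtFilter _ _) hg.continuousAt
  have h2 : (fun x => ∫ y in (0 : ℝ)..h, g (x + y)) =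
      fun x => (∫ y in (0 : ℝ)..(x + h), g y) - ∫ y in (0 : ℝ)..x, g y := by
    funext a
    rw [intervalIntegral.integral_interval_sub_left (hg.intervalIntegrable _ _)
      (hg.intervalIntegrable _ _), intervalIntegral.integral_comp_add_left, add_zero]
  rw [h2]
  exact ((h1 (x + h)).comp_add_const x h).sub (h1 x)

section BoxAvg

variable {η ε : ℝ} {f g : ℝ → ℝ → ℝ}

lemma continuous_boxAvgT (hf : Continuous fun q : ℝ × ℝ => f q.1 q.2) :
    Continuous fun q : ℝ × ℝ => boxAvgT η ε f q.1 q.2 := by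
  unfold boxAvgT
  refine continuous_const.mul
    (intervalIntegral.continuous_parametric_intervalIntegral_of_continuous' ?_ _ _)
  exact (hf.comp (f := fun q : (ℝ × ℝ) × ℝ => (q.1.1 + η, q.1.2 + q.2)) (by fun_prop)).sub
    (hf.comp (f := fun q : (ℝ × ℝ) × ℝ => (q.1.1, q.1.2 + q.2)) (by fun_prop))

lemma continuous_boxAvgX (hf : Continuous fun q : ℝ × ℝ => f q.1 q.2) :
    Continuous fun q : ℝ × ℝ => boxAvgX η ε f q.1 q.2 := by
  unfold boxAvgX
  refine continuous_const.mul
    (intervalIntegral.continuous_parametric_intervalIntegral_of_continuous' ?_ _ _)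
  exact (hf.comp (f := fun q : (ℝ × ℝ) × ℝ => (q.1.1 + q.2, q.1.2 + ε)) (by fun_prop)).sub
    (hf.comp (f := fun q : (ℝ × ℝ) × ℝ => (q.1.1 + q.2, q.1.2)) (by fun_prop))

lemma continuous_inner_integral (hf : Continuous fun q : ℝ × ℝ => f q.1 q.2) (x : ℝ) :
    Continuous fun t => ∫ y in (0 : ℝ)..ε, f t (x + y) :=
  intervalIntegral.continuous_parametric_intervalIntegral_of_continuous'
    (f := fun t y => f t (x + y))
    (hf.comp (f := fun q : ℝ × ℝ => (q.1, x + q.2)) (by fun_prop)) _ _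

lemma continuous_slice (hf : Continuous fun q : ℝ × ℝ => f q.1 q.2) (t x : ℝ) :
    Continuous fun y => f t (x + y) :=
  hf.comp (f := fun y : ℝ => (t, x + y)) (by fun_prop)

lemma boxAvg_swap (hf : Continuous fun q : ℝ × ℝ => f q.1 q.2) (t x : ℝ) :
    boxAvg η ε f t x = boxAvg ε η (fun y s => f s y) x t := by
  unfold boxAvg
  rw [mul_comm η ε]
  congr 1
  refine MeasureTheory.intervalIntegral_intervalIntegral_swap ?_
  have hc : Continuous (Function.uncurry fun s y => f (t + s) (x + y)) :=
    hf.comp (f := fun q : ℝ × ℝ => (t + q.1, x + q.2)) (by fun_prop)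
  exact (hc.continuousOn.integrableOn_compact
    (isCompact_uIcc.prod isCompact_uIcc)).mono_set (prod_mono uIoc_subset_uIcc uIoc_subset_uIcc)

lemma hasDerivAt_boxAvg_left (hf : Continuous fun q : ℝ × ℝ => f q.1 q.2) (t x : ℝ) :
    HasDerivAt (fun s => boxAvg η ε f s x) (boxAvgT η ε f t x) t := by
  unfold boxAvg boxAvgT
  rw [intervalIntegral.integral_sub ((continuous_slice hf _ _).intervalIntegrable _ _)
    ((continuous_slice hf _ _).intervalIntegrable _ _)]
  exact (hasDerivAt_integral_shift (continuous_inner_integral hf x) η t).const_mul _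

lemma boxAvgX_eq_boxAvgT (t x : ℝ) :
    boxAvgX η ε f t x = boxAvgT ε η (fun y s => f s y) x t := by
  unfold boxAvgT boxAvgX
  rw [mul_comm ε η]

lemma hasDerivAt_boxAvg_right (hf : Continuous fun q : ℝ × ℝ => f q.1 q.2) (t x : ℝ) :
    HasDerivAt (fun y => boxAvg η ε f t y) (boxAvgX η ε f t x) x := by
  have hf' : Continuous fun q : ℝ × ℝ => (fun y s => f s y) q.1 q.2 :=
    hf.comp (f := fun q : ℝ × ℝ => (q.2, q.1)) (by fun_prop)
  have h := hasDerivAt_boxAvg_left (η := ε) (ε := η) (f := fun y s => f s y) hf' x t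
  rw [← boxAvgX_eq_boxAvgT] at h
  exact h.congr_of_eventuallyEq (Eventually.of_forall fun y => boxAvg_swap hf t y)

lemma continuous_toSpanSingleton {a : ℝ → ℝ → ℝ} (ha : Continuous fun q : ℝ × ℝ => a q.1 q.2) :
    Continuous fun q : ℝ × ℝ => ContinuousLinearMap.toSpanSingleton ℝ (a q.1 q.2) :=
  (ContinuousLinearMap.toSpanSingletonCLE (𝕜 := ℝ) (E := ℝ)).continuous.comp ha

/-- A function of two real variables with continuous partial derivatives is differentiable. -/
lemma hasFDerivAt_of_partials {F a b : ℝ → ℝ → ℝ}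
    (ha : ∀ t x, HasDerivAt (fun s => F s x) (a t x) t)
    (hb : ∀ t x, HasDerivAt (fun y => F t y) (b t x) x)
    (hac : Continuous fun q : ℝ × ℝ => a q.1 q.2) (hbc : Continuous fun q : ℝ × ℝ => b q.1 q.2)
    (q : ℝ × ℝ) :
    HasFDerivAt (fun q : ℝ × ℝ => F q.1 q.2)
      ((ContinuousLinearMap.toSpanSingleton ℝ (a q.1 q.2)).coprod
        (ContinuousLinearMap.toSpanSingleton ℝ (b q.1 q.2))) q :=
  (hasStrictFDerivAt_uncurry_coprod (f := F)
    (f₁ := fun t x => ContinuousLinearMap.toSpanSingleton ℝ (a t x))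
    (f₂ := fun t x => ContinuousLinearMap.toSpanSingleton ℝ (b t x))
    (Eventually.of_forall fun v => (ha v.1 v.2).hasFDerivAt)
    (Eventually.of_forall fun v => (hb v.1 v.2).hasFDerivAt)
    (continuous_toSpanSingleton hac).continuousAt
    (continuous_toSpanSingleton hbc).continuousAt).hasFDerivAt

lemma contDiff_one_of_partials {F a b : ℝ → ℝ → ℝ}
    (ha : ∀ t x, HasDerivAt (fun s => F s x) (a t x) t)
    (hb : ∀ t x, HasDerivAt (fun y => F t y) (b t x) x)
    (hac : Continuous fun q : ℝ × ℝ => a q.1 q.2) (hbc : Continuous fun q : ℝ × ℝ => b q.1 q.2) :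
    ContDiff ℝ 1 fun q : ℝ × ℝ => F q.1 q.2 :=
  contDiff_one_iff_hasFDerivAt.2 ⟨fun q =>
    (ContinuousLinearMap.toSpanSingleton ℝ (a q.1 q.2)).coprod
      (ContinuousLinearMap.toSpanSingleton ℝ (b q.1 q.2)),
    (continuous_toSpanSingleton hac).continuousLinearMapCoprod (continuous_toSpanSingleton hbc),
    hasFDerivAt_of_partials ha hb hac hbc⟩

lemma boxAvg_le (hη : 0 < η) (hε : 0 < ε) (hf : Continuous fun q : ℝ × ℝ => f q.1 q.2)
    {t x B : ℝ} (h : ∀ s ∈ Icc 0 η, ∀ y ∈ Icc 0 ε, f (t + s) (x + y) ≤ B) :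
    boxAvg η ε f t x ≤ B := by
  have h1 : ∫ s in (0 : ℝ)..η, ∫ y in (0 : ℝ)..ε, f (t + s) (x + y) ≤
      ∫ s in (0 : ℝ)..η, ∫ y in (0 : ℝ)..ε, B := by
    refine intervalIntegral.integral_mono_on hη.le
      (((continuous_inner_integral hf x).comp (by fun_prop : Continuous fun s => t + s)
        ).intervalIntegrable _ _) (continuous_const.intervalIntegrable _ _) fun s hs => ?_
    exact intervalIntegral.integral_mono_on hε.le ((continuous_slice hf _ _).intervalIntegrable _ _)
      (continuous_const.intervalIntegrable _ _) fun y hy => h s hs y hy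
  simp only [intervalIntegral.integral_const, sub_zero, smul_eq_mul] at h1
  unfold boxAvg
  rw [inv_mul_le_iff₀ (by positivity)]
  linarith

lemma boxAvg_sub (hf : Continuous fun q : ℝ × ℝ => f q.1 q.2)
    (hg : Continuous fun q : ℝ × ℝ => g q.1 q.2) (t x : ℝ) :
    boxAvg η ε (fun t x => f t x - g t x) t x = boxAvg η ε f t x - boxAvg η ε g t x := by
  unfold boxAvg
  rw [← mul_sub, ← intervalIntegral.integral_sub]
  · congr 2
    funext s
    exact intervalIntegral.integral_sub ((continuous_slice hf _ _).intervalIntegrable _ _)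
      ((continuous_slice hg _ _).intervalIntegrable _ _)
  · exact ((continuous_inner_integral hf x).comp
      (by fun_prop : Continuous fun s => t + s)).intervalIntegrable _ _
  · exact ((continuous_inner_integral hg x).comp
      (by fun_prop : Continuous fun s => t + s)).intervalIntegrable _ _

lemma boxAvg_const_mul (c t x : ℝ) :
    boxAvg η ε (fun t x => c * f t x) t x = c * boxAvg η ε f t x := by
  unfold boxAvg
  simp only [intervalIntegral.integral_const_mul]
  ring

lemma boxAvg_shift (a b t x : ℝ) :
    boxAvg η ε (fun t x => f (t + a) (x + b)) t x = boxAvg η ε f (t + a) (x + b) := by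
  unfold boxAvg
  simp only [add_right_comm]

lemma abs_boxAvg_sub_le (hη : 0 < η) (hε : 0 < ε) (hf : Continuous fun q : ℝ × ℝ => f q.1 q.2)
    {t x c B : ℝ} (h : ∀ s ∈ Icc 0 η, ∀ y ∈ Icc 0 ε, |f (t + s) (x + y) - c| ≤ B) :
    |boxAvg η ε f t x - c| ≤ B := by
  have h1 := boxAvg_le hη hε hf (t := t) (x := x) (B := B + c)
    fun s hs y hy => by linarith [(abs_le.1 (h s hs y hy)).2]
  have h2 := boxAvg_le hη hε (f := fun t x => (-1) * f t x) (t := t) (x := x) (B := B - c)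
    (continuous_const.mul hf) fun s hs y hy => by linarith [(abs_le.1 (h s hs y hy)).1]
  rw [boxAvg_const_mul] at h2
  exact abs_le.2 ⟨by linarith, by linarith⟩

lemma abs_boxAvgT_sub_le (hη : 0 < η) (hε : 0 < ε) (hf : Continuous fun q : ℝ × ℝ => f q.1 q.2)
    {t x t' x' B : ℝ} (h : ∀ y ∈ Icc 0 ε,
      |(f (t + η) (x + y) - f t (x + y)) - (f (t' + η) (x' + y) - f t' (x' + y))| ≤ B) :
    |boxAvgT η ε f t x - boxAvgT η ε f t' x'| ≤ B / η := by
  have hc : ∀ t x, IntervalIntegrable (fun y => f (t + η) (x + y) - f t (x + y))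
      MeasureTheory.volume 0 ε := fun t x =>
    ((continuous_slice hf _ _).sub (continuous_slice hf _ _)).intervalIntegrable _ _
  unfold boxAvgT
  rw [← mul_sub, ← intervalIntegral.integral_sub (hc _ _) (hc _ _), abs_mul,
    abs_of_pos (by positivity : 0 < (η * ε)⁻¹)]
  have h1 := intervalIntegral.norm_integral_le_of_norm_le_const (a := 0) (b := ε) (C := B)
    (f := fun y => (f (t + η) (x + y) - f t (x + y)) - (f (t' + η) (x' + y) - f t' (x' + y)))
    fun y hy => h y (Ioc_subset_Icc_self (by rwa [uIoc_of_le hε.le] at hy))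
  rw [sub_zero, abs_of_pos hε, Real.norm_eq_abs] at h1
  rw [inv_mul_le_iff₀ (by positivity)]
  refine h1.trans_eq ?_
  field_simp

lemma abs_boxAvgT_le (hη : 0 < η) (hε : 0 < ε) {t x B : ℝ}
    (h : ∀ y ∈ Icc 0 ε, |f (t + η) (x + y) - f t (x + y)| ≤ B) :
    |boxAvgT η ε f t x| ≤ B / η := by
  unfold boxAvgT
  rw [abs_mul, abs_of_pos (by positivity : 0 < (η * ε)⁻¹)]
  have h1 := intervalIntegral.norm_integral_le_of_norm_le_const (a := 0) (b := ε) (C := B)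
    (f := fun y => f (t + η) (x + y) - f t (x + y))
    fun y hy => h y (Ioc_subset_Icc_self (by rwa [uIoc_of_le hε.le] at hy))
  rw [sub_zero, abs_of_pos hε, Real.norm_eq_abs] at h1
  rw [inv_mul_le_iff₀ (by positivity)]
  refine h1.trans_eq ?_
  field_simp

end BoxAvg

/-- Comparison of a discrete subsolution with a solution of the scheme. -/
lemma SchemeNS.discrete_comparison {N : ℕ} {H : Fin N → ℝ → ℝ} {p₀ : Fin N → ℝ} {Δx Δt : ℝ}
    {U V : Fin N → ℕ → ℕ → ℝ} {γ : ℝ} {L : Fin N → ℝ → ℝ}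
    (hL : ∀ α, LegendreDual γ (L α) (H α) (p₀ α)) (hΔx : 0 < Δx) (hΔt : 0 < Δt)
    (hU : SchemeNS H p₀ Δx Δt U) {Q T R δ e σ : ℝ} (hδ : 0 ≤ δ) (he : 0 ≤ e) (hσ : 0 ≤ σ)
    (hcfl : ∀ (n : ℕ) (α : Fin N) (i : ℕ), |deriv (H α) (spaceSlope U Δx α n i)| ≤ Δx / Δt)
    (hQ : ∀ (n : ℕ) (α : Fin N) (i : ℕ), |deriv (H α) (spaceSlope U Δx α n i)| ≤ Q)
    (hV : ∀ (α β : Fin N) (n : ℕ), V α n 0 = V β n 0)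
    (hsub : ∀ (n : ℕ) (α : Fin N) (i : ℕ), ((n + 1 : ℕ) : ℝ) * Δt ≤ T → (i : ℝ) * Δx ≤ R →
      timeSlope V Δt α n i + H α (spaceSlope V Δx α n i) ≤ e ∧
      timeSlope V Δt α n (i + 1) + H α (spaceSlope V Δx α n i) ≤ e)
    (hinit : ∀ (α : Fin N) (i : ℕ), (i : ℝ) * Δx ≤ R → V α 0 i - U α 0 i ≤ δ)
    (hfar : ∀ (n : ℕ) (α : Fin N) (i : ℕ), (n : ℝ) * Δt ≤ T → R < i * Δx → V α n i - U α n i ≤ σ * (i * Δx)) :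
    ∀ (n : ℕ) (α : Fin N) (i : ℕ), (n : ℝ) * Δt ≤ T →
      V α n i - U α n i ≤ δ + e * (n * Δt) + σ * (i * Δx + Q * (n * Δt)) := by
  intro n
  induction n with
  | zero =>
    intro α i hn
    have hi : 0 ≤ σ * (i * Δx) := by positivity
    rcases le_or_gt ((i : ℝ) * Δx) R with h | h
    · have := hinit α i h
      push_cast
      linarith
    · have := hfar 0 α i hn h
      push_cast
      linarith
  | succ n ih =>
    intro α i hn
    have hQ0 : 0 ≤ Q := (abs_nonneg _).trans (hQ 0 α 0)
    rcases le_or_gt ((i : ℝ) * Δx) R with h | h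
    swap
    · have h1 := hfar (n + 1) α i hn h
      have h2 : 0 ≤ e * (((n + 1 : ℕ) : ℝ) * Δt) := by positivity
      have h3 : 0 ≤ σ * (Q * (((n + 1 : ℕ) : ℝ) * Δt)) := by positivity
      linarith
    have hn' : (n : ℝ) * Δt ≤ T := by
      push_cast at hn
      nlinarith
    have hlam : Δt / Δx * (Δx / Δt) = 1 := by field_simp
    have hlam0 : 0 < Δt / Δx := by positivity
    have hVt : ∀ (β : Fin N) (j : ℕ), V β (n + 1) j = V β n j + Δt * timeSlope V Δt β n j := fun β j => by
      unfold timeSlope; field_simp; ring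
    have hUt : ∀ (β : Fin N) (j : ℕ), U β (n + 1) j = U β n j + Δt * timeSlope U Δt β n j := fun β j => by
      unfold timeSlope; field_simp; ring
    have hdiff : ∀ (β : Fin N) (j : ℕ), Δt * (spaceSlope U Δx β n j - spaceSlope V Δx β n j) =
        Δt / Δx * ((V β n j - U β n j) - (V β n (j + 1) - U β n (j + 1))) := fun β j => by
      unfold spaceSlope; field_simp; ring
    have hforward : ∀ (β : Fin N) (j : ℕ), (j : ℝ) * Δx ≤ R →
        timeSlope U Δt β n j = -Hm (H β) (p₀ β) (spaceSlope U Δx β n j) →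
        V β (n + 1) j - U β (n + 1) j ≤ δ + e * (((n + 1 : ℕ) : ℝ) * Δt) +
          σ * (j * Δx + Q * (((n + 1 : ℕ) : ℝ) * Δt)) := by
      intro β j hj hU'
      obtain ⟨q, hq0, hq, hqs⟩ := (hL β).exists_slope_Hm (spaceSlope U Δx β n j)
      have h1 := hqs (spaceSlope V Δx β n j)
      have h2 := (hL β).Hm_le (spaceSlope V Δx β n j)
      have h3 := (hsub n β j hn hj).1
      have h4 : timeSlope V Δt β n j - timeSlope U Δt β n j ≤
          e + -q * (spaceSlope V Δx β n j - spaceSlope U Δx β n j) := by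
        rw [hU']; linarith
      have h5 := mul_le_mul_of_nonneg_left h4 hΔt.le
      set θ := Δt / Δx * -q with hθ
      have hθ0 : 0 ≤ θ := mul_nonneg hlam0.le (by linarith)
      have hθ1 : θ ≤ 1 := by
        rw [← hlam]
        exact mul_le_mul_of_nonneg_left (hq.trans (hcfl n β j)) hlam0.le
      have hθQ : θ * Δx ≤ Q * Δt := by
        have := mul_le_mul_of_nonneg_right (hq.trans (hQ n β j)) hΔt.le
        calc θ * Δx = -q * Δt := by rw [hθ]; field_simp
          _ ≤ Q * Δt := this
      have h6 : V β (n + 1) j - U β (n + 1) j ≤ (1 - θ) * (V β n j - U β n j) +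
          θ * (V β n (j + 1) - U β n (j + 1)) + Δt * e := by
        rw [hVt, hUt]
        have h7 : Δt * (-q * (spaceSlope V Δx β n j - spaceSlope U Δx β n j)) =
            θ * ((V β n (j + 1) - U β n (j + 1)) - (V β n j - U β n j)) := by
          rw [hθ]
          linear_combination q * hdiff β j
        linarith
      have h8 := mul_le_mul_of_nonneg_left (ih β j hn') (sub_nonneg.2 hθ1)
      have h9 := mul_le_mul_of_nonneg_left (ih β (j + 1) hn') hθ0
      have h10 := mul_le_mul_of_nonneg_left hθQ hσ
      push_cast at h9 ⊢
      linarith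
    have hbackward : ∀ (β : Fin N) (j : ℕ), (j : ℝ) * Δx ≤ R →
        timeSlope U Δt β n (j + 1) = -Hp (H β) (p₀ β) (spaceSlope U Δx β n j) →
        V β (n + 1) (j + 1) - U β (n + 1) (j + 1) ≤ δ + e * (((n + 1 : ℕ) : ℝ) * Δt) +
          σ * (((j + 1 : ℕ) : ℝ) * Δx + Q * (((n + 1 : ℕ) : ℝ) * Δt)) := by
      intro β j hj hU'
      obtain ⟨q, hq0, hq, hqs⟩ := (hL β).exists_slope_Hp (spaceSlope U Δx β n j)
      have h1 := hqs (spaceSlope V Δx β n j)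
      have h2 := (hL β).Hp_le (spaceSlope V Δx β n j)
      have h3 := (hsub n β j hn hj).2
      have h4 : timeSlope V Δt β n (j + 1) - timeSlope U Δt β n (j + 1) ≤
          e + q * (spaceSlope U Δx β n j - spaceSlope V Δx β n j) := by
        rw [hU']; linarith
      have h5 := mul_le_mul_of_nonneg_left h4 hΔt.le
      set θ := Δt / Δx * q with hθ
      have hθ0 : 0 ≤ θ := mul_nonneg hlam0.le hq0
      have hθ1 : θ ≤ 1 := by
        rw [← hlam]
        exact mul_le_mul_of_nonneg_left (hq.trans (hcfl n β j)) hlam0.le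
      have h6 : V β (n + 1) (j + 1) - U β (n + 1) (j + 1) ≤
          (1 - θ) * (V β n (j + 1) - U β n (j + 1)) + θ * (V β n j - U β n j) + Δt * e := by
        rw [hVt, hUt]
        have h7 : Δt * (q * (spaceSlope U Δx β n j - spaceSlope V Δx β n j)) =
            θ * ((V β n j - U β n j) - (V β n (j + 1) - U β n (j + 1))) := by
          rw [hθ]
          linear_combination q * hdiff β j
        linarith
      have h8 := mul_le_mul_of_nonneg_left (ih β (j + 1) hn') (sub_nonneg.2 hθ1)
      have h9 := mul_le_mul_of_nonneg_left (ih β j hn') hθ0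
      have h10 : 0 ≤ θ * (σ * Δx) := by positivity
      have h11 : 0 ≤ σ * (Q * Δt) := by positivity
      push_cast at h8 ⊢
      linarith
    cases i with
    | zero =>
      obtain ⟨β, hβ⟩ := (range_nonempty_iff_nonempty.2 ⟨α⟩ :
        (range fun β : Fin N => Hm (H β) (p₀ β) (spaceSlope U Δx β n 0)).Nonempty).csSup_mem
        (finite_range _)
      have h1 := hU.timeSlope_zero hΔt β n
      rw [← hβ] at h1
      have h2 := hforward β 0 h h1
      rw [hV α β, show U α (n + 1) 0 = U β (n + 1) 0 from (hU (n + 1)).2.1 α β]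
      exact h2
    | succ j =>
      have hj : (j : ℝ) * Δx ≤ R := by
        push_cast at h
        linarith
      rcases max_choice (Hp (H α) (p₀ α) (spaceSlope U Δx α n j))
        (Hm (H α) (p₀ α) (spaceSlope U Δx α n (j + 1))) with h1 | h1
      · exact hbackward α j hj (by rw [hU.timeSlope_succ hΔt, h1])
      · exact hforward α (j + 1) h (by rw [hU.timeSlope_succ hΔt, h1])

/-- Box average of `f`, corrected so that its trace at `x = 0` only depends on the trace of `f`. -/
noncomputable def juncAvg (η ε : ℝ) (f : ℝ → ℝ → ℝ) (t x : ℝ) : ℝ :=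
  boxAvg η ε f t x - boxAvg η ε (fun t y => f t y - f t 0) t 0

/-- Time derivative of `juncAvg`. -/
noncomputable def juncAvgT (η ε : ℝ) (f : ℝ → ℝ → ℝ) (t x : ℝ) : ℝ :=
  boxAvgT η ε f t x - boxAvgT η ε (fun t y => f t y - f t 0) t 0

section JuncAvg

variable {η ε : ℝ} {f : ℝ → ℝ → ℝ}

lemma continuous_trace (hf : Continuous fun q : ℝ × ℝ => f q.1 q.2) :
    Continuous fun q : ℝ × ℝ => (fun t (_ : ℝ) => f t 0) q.1 q.2 :=
  hf.comp (f := fun q : ℝ × ℝ => (q.1, (0 : ℝ))) (by fun_prop)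

lemma continuous_sub_trace (hf : Continuous fun q : ℝ × ℝ => f q.1 q.2) :
    Continuous fun q : ℝ × ℝ => (fun t y => f t y - f t 0) q.1 q.2 :=
  hf.sub (continuous_trace hf)

lemma juncAvg_zero (hf : Continuous fun q : ℝ × ℝ => f q.1 q.2) (t : ℝ) :
    juncAvg η ε f t 0 = boxAvg η ε (fun t _ => f t 0) t 0 := by
  unfold juncAvg
  rw [boxAvg_sub (g := fun t _ => f t 0) hf (continuous_trace hf), sub_sub_cancel]

lemma hasDerivAt_juncAvg_left (hf : Continuous fun q : ℝ × ℝ => f q.1 q.2) (t x : ℝ) :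
    HasDerivAt (fun s => juncAvg η ε f s x) (juncAvgT η ε f t x) t :=
  (hasDerivAt_boxAvg_left hf t x).sub (hasDerivAt_boxAvg_left (continuous_sub_trace hf) t 0)

lemma hasDerivAt_juncAvg_right (hf : Continuous fun q : ℝ × ℝ => f q.1 q.2) (t x : ℝ) :
    HasDerivAt (fun y => juncAvg η ε f t y) (boxAvgX η ε f t x) x :=
  (hasDerivAt_boxAvg_right hf t x).sub_const _

lemma continuous_juncAvgT (hf : Continuous fun q : ℝ × ℝ => f q.1 q.2) :
    Continuous fun q : ℝ × ℝ => juncAvgT η ε f q.1 q.2 :=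
  (continuous_boxAvgT hf).sub ((continuous_boxAvgT (f := fun t y => f t y - f t 0)
    (continuous_sub_trace hf)).comp (f := fun q : ℝ × ℝ => (q.1, (0 : ℝ))) (by fun_prop))

lemma abs_boxAvg_sub_trace_le (hη : 0 < η) (hε : 0 < ε)
    (hf : Continuous fun q : ℝ × ℝ => f q.1 q.2) {t ω : ℝ}
    (h : ∀ s ∈ Icc 0 η, ∀ y ∈ Icc 0 ε, |f (t + s) y - f (t + s) 0| ≤ ω) :
    |boxAvg η ε (fun t y => f t y - f t 0) t 0| ≤ ω := by
  have h1 := abs_boxAvg_sub_le (f := fun t y => f t y - f t 0) hη hε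
    (continuous_sub_trace hf) (t := t) (x := 0) (c := 0) (B := ω)
    fun s hs y hy => by simpa using h s hs y hy
  simpa using h1

lemma abs_juncAvg_sub_le (hη : 0 < η) (hε : 0 < ε) (hf : Continuous fun q : ℝ × ℝ => f q.1 q.2)
    {t x c ω₁ ω₂ : ℝ} (h₁ : ∀ s ∈ Icc 0 η, ∀ y ∈ Icc 0 ε, |f (t + s) (x + y) - c| ≤ ω₁)
    (h₂ : ∀ s ∈ Icc 0 η, ∀ y ∈ Icc 0 ε, |f (t + s) y - f (t + s) 0| ≤ ω₂) :
    |juncAvg η ε f t x - c| ≤ ω₁ + ω₂ := by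
  have h3 := abs_le.1 (abs_boxAvg_sub_le hη hε hf h₁)
  have h4 := abs_le.1 (abs_boxAvg_sub_trace_le hη hε hf h₂)
  unfold juncAvg
  exact abs_le.2 ⟨by linarith, by linarith⟩

lemma juncAvg_le (hη : 0 < η) (hε : 0 < ε) (hf : Continuous fun q : ℝ × ℝ => f q.1 q.2)
    {t x c ω : ℝ} (h₁ : ∀ s ∈ Icc 0 η, ∀ y ∈ Icc 0 ε, f (t + s) (x + y) ≤ c)
    (h₂ : ∀ s ∈ Icc 0 η, ∀ y ∈ Icc 0 ε, |f (t + s) y - f (t + s) 0| ≤ ω) :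
    juncAvg η ε f t x ≤ c + ω := by
  have h3 := boxAvg_le hη hε hf h₁
  have h4 := abs_le.1 (abs_boxAvg_sub_trace_le hη hε hf h₂)
  unfold juncAvg
  linarith

lemma abs_juncAvgT_sub_boxAvgT_le (hη : 0 < η) (hε : 0 < ε) {t x ω : ℝ}
    (h : ∀ s ∈ Icc 0 η, ∀ y ∈ Icc 0 ε, |f (t + s) y - f (t + s) 0| ≤ ω) :
    |juncAvgT η ε f t x - boxAvgT η ε f t x| ≤ 2 * ω / η := by
  have h1 := abs_boxAvgT_le (f := fun t y => f t y - f t 0) hη hε (t := t) (x := 0) (B := 2 * ω)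
    fun y hy => by
      have h2 := abs_le.1 (h η ⟨hη.le, le_rfl⟩ y hy)
      have h3 := abs_le.1 (h 0 ⟨le_rfl, hη.le⟩ y hy)
      simp only [add_zero, zero_add] at h2 h3 ⊢
      exact abs_le.2 ⟨by linarith, by linarith⟩
  unfold juncAvgT
  rwa [sub_sub_cancel_left, abs_neg]

/-- Averaging turns a dynamic programming inequality into a differential inequality. -/
lemma boxAvgT_add_mul_boxAvgX_le (hη : 0 < η) (hε : 0 < ε)
    (hf : Continuous fun q : ℝ × ℝ => f q.1 q.2) {t x q ℓ : ℝ}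
    (h : ∀ᶠ h in 𝓝[>] (0 : ℝ), ∀ s ∈ Icc 0 η, ∀ y ∈ Icc 0 ε,
      f (t + s + h) (x + y + q * h) ≤ f (t + s) (x + y) + h * ℓ) :
    boxAvgT η ε f t x + q * boxAvgX η ε f t x ≤ ℓ := by
  have hd : HasDerivAt (fun h : ℝ => boxAvg η ε f (t + h) (x + q * h))
      (boxAvgT η ε f t x + q * boxAvgX η ε f t x) 0 := by
    have h1 := hasFDerivAt_of_partials (hasDerivAt_boxAvg_left (η := η) (ε := ε) hf)
      (hasDerivAt_boxAvg_right hf)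
      (continuous_boxAvgT hf) (continuous_boxAvgX hf) (t + 0, x + q * 0)
    have h2 : HasDerivAt (fun h : ℝ => (t + h, x + q * h)) ((1 : ℝ), q) 0 := by
      refine ((hasDerivAt_id (0 : ℝ)).const_add t).prodMk ?_
      simpa using ((hasDerivAt_id (0 : ℝ)).const_mul q).const_add x
    refine (h1.comp_hasDerivAt (0 : ℝ) h2).congr_deriv ?_
    simp
  refine le_of_tendsto hd.tendsto_slope_zero_right ?_
  filter_upwards [h, self_mem_nhdsWithin] with r hr hr0
  have hr0 : 0 < r := hr0
  have h3 : boxAvg η ε (fun t x => f (t + r) (x + q * r) - f t x) t x ≤ r * ℓ := by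
    refine boxAvg_le (f := fun t x => f (t + r) (x + q * r) - f t x) hη hε
      (Continuous.sub (hf.comp (f := fun p : ℝ × ℝ => (p.1 + r, p.2 + q * r))
      (by fun_prop)) hf) fun s hs y hy => ?_
    linarith [hr s hs y hy]
  rw [boxAvg_sub (f := fun t x => f (t + r) (x + q * r)) (hf.comp
    (f := fun p : ℝ × ℝ => (p.1 + r, p.2 + q * r)) (by fun_prop)) hf, boxAvg_shift] at h3
  simp only [zero_add, smul_eq_mul, mul_zero, add_zero]
  rw [inv_mul_le_iff₀ hr0]
  exact h3

lemma boxAvgT_add_ham_le (hη : 0 < η) (hε : 0 < ε)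
    (hf : Continuous fun q : ℝ × ℝ => f q.1 q.2) {γ : ℝ} {L H : ℝ → ℝ} {p₀ : ℝ}
    (hL : LegendreDual γ L H p₀) {T : ℝ}
    (hdp : ∀ s t x y, 0 ≤ s → s < t → t ≤ T → 0 ≤ x → 0 ≤ y →
      f t x ≤ f s y + (t - s) * L ((x - y) / (t - s)))
    {t x : ℝ} (ht : 0 ≤ t) (htT : t + η < T) (hx : 0 ≤ x) :
    boxAvgT η ε f t x + H (boxAvgX η ε f t x) ≤ 0 := by
  have hpos : ∀ x, 0 < x → boxAvgT η ε f t x + H (boxAvgX η ε f t x) ≤ 0 := fun x hx => by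
    suffices H (boxAvgX η ε f t x) ≤ -boxAvgT η ε f t x by linarith
    refine hL.ham_le _ _ fun q => ?_
    suffices boxAvgT η ε f t x + q * boxAvgX η ε f t x ≤ L q by linarith
    refine boxAvgT_add_mul_boxAvgX_le hη hε hf ?_
    have hc : Tendsto (fun h : ℝ => x + q * h) (𝓝[>] 0) (𝓝 x) := by
      have : Continuous fun h : ℝ => x + q * h := by fun_prop
      simpa using (this.tendsto 0).mono_left nhdsWithin_le_nhds
    have hc' : Tendsto (fun h : ℝ => t + η + h) (𝓝[>] 0) (𝓝 (t + η)) := by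
      have : Continuous fun h : ℝ => t + η + h := by fun_prop
      simpa using (this.tendsto 0).mono_left nhdsWithin_le_nhds
    filter_upwards [hc.eventually (lt_mem_nhds hx), hc'.eventually (gt_mem_nhds htT),
      self_mem_nhdsWithin] with h h1 h2 h3 s hs y hy
    have h3 : 0 < h := h3
    have h4 := hdp (t + s) (t + s + h) (x + y + q * h) (x + y) (by linarith [hs.1]) (by linarith)
      (by linarith [hs.2]) (by linarith [hy.1]) (by linarith [hy.1])
    have h5 : (x + y + q * h - (x + y)) / h = q := by field_simp; ring
    rwa [add_sub_cancel_left, h5] at h4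
  rcases hx.eq_or_lt with rfl | hx
  · have hc : Continuous fun x => boxAvgT η ε f t x + H (boxAvgX η ε f t x) := by
      have hi : Continuous fun x : ℝ => (t, x) := by fun_prop
      exact ((continuous_boxAvgT hf).comp hi).add
        (hL.contDiff_ham.continuous.comp ((continuous_boxAvgX hf).comp hi))
    exact le_of_tendsto ((hc.tendsto 0).mono_left nhdsWithin_le_nhds)
      (eventually_nhdsWithin_of_forall (s := Ioi 0) hpos)
  · exact hpos x hx

end JuncAvg

/-- Uniform modulus of continuity for finitely many functions on a compact rectangle. -/
lemma exists_modulus {N : ℕ} {F : Fin N → ℝ → ℝ → ℝ}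
    (hF : ∀ α, Continuous fun q : ℝ × ℝ => F α q.1 q.2) (T R : ℝ) {e : ℝ} (he : 0 < e) :
    ∃ ρ > 0, ∀ α, ∀ t ∈ Icc 0 T, ∀ t' ∈ Icc 0 T, ∀ x ∈ Icc 0 R, ∀ x' ∈ Icc 0 R,
      |t - t'| ≤ ρ → |x - x'| ≤ ρ → |F α t x - F α t' x'| ≤ e := by
  have hc : Continuous fun q : ℝ × ℝ => fun α => F α q.1 q.2 := continuous_pi hF
  have hu := (isCompact_Icc.prod isCompact_Icc : IsCompact (Icc 0 T ×ˢ Icc 0 R)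
    ).uniformContinuousOn_of_continuous hc.continuousOn
  obtain ⟨ρ, hρ, h⟩ := Metric.uniformContinuousOn_iff.1 hu e he
  refine ⟨ρ / 2, half_pos hρ, fun α t ht t' ht' x hx x' hx' h1 h2 => ?_⟩
  have h3 := h (t, x) ⟨ht, hx⟩ (t', x') ⟨ht', hx'⟩ (by
    rw [Prod.dist_eq, Real.dist_eq, Real.dist_eq]
    exact max_lt (h1.trans_lt (half_lt_self hρ)) (h2.trans_lt (half_lt_self hρ)))
  have h4 := (dist_le_pi_dist _ _ α).trans h3.le
  rwa [Real.dist_eq] at h4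

/-- A viscosity solution is uniformly approximated on compact sets by smooth almost subsolutions. -/
lemma IsViscSolCI.exists_smooth_approx {N : ℕ} {T : ℝ} {H : Fin N → ℝ → ℝ} {p₀ : Fin N → ℝ}
    {u₀ : Fin N → ℝ → ℝ} {u : Fin N → ℝ → ℝ → ℝ} (hu : IsViscSolCI T H p₀ u₀ u)
    {γ : ℝ} {L : Fin N → ℝ → ℝ} (hL : ∀ α, LegendreDual γ (L α) (H α) (p₀ α)) {B C : ℝ}
    (hC : 0 ≤ C) (hu₀ : ∀ α x y, 0 ≤ x → 0 ≤ y → |u₀ α x - u₀ α y| ≤ C * |x - y|)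
    (hB : 0 ≤ B) (hLB : ∀ α, L α 0 ≤ B) {T' R e : ℝ} (hT'0 : 0 ≤ T') (hT' : T' < T) (hR : 0 ≤ R)
    (he : 0 < e) :
    ∃ φ a b : Fin N → ℝ → ℝ → ℝ,
      (∀ α t x, HasDerivAt (fun s => φ α s x) (a α t x) t) ∧
      (∀ α t x, HasDerivAt (fun y => φ α t y) (b α t x) x) ∧
      (∀ α, Continuous fun q : ℝ × ℝ => a α q.1 q.2) ∧
      (∀ α β t, φ α t 0 = φ β t 0) ∧
      (∀ α, ∀ t ∈ Icc 0 T', ∀ x, 0 ≤ x → a α t x + H α (b α t x) ≤ e) ∧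
      (∀ α, ∀ t ∈ Icc 0 T', ∀ x ∈ Icc 0 R, |φ α t x - u α t x| ≤ e) ∧
      (∀ α, ∀ t ∈ Icc 0 T', ∀ x, 0 ≤ x → φ α t x ≤ u₀ α x + C + T * B + e) := by
  set T₁ := (T' + T) / 2 with hT₁
  have hT₁0 : 0 < T₁ := by linarith
  have hT₁T : T₁ < T := by linarith
  set f : Fin N → ℝ → ℝ → ℝ := fun α t x => u α (max 0 (min t T₁)) (max 0 x) with hfdef
  have hf : ∀ α, Continuous fun q : ℝ × ℝ => f α q.1 q.2 := fun α =>
    (hu.continuousOn α).comp_continuous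
      (f := fun q : ℝ × ℝ => (max 0 (min q.1 T₁), max 0 q.2)) (by fun_prop) fun q =>
      ⟨⟨le_max_left _ _, max_lt (hT₁0.trans hT₁T) ((min_le_right _ _).trans_lt hT₁T)⟩,
        mem_Ici.2 (le_max_left _ _)⟩
  have hfu : ∀ α t x, 0 ≤ t → t ≤ T₁ → 0 ≤ x → f α t x = u α t x := fun α t x h1 h2 h3 => by
    simp only [hfdef]
    rw [min_eq_left h2, max_eq_right h1, max_eq_right h3]
  have hcommon : ∀ α β t, f α t 0 = f β t 0 := fun α β t => by
    simp only [hfdef, max_self]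
    exact hu.1.1.2.1 α β _
  obtain ⟨ρ, hρ, hmod⟩ := exists_modulus hf T₁ (R + 1) (half_pos he)
  set η := min (min ρ 1) ((T₁ - T') / 2) with hηdef
  have hη : 0 < η := lt_min (lt_min hρ one_pos) (by linarith)
  have hηT : η ≤ (T₁ - T') / 2 := min_le_right _ _
  have hω : 0 < min (e / 2) (e * η / 2) := lt_min (by linarith) (by positivity)
  obtain ⟨ρ', hρ', hmod'⟩ := exists_modulus hf T₁ (R + 1) hω
  set ε := min (min ρ 1) ρ' with hεdef
  have hε : 0 < ε := lt_min (lt_min hρ one_pos) hρ'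
  have hε1 : ε ≤ 1 := (min_le_left _ _).trans (min_le_right _ _)
  have htrace : ∀ α, ∀ t ∈ Icc 0 T', ∀ s ∈ Icc 0 η, ∀ y ∈ Icc 0 ε,
      |f α (t + s) y - f α (t + s) 0| ≤ min (e / 2) (e * η / 2) := fun α t ht s hs y hy => by
    have hts : t + s ∈ Icc 0 T₁ := ⟨add_nonneg ht.1 hs.1, by linarith [ht.2, hs.2]⟩
    refine hmod' α _ hts _ hts y ⟨hy.1, by linarith [hy.2]⟩ 0 ⟨le_rfl, by linarith⟩
      (by simpa using hρ'.le) ?_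
    rw [sub_zero, abs_of_nonneg hy.1]
    exact hy.2.trans (min_le_right _ _)
  refine ⟨fun α => juncAvg η ε (f α), fun α => juncAvgT η ε (f α), fun α => boxAvgX η ε (f α),
    fun α => hasDerivAt_juncAvg_left (hf α), fun α => hasDerivAt_juncAvg_right (hf α),
    fun α => continuous_juncAvgT (hf α), fun α β t => ?_, fun α t ht x hx => ?_,
    fun α t ht x hx => ?_, fun α t ht x hx => ?_⟩
  · beta_reduce
    rw [juncAvg_zero (hf α), juncAvg_zero (hf β)]
    congr 1
    funext s _
    exact hcommon α β s
  · have h1 := boxAvgT_add_ham_le hη hε (hf α) (hL α) (T := T₁) (fun s t x y hs hst ht hx hy => by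
      rw [hfu α t x (hs.trans hst.le) ht hx, hfu α s y hs (hst.le.trans ht) hy]
      exact hu.le_add_lagrangian (hL α) hs hst (ht.trans_lt hT₁T) hx hy) ht.1
      (by linarith [ht.2]) hx
    have h2 := abs_juncAvgT_sub_boxAvgT_le (f := f α) (t := t) (x := x) hη hε (htrace α t ht)
    have h3 : 2 * min (e / 2) (e * η / 2) / η ≤ e := by
      rw [div_le_iff₀ hη]
      linarith [min_le_right (e / 2) (e * η / 2)]
    linarith [(abs_le.1 h2).2]
  · rw [← hfu α t x ht.1 (by linarith [ht.2]) hx.1]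
    refine (abs_juncAvg_sub_le (ω₁ := e / 2) hη hε (hf α) (fun s hs y hy => ?_) (htrace α t ht)).trans
      (by linarith [min_le_left (e / 2) (e * η / 2)])
    refine hmod α _ ⟨add_nonneg ht.1 hs.1, by linarith [ht.2, hs.2]⟩ _ ⟨ht.1, by linarith [ht.2]⟩
      _ ⟨add_nonneg hx.1 hy.1, by linarith [hx.2, hy.2]⟩ _ ⟨hx.1, by linarith [hx.2]⟩ ?_ ?_
    · rw [add_sub_cancel_left, abs_of_nonneg hs.1]
      exact hs.2.trans ((min_le_left _ _).trans (min_le_left _ _))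
    · rw [add_sub_cancel_left, abs_of_nonneg hy.1]
      exact hy.2.trans ((min_le_left _ _).trans (min_le_left _ _))
  · refine (juncAvg_le (c := u₀ α x + C + T * B) hη hε (hf α) (fun s hs y hy => ?_)
      (htrace α t ht)).trans (by linarith [min_le_left (e / 2) (e * η / 2)])
    have hxy : 0 ≤ x + y := add_nonneg hx hy.1
    have h1 : u₀ α (x + y) ≤ u₀ α x + C := by
      have h2 := (abs_le.1 (hu₀ α (x + y) x hxy hx)).2
      rw [add_sub_cancel_left, abs_of_nonneg hy.1] at h2
      nlinarith [hy.2]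
    rw [hfu α _ _ (add_nonneg ht.1 hs.1) (by linarith [ht.2, hs.2]) hxy]
    rcases (add_nonneg ht.1 hs.1).eq_or_lt with h0 | h0
    · rw [← h0, hu.initial α hxy]
      have : 0 ≤ T * B := mul_nonneg (by linarith) hB
      linarith
    · have h3 := hu.le_add_lagrangian (hL α) le_rfl h0 (by linarith [ht.2, hs.2]) hxy hxy
      rw [sub_self, zero_div, sub_zero, hu.initial α hxy] at h3
      have h4 : (t + s) * L α 0 ≤ T * B :=
        (mul_le_mul_of_nonneg_left (hLB α) h0.le).trans
          (mul_le_mul_of_nonneg_right (by linarith [ht.2, hs.2]) hB)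
      linarith

/-- `U` solves the scheme with initial data `u₀` sampled on the grid, under the CFL condition. -/
structure IsSchemeSolution {N : ℕ} (H : Fin N → ℝ → ℝ) (p₀ : Fin N → ℝ) (u₀ : Fin N → ℝ → ℝ)
    (Δx Δt : ℝ) (U : Fin N → ℕ → ℕ → ℝ) : Prop where
  pos_x : 0 < Δx
  pos_t : 0 < Δt
  scheme : SchemeNS H p₀ Δx Δt U
  init : ∀ α (i : ℕ), U α 0 i = u₀ α (i * Δx)
  cfl : CFLprime H p₀ Δx Δt U

lemma exists_nonneg_bound {N : ℕ} (f : Fin N → ℝ) : ∃ B, 0 ≤ B ∧ ∀ α, f α ≤ B :=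
  ⟨∑ α, |f α|, Finset.sum_nonneg fun _ _ => abs_nonneg _, fun α => (le_abs_self _).trans
    (Finset.single_le_sum (f := fun α => |f α|) (fun _ _ => abs_nonneg _) (Finset.mem_univ α))⟩

lemma exists_bound_on_Icc {N : ℕ} {f : Fin N → ℝ → ℝ} (hf : ∀ α, Continuous (f α)) (P : ℝ) :
    ∃ B, 0 ≤ B ∧ ∀ α p, |p| ≤ P → |f α p| ≤ B := by
  have h : ∀ α, ∃ B, ∀ p ∈ Icc (-P) P, |f α p| ≤ B := fun α =>
    isCompact_Icc.exists_bound_of_continuousOn (hf α).continuousOn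
  choose g hg using h
  obtain ⟨B, hB0, hB⟩ := exists_nonneg_bound g
  exact ⟨B, hB0, fun α p hp => (hg α p (abs_le.1 hp)).trans (hB α)⟩

lemma exists_uniform_bounds {N : ℕ} {H : Fin N → ℝ → ℝ} {p₀ : Fin N → ℝ}
    {u₀ : Fin N → ℝ → ℝ} {γ : ℝ} {L : Fin N → ℝ → ℝ}
    (hL : ∀ α, LegendreDual γ (L α) (H α) (p₀ α)) {C₀ : ℝ}
    (hu₀ : ∀ α x y, 0 ≤ x → 0 ≤ y → |u₀ α x - u₀ α y| ≤ C₀ * |x - y|) :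
    ∃ C, 0 ≤ C ∧ ∀ Δx Δt U, IsSchemeSolution H p₀ u₀ Δx Δt U → ∀ (n : ℕ) (α : Fin N) (i : ℕ),
      |spaceSlope U Δx α n i| ≤ C ∧ |timeSlope U Δt α n i| ≤ C ∧
      |deriv (H α) (spaceSlope U Δx α n i)| ≤ C ∧
      |deriv (H α) (spaceSlope U Δx α n i)| ≤ Δx / Δt := by
  obtain ⟨M, hM0, hM⟩ := exists_bound_on_Icc (fun α => (hL α).contDiff_ham.continuous) C₀
  have hP : ∀ α, ∃ P, ∀ p, H α p ≤ M → |p| ≤ P := fun α =>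
    let ⟨P, _, hP⟩ := (hL α).exists_bound_of_ham_le M
    ⟨P, hP⟩
  choose P' hP' using hP
  obtain ⟨P, hP0, hP⟩ := exists_nonneg_bound P'
  obtain ⟨Q, hQ0, hQ⟩ := exists_bound_on_Icc
    (fun α => (hL α).contDiff_ham.continuous_deriv le_rfl) P
  obtain ⟨B, hB0, hB⟩ := exists_nonneg_bound fun α => -H α (p₀ α)
  refine ⟨M + P + Q + B, by positivity, fun Δx Δt U hU n α i => ?_⟩
  have hx := hU.pos_x
  have h0 : ∀ α i, H α (spaceSlope U Δx α 0 i) ≤ M := fun α i => by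
    refine (le_abs_self _).trans (hM α _ ?_)
    have h1 := hu₀ α ((i + 1 : ℕ) * Δx) (i * Δx) (by positivity) (by positivity)
    have h2 : ((i + 1 : ℕ) : ℝ) * Δx - i * Δx = Δx := by push_cast; ring
    rw [h2, abs_of_pos hx] at h1
    rw [spaceSlope, hU.init, hU.init, abs_div, abs_of_pos hx, div_le_iff₀ hx]
    exact h1
  obtain ⟨h1, h2, h3, h4⟩ := hU.scheme.gradient_estimates hL hx hU.pos_t hU.cfl h0 n α i
  have h5 := (hP' α _ h1).trans (hP α)
  exact ⟨by linarith, abs_le.2 ⟨by linarith, by linarith [hB α]⟩, by linarith [hQ α _ h5], h2⟩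

lemma abs_sub_init_le {Δt C : ℝ} {N : ℕ} {U : Fin N → ℕ → ℕ → ℝ} (hΔt : 0 < Δt) {α : Fin N}
    {i : ℕ} (h : ∀ n, |timeSlope U Δt α n i| ≤ C) (n : ℕ) :
    |U α n i - U α 0 i| ≤ C * (n * Δt) := by
  induction n with
  | zero => simp
  | succ n ih =>
    have h1 := h n
    rw [timeSlope, abs_div, abs_of_pos hΔt, div_le_iff₀ hΔt] at h1
    have h2 := abs_sub_le (U α (n + 1) i) (U α n i) (U α 0 i)
    push_cast
    linarith

/-- Upper bound of the viscosity solution by the numerical solution, up to a small error. -/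
lemma IsViscSolCI.le_scheme_add {N : ℕ} {T : ℝ} {H : Fin N → ℝ → ℝ} {p₀ : Fin N → ℝ}
    {u₀ : Fin N → ℝ → ℝ} {u : Fin N → ℝ → ℝ → ℝ} (hu : IsViscSolCI T H p₀ u₀ u)
    {γ : ℝ} {L : Fin N → ℝ → ℝ} (hL : ∀ α, LegendreDual γ (L α) (H α) (p₀ α)) {C₀ : ℝ}
    (hC₀ : 0 ≤ C₀) (hu₀ : ∀ α x y, 0 ≤ x → 0 ≤ y → |u₀ α x - u₀ α y| ≤ C₀ * |x - y|)
    {T' R δ : ℝ} (hT'0 : 0 ≤ T') (hT' : T' < T) (hR : 0 ≤ R) (hδ : 0 < δ) :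
    ∃ ρ > 0, ∀ Δx Δt U, IsSchemeSolution H p₀ u₀ Δx Δt U → Δx ≤ ρ → Δt ≤ ρ →
      ∀ (α : Fin N) (n i : ℕ), n * Δt ≤ T' → i * Δx ≤ R →
        u α (n * Δt) (i * Δx) - U α n i ≤ δ := by
  obtain ⟨C, hC, hbd⟩ := exists_uniform_bounds hL hu₀
  obtain ⟨B, hB, hLB⟩ := exists_nonneg_bound fun α => L α 0
  have hT : 0 < T := hT'0.trans_lt hT'
  set e := min 1 (δ / (4 * (1 + T))) with he
  have he0 : 0 < e := by positivity
  have he1 : e ≤ 1 := min_le_left _ _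
  have heδ : e * (4 * (1 + T)) ≤ δ := by
    rw [← le_div_iff₀ (by positivity)]
    exact min_le_right _ _
  set σ := δ / (4 * (R + C * T + 1)) with hσ
  have hσ0 : 0 < σ := by positivity
  have hσδ : σ * (4 * (R + C * T + 1)) = δ := by rw [hσ]; field_simp
  set D := C₀ + T * B + 1 + C * T with hD
  have hD0 : 0 ≤ D := by positivity
  set R₂ := max R (D / σ) with hR₂
  have hR₂0 : 0 ≤ R₂ := hR.trans (le_max_left _ _)
  have hR₂D : D ≤ σ * R₂ := by
    rw [mul_comm, ← div_le_iff₀ hσ0]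
    exact le_max_right _ _
  obtain ⟨φ, a, b, ha, hb, hac, hφ0, hsub, hφu, hφB⟩ :=
    hu.exists_smooth_approx hL hC₀ hu₀ hB hLB hT'0 hT' hR₂0 he0
  obtain ⟨ρ, hρ, hmod⟩ := exists_modulus hac T' (R₂ + 2) he0
  refine ⟨min ρ 1, lt_min hρ one_pos, fun Δx Δt U hU hx ht α n i hn hi => ?_⟩
  have hx0 := hU.pos_x
  have ht0 := hU.pos_t
  have hxρ := hx.trans (min_le_left _ _)
  have hx1 := hx.trans (min_le_right _ _)
  have htρ := ht.trans (min_le_left _ _)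
  have hUC := hbd Δx Δt U hU
  set V : Fin N → ℕ → ℕ → ℝ := fun α n i => φ α (n * Δt) (i * Δx) with hV
  have hmain := hU.scheme.discrete_comparison (V := V) (Q := C) (T := T') (R := R₂) (δ := e)
    (e := 2 * e) (σ := σ) hL hx0 ht0 he0.le (by positivity) hσ0.le
    (fun n α i => (hUC n α i).2.2.2) (fun n α i => (hUC n α i).2.2.1)
    (fun α β n => by simpa [hV] using hφ0 α β _) (fun n α i hn hi => ?_) (fun α i hi => ?_)
    (fun n α i hn hi => ?_) n α i hn
  · have h1 := (abs_le.1 (hφu α _ ⟨by positivity, hn⟩ _ ⟨by positivity, hi.trans (le_max_left _ _)⟩)).1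
    have h2 : e * (n * Δt) ≤ e * T := mul_le_mul_of_nonneg_left (by linarith) he0.le
    have h3 : σ * (i * Δx + C * (n * Δt)) ≤ σ * (R + C * T) :=
      mul_le_mul_of_nonneg_left (add_le_add hi (mul_le_mul_of_nonneg_left (by linarith) hC)) hσ0.le
    simp only [hV] at hmain
    linarith
  · have hnt : (n : ℝ) * Δt < (n + 1 : ℕ) * Δt := by push_cast; linarith
    have hix : (i : ℝ) * Δx < (i + 1 : ℕ) * Δx := by push_cast; linarith
    have hnt' : ((n + 1 : ℕ) : ℝ) * Δt - n * Δt = Δt := by push_cast; ring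
    have hix' : ((i + 1 : ℕ) : ℝ) * Δx - i * Δx = Δx := by push_cast; ring
    have hn0 : 0 ≤ (n : ℝ) * Δt := by positivity
    have hi0 : 0 ≤ (i : ℝ) * Δx := by positivity
    obtain ⟨ξ, hξ, hξs⟩ := exists_hasDerivAt_eq_slope (fun y => φ α (n * Δt) y)
      (fun y => b α (n * Δt) y) hix
      (HasDerivAt.continuousOn fun y _ => hb α _ y) fun y _ => hb α _ y
    rw [hix'] at hξs
    have h1 := hsub α (n * Δt) ⟨hn0, hnt.le.trans hn⟩ ξ (hi0.trans hξ.1.le)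
    have htime : ∀ j : ℕ, i ≤ j → j ≤ i + 1 →
        timeSlope V Δt α n j + H α (spaceSlope V Δx α n i) ≤ 2 * e := fun j hij hji => by
      obtain ⟨τ, hτ, hτs⟩ := exists_hasDerivAt_eq_slope (fun s => φ α s (j * Δx))
        (fun s => a α s (j * Δx)) hnt
        (HasDerivAt.continuousOn fun s _ => ha α s _) fun s _ => ha α s _
      rw [hnt'] at hτs
      have hj1 : (i : ℝ) * Δx ≤ j * Δx := by gcongr
      have hj2 : (j : ℝ) * Δx ≤ (i + 1 : ℕ) * Δx := by gcongr
      have h2 := hmod α τ ⟨hn0.trans hτ.1.le, hτ.2.le.trans hn⟩ (n * Δt) ⟨hn0, hnt.le.trans hn⟩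
        (j * Δx) ⟨hi0.trans hj1, by linarith⟩ ξ ⟨hi0.trans hξ.1.le, by linarith [hξ.2]⟩
        (abs_le.2 ⟨by linarith [hτ.1], by linarith [hτ.2]⟩)
        (abs_le.2 ⟨by linarith [hξ.2], by linarith [hξ.1]⟩)
      have h3 : spaceSlope V Δx α n i = b α (n * Δt) ξ := hξs.symm
      have h4 : timeSlope V Δt α n j = a α τ (j * Δx) := hτs.symm
      rw [h3, h4]
      linarith [(abs_le.1 h2).2]
    exact ⟨htime i le_rfl (Nat.le_succ i), htime (i + 1) (Nat.le_succ i) le_rfl⟩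
  · have h1 := (abs_le.1 (hφu α 0 ⟨le_rfl, hT'0⟩ (i * Δx) ⟨by positivity, hi⟩)).2
    rw [hu.initial α (by positivity)] at h1
    simp only [hV, hU.init, Nat.cast_zero, zero_mul]
    exact h1
  · have h1 := hφB α _ ⟨by positivity, hn⟩ (i * Δx) (by positivity)
    have h2 := (abs_le.1 (abs_sub_init_le ht0 (fun n => (hUC n α i).2.1) n)).1
    rw [hU.init] at h2
    have h3 : C * (n * Δt) ≤ C * T := mul_le_mul_of_nonneg_left (by linarith) hC
    have h4 : σ * R₂ ≤ σ * (i * Δx) := mul_le_mul_of_nonneg_left hi.le hσ0.le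
    simp only [hV]
    linarith

/-- Piecewise linear interpolation of a sequence. -/
noncomputable def linInterp (a : ℕ → ℝ) (s : ℝ) : ℝ :=
  a ⌊s⌋₊ + (s - ⌊s⌋₊) * (a (⌊s⌋₊ + 1) - a ⌊s⌋₊)

section LinInterp

variable {a b : ℕ → ℝ} {s r C : ℝ}

@[simp] lemma linInterp_natCast (n : ℕ) : linInterp a n = a n := by
  simp [linInterp]

lemma linInterp_add_one (hs : 0 ≤ s) : linInterp a (s + 1) = linInterp (fun n => a (n + 1)) s := by
  simp only [linInterp, Nat.floor_add_one hs]
  push_cast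
  ring

lemma linInterp_sub : linInterp (fun n => a n - b n) s = linInterp a s - linInterp b s := by
  unfold linInterp
  ring

lemma linInterp_add : linInterp (fun n => a n + b n) s = linInterp a s + linInterp b s := by
  unfold linInterp
  ring

lemma linInterp_const_mul (c : ℝ) : linInterp (fun n => c * a n) s = c * linInterp a s := by
  unfold linInterp
  ring

lemma linInterp_le (hs : 0 ≤ s) (h : ∀ n, a n ≤ C) : linInterp a s ≤ C := by
  have h0 := Nat.floor_le hs
  have h1 := (Nat.lt_floor_add_one s).le
  unfold linInterp
  nlinarith [h ⌊s⌋₊, h (⌊s⌋₊ + 1)]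

lemma abs_linInterp_le (hs : 0 ≤ s) (h : ∀ n, |a n| ≤ C) : |linInterp a s| ≤ C := by
  have h1 := linInterp_le hs fun n => (abs_le.1 (h n)).2
  have h2 := linInterp_le (a := fun n => (-1) * a n) hs (C := C) fun n => by
    linarith [(abs_le.1 (h n)).1]
  rw [linInterp_const_mul] at h2
  exact abs_le.2 ⟨by linarith, h1⟩

lemma abs_sub_le_of_abs_succ_sub_le (h : ∀ n, |a (n + 1) - a n| ≤ C) {m n : ℕ} (hmn : m ≤ n) :
    |a n - a m| ≤ C * (n - m) := by
  induction n, hmn using Nat.le_induction with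
  | base => simp
  | succ n hn ih =>
    have h1 := abs_sub_le (a (n + 1)) (a n) (a m)
    push_cast
    linarith [h n]

lemma abs_linInterp_sub_le_of_le (hs : 0 ≤ s) (h : ∀ n, |a (n + 1) - a n| ≤ C) {m : ℕ}
    (hm : (m : ℝ) ≤ s) : |linInterp a s - a m| ≤ C * (s - m) := by
  have h0 := Nat.floor_le hs
  have h1 := abs_sub_le_of_abs_succ_sub_le h (Nat.le_floor hm)
  have h2 : |linInterp a s - a ⌊s⌋₊| ≤ C * (s - ⌊s⌋₊) := by
    rw [linInterp, add_sub_cancel_left, abs_mul, abs_of_nonneg (sub_nonneg.2 h0), mul_comm]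
    exact mul_le_mul_of_nonneg_right (h _) (sub_nonneg.2 h0)
  have h3 := abs_sub_le (linInterp a s) (a ⌊s⌋₊) (a m)
  linarith

lemma abs_linInterp_sub_le_of_ge (h : ∀ n, |a (n + 1) - a n| ≤ C) {m : ℕ}
    (hm : s < m) (hs : 0 ≤ s) : |a m - linInterp a s| ≤ C * (m - s) := by
  have h0 := (Nat.lt_floor_add_one s).le
  have h1 := abs_sub_le_of_abs_succ_sub_le h (Nat.succ_le_of_lt ((Nat.floor_lt hs).2 hm))
  have h2 : |a (⌊s⌋₊ + 1) - linInterp a s| ≤ C * (⌊s⌋₊ + 1 - s) := by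
    have h4 : a (⌊s⌋₊ + 1) - linInterp a s = (⌊s⌋₊ + 1 - s) * (a (⌊s⌋₊ + 1) - a ⌊s⌋₊) := by
      unfold linInterp
      ring
    rw [h4, abs_mul, abs_of_nonneg (sub_nonneg.2 h0), mul_comm]
    exact mul_le_mul_of_nonneg_right (h _) (sub_nonneg.2 h0)
  have h3 := abs_sub_le (a m) (a (⌊s⌋₊ + 1)) (linInterp a s)
  push_cast at h1
  linarith

lemma abs_linInterp_sub_le (h : ∀ n, |a (n + 1) - a n| ≤ C) (hs : 0 ≤ s) (hr : 0 ≤ r) :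
    |linInterp a s - linInterp a r| ≤ C * |s - r| := by
  wlog hrs : r ≤ s generalizing s r
  · rw [abs_sub_comm, abs_sub_comm s r]
    exact this hr hs (le_of_not_ge hrs)
  rw [abs_of_nonneg (sub_nonneg.2 hrs)]
  rcases le_or_gt ((⌊r⌋₊ + 1 : ℕ) : ℝ) s with h1 | h1
  · have h2 := abs_linInterp_sub_le_of_le hs h h1
    have h3 := abs_linInterp_sub_le_of_ge h (m := ⌊r⌋₊ + 1)
      (by exact_mod_cast Nat.lt_floor_add_one r) hr
    have h4 := abs_sub_le (linInterp a s) (a (⌊r⌋₊ + 1)) (linInterp a r)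
    linarith
  · have h2 : ⌊s⌋₊ = ⌊r⌋₊ := le_antisymm
      (Nat.lt_succ_iff.1 ((Nat.floor_lt hs).2 h1)) (Nat.floor_le_floor hrs)
    have h3 : linInterp a s - linInterp a r = (s - r) * (a (⌊r⌋₊ + 1) - a ⌊r⌋₊) := by
      unfold linInterp
      rw [h2]
      ring
    rw [h3, abs_mul, abs_of_nonneg (sub_nonneg.2 hrs), mul_comm]
    exact mul_le_mul_of_nonneg_right (h _) (sub_nonneg.2 hrs)

end LinInterp

/-- Bilinear interpolation of a grid function, extended by its boundary values. -/
noncomputable def gridInterp (Δx Δt : ℝ) (V : ℕ → ℕ → ℝ) (t x : ℝ) : ℝ :=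
  linInterp (fun n => linInterp (V n) (max 0 x / Δx)) (max 0 t / Δt)

section GridInterp

variable {Δx Δt : ℝ} {V : ℕ → ℕ → ℝ}

lemma gridInterp_grid (hΔx : 0 < Δx) (hΔt : 0 < Δt) (n i : ℕ) :
    gridInterp Δx Δt V (n * Δt) (i * Δx) = V n i := by
  unfold gridInterp
  rw [max_eq_right (by positivity), max_eq_right (by positivity), mul_div_cancel_right₀ _ hΔt.ne',
    mul_div_cancel_right₀ _ hΔx.ne', linInterp_natCast, linInterp_natCast]

lemma gridInterp_zero (t : ℝ) :
    gridInterp Δx Δt V t 0 = linInterp (fun n => V n 0) (max 0 t / Δt) := by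
  unfold gridInterp
  have h : ∀ n, linInterp (V n) (max 0 0 / Δx) = V n 0 := fun n => by
    rw [max_self, zero_div, ← Nat.cast_zero, linInterp_natCast]
  simp only [h]

lemma abs_max_zero_sub_le (x y : ℝ) : |max 0 x - max 0 y| ≤ |x - y| := by
  have h := abs_max_sub_max_le_abs x y 0
  rwa [max_comm x, max_comm y] at h

lemma abs_gridInterp_sub_le (hΔx : 0 < Δx) (hΔt : 0 < Δt) {C : ℝ} (hC : 0 ≤ C)
    (hx : ∀ n i, |V n (i + 1) - V n i| ≤ C * Δx) (ht : ∀ n i, |V (n + 1) i - V n i| ≤ C * Δt)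
    (t x t' x' : ℝ) :
    |gridInterp Δx Δt V t x - gridInterp Δx Δt V t' x'| ≤ C * |t - t'| + C * |x - x'| := by
  have hX : ∀ x, 0 ≤ max 0 x / Δx := fun x => div_nonneg (le_max_left _ _) hΔx.le
  have hT : ∀ t, 0 ≤ max 0 t / Δt := fun t => div_nonneg (le_max_left _ _) hΔt.le
  have h1 : |gridInterp Δx Δt V t x - gridInterp Δx Δt V t' x| ≤ C * |t - t'| := by
    have h := abs_linInterp_sub_le (a := fun n => linInterp (V n) (max 0 x / Δx)) (C := C * Δt)
      (fun n => by
        rw [← linInterp_sub]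
        exact abs_linInterp_le (hX x) fun i => ht n i) (hT t) (hT t')
    refine h.trans ?_
    rw [← sub_div, abs_div, abs_of_pos hΔt, mul_assoc, mul_div_cancel₀ _ hΔt.ne']
    exact mul_le_mul_of_nonneg_left (abs_max_zero_sub_le _ _) hC
  have h2 : |gridInterp Δx Δt V t' x - gridInterp Δx Δt V t' x'| ≤ C * |x - x'| := by
    unfold gridInterp
    rw [← linInterp_sub]
    refine abs_linInterp_le (hT t') fun n => ?_
    refine (abs_linInterp_sub_le (C := C * Δx) (fun i => hx n i) (hX x) (hX x')).trans ?_
    rw [← sub_div, abs_div, abs_of_pos hΔx, mul_assoc, mul_div_cancel₀ _ hΔx.ne']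
    exact mul_le_mul_of_nonneg_left (abs_max_zero_sub_le _ _) hC
  exact (abs_sub_le _ _ _).trans (add_le_add h1 h2)

lemma gridInterp_add_left (hΔt : 0 < Δt) {t : ℝ} (ht : 0 ≤ t) (x : ℝ) :
    gridInterp Δx Δt V (t + Δt) x = gridInterp Δx Δt (fun n i => V (n + 1) i) t x := by
  unfold gridInterp
  rw [max_eq_right ht, max_eq_right (add_nonneg ht hΔt.le), add_div, div_self hΔt.ne',
    linInterp_add_one (div_nonneg ht hΔt.le)]

lemma gridInterp_add_right (hΔx : 0 < Δx) (t : ℝ) {x : ℝ} (hx : 0 ≤ x) :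
    gridInterp Δx Δt V t (x + Δx) = gridInterp Δx Δt (fun n i => V n (i + 1)) t x := by
  unfold gridInterp
  rw [max_eq_right hx, max_eq_right (add_nonneg hx hΔx.le), add_div, div_self hΔx.ne']
  simp only [linInterp_add_one (div_nonneg hx hΔx.le)]

lemma gridInterp_sub (V W : ℕ → ℕ → ℝ) (t x : ℝ) :
    gridInterp Δx Δt (fun n i => V n i - W n i) t x =
      gridInterp Δx Δt V t x - gridInterp Δx Δt W t x := by
  simp only [gridInterp, linInterp_sub]

lemma gridInterp_add (V W : ℕ → ℕ → ℝ) (t x : ℝ) :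
    gridInterp Δx Δt (fun n i => V n i + W n i) t x =
      gridInterp Δx Δt V t x + gridInterp Δx Δt W t x := by
  simp only [gridInterp, linInterp_add]

lemma gridInterp_const_mul (c : ℝ) (V : ℕ → ℕ → ℝ) (t x : ℝ) :
    gridInterp Δx Δt (fun n i => c * V n i) t x = c * gridInterp Δx Δt V t x := by
  simp only [gridInterp, linInterp_const_mul]

lemma gridInterp_le (hΔx : 0 < Δx) (hΔt : 0 < Δt) {B : ℝ} (h : ∀ n i, V n i ≤ B) (t x : ℝ) :
    gridInterp Δx Δt V t x ≤ B :=
  linInterp_le (div_nonneg (le_max_left _ _) hΔt.le) fun n =>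
    linInterp_le (div_nonneg (le_max_left _ _) hΔx.le) fun i => h n i

lemma gridInterp_slopes_le (hΔx : 0 < Δx) (hΔt : 0 < Δt) {q ℓ : ℝ}
    (h : ∀ n i, (V (n + 1) i - V n i) / Δt + q * ((V n (i + 1) - V n i) / Δx) ≤ ℓ)
    {t x : ℝ} (ht : 0 ≤ t) (hx : 0 ≤ x) :
    (gridInterp Δx Δt V (t + Δt) x - gridInterp Δx Δt V t x) / Δt +
      q * ((gridInterp Δx Δt V t (x + Δx) - gridInterp Δx Δt V t x) / Δx) ≤ ℓ := by
  have h1 := gridInterp_le (V := fun n i => Δt⁻¹ * (V (n + 1) i - V n i) +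
    (q * Δx⁻¹) * (V n (i + 1) - V n i)) hΔx hΔt (B := ℓ) (fun n i => by
      refine le_of_eq_of_le ?_ (h n i)
      rw [div_eq_mul_inv, div_eq_mul_inv]
      ring) t x
  rw [gridInterp_add, gridInterp_const_mul, gridInterp_const_mul, gridInterp_sub, gridInterp_sub,
    ← gridInterp_add_left hΔt ht, ← gridInterp_add_right hΔx t hx] at h1
  refine le_of_eq_of_le ?_ h1
  rw [div_eq_mul_inv, div_eq_mul_inv]
  ring

lemma gridInterp_shifted_slopes_le (hΔx : 0 < Δx) (hΔt : 0 < Δt) {q ℓ : ℝ}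
    (h : ∀ n i, (V (n + 1) (i + 1) - V n (i + 1)) / Δt + q * ((V n (i + 1) - V n i) / Δx) ≤ ℓ)
    {t x : ℝ} (ht : 0 ≤ t) (hx : 0 ≤ x) :
    (gridInterp Δx Δt V (t + Δt) (x + Δx) - gridInterp Δx Δt V t (x + Δx)) / Δt +
      q * ((gridInterp Δx Δt V t (x + Δx) - gridInterp Δx Δt V t x) / Δx) ≤ ℓ := by
  have h1 := gridInterp_le (V := fun n i => Δt⁻¹ * (V (n + 1) (i + 1) - V n (i + 1)) +
    (q * Δx⁻¹) * (V n (i + 1) - V n i)) hΔx hΔt (B := ℓ) (fun n i => by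
      refine le_of_eq_of_le ?_ (h n i)
      rw [div_eq_mul_inv, div_eq_mul_inv]
      ring) t x
  rw [gridInterp_add, gridInterp_const_mul, gridInterp_const_mul, gridInterp_sub, gridInterp_sub,
    ← gridInterp_add_left (V := fun n i => V n (i + 1)) hΔt ht,
    ← gridInterp_add_right hΔx t hx, ← gridInterp_add_right hΔx (t + Δt) hx] at h1
  refine le_of_eq_of_le ?_ h1
  rw [div_eq_mul_inv, div_eq_mul_inv]
  ring

end GridInterp

section LipschitzBoxAvg

variable {η ε C : ℝ} {f : ℝ → ℝ → ℝ}

lemma continuous_of_abs_sub_le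
    (hf : ∀ t x t' x', |f t x - f t' x'| ≤ C * |t - t'| + C * |x - x'|) :
    Continuous fun q : ℝ × ℝ => f q.1 q.2 := by
  refine continuous_iff_continuousAt.2 fun q => ?_
  refine tendsto_iff_norm_sub_tendsto_zero.2 ?_
  refine squeeze_zero (fun _ => norm_nonneg _) (fun r => hf r.1 r.2 q.1 q.2) ?_
  have h : Continuous fun r : ℝ × ℝ => C * |r.1 - q.1| + C * |r.2 - q.2| := by fun_prop
  simpa using h.tendsto q

lemma abs_boxAvgT_sub_le_of_lipschitz (hη : 0 < η) (hε : 0 < ε)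
    (hf : ∀ t x t' x', |f t x - f t' x'| ≤ C * |t - t'| + C * |x - x'|) (t x t' x' : ℝ) :
    |boxAvgT η ε f t x - boxAvgT η ε f t' x'| ≤ 2 * (C * |t - t'| + C * |x - x'|) / η := by
  refine abs_boxAvgT_sub_le hη hε (continuous_of_abs_sub_le hf) fun y _ => ?_
  have h1 := abs_le.1 (hf (t + η) (x + y) (t' + η) (x' + y))
  have h2 := abs_le.1 (hf t (x + y) t' (x' + y))
  rw [add_sub_add_right_eq_sub, add_sub_add_right_eq_sub] at h1
  rw [add_sub_add_right_eq_sub] at h2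
  exact abs_le.2 ⟨by linarith, by linarith⟩

lemma abs_boxAvgX_le_of_lipschitz (hη : 0 < η) (hε : 0 < ε)
    (hf : ∀ t x t' x', |f t x - f t' x'| ≤ C * |t - t'| + C * |x - x'|) (t x : ℝ) :
    |boxAvgX η ε f t x| ≤ C := by
  rw [boxAvgX_eq_boxAvgT]
  refine (abs_boxAvgT_le hε hη (B := C * ε) fun y _ => ?_).trans_eq (mul_div_cancel_right₀ _ hε.ne')
  refine (hf _ _ _ _).trans_eq ?_
  rw [sub_self, abs_zero, mul_zero, zero_add, add_sub_cancel_left, abs_of_pos hε]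

lemma exists_boxAvgT_eq_slope (hf : Continuous fun q : ℝ × ℝ => f q.1 q.2) {h : ℝ} (hh : 0 < h)
    (t x : ℝ) : ∃ s ∈ Ioo t (t + h),
      boxAvgT η ε f s x = (boxAvg η ε f (t + h) x - boxAvg η ε f t x) / h := by
  obtain ⟨s, hs, h1⟩ := exists_hasDerivAt_eq_slope (fun s => boxAvg η ε f s x)
    (fun s => boxAvgT η ε f s x) (lt_add_of_pos_right t hh)
    (fun s _ => (hasDerivAt_boxAvg_left hf s x).continuousAt.continuousWithinAt)
    fun s _ => hasDerivAt_boxAvg_left hf s x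
  exact ⟨s, hs, by rw [h1, add_sub_cancel_left]⟩

lemma exists_boxAvgX_eq_slope (hf : Continuous fun q : ℝ × ℝ => f q.1 q.2) {h : ℝ} (hh : 0 < h)
    (t x : ℝ) : ∃ y ∈ Ioo x (x + h),
      boxAvgX η ε f t y = (boxAvg η ε f t (x + h) - boxAvg η ε f t x) / h := by
  obtain ⟨s, hs, h1⟩ := exists_hasDerivAt_eq_slope (fun y => boxAvg η ε f t y)
    (fun y => boxAvgX η ε f t y) (lt_add_of_pos_right x hh)
    (fun y _ => (hasDerivAt_boxAvg_right hf t y).continuousAt.continuousWithinAt)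
    fun y _ => hasDerivAt_boxAvg_right hf t y
  exact ⟨s, hs, by rw [h1, add_sub_cancel_left]⟩

/-- Averaging turns an inequality between difference quotients into a differential inequality. -/
lemma boxAvgT_add_mul_boxAvgX_le_of_slopes (hη : 0 < η) (hε : 0 < ε) (hC : 0 ≤ C)
    (hf : ∀ t x t' x', |f t x - f t' x'| ≤ C * |t - t'| + C * |x - x'|)
    {Δx Δt r q ℓ : ℝ} (hΔx : 0 < Δx) (hΔt : 0 < Δt) (hr0 : 0 ≤ r) (hr : r ≤ Δx)
    (h : ∀ t x, 0 ≤ t → 0 ≤ x → (f (t + Δt) (x + r) - f t (x + r)) / Δt +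
      q * ((f t (x + Δx) - f t x) / Δx) ≤ ℓ) {t x : ℝ} (ht : 0 ≤ t) (hx : 0 ≤ x) :
    boxAvgT η ε f t x + q * boxAvgX η ε f t x ≤
      ℓ + 2 * (C * Δt + C * Δx) / η + |q| * (2 * (C * Δx) / ε) := by
  have hc := continuous_of_abs_sub_le hf
  have hcs : ∀ a b : ℝ, Continuous fun p : ℝ × ℝ => f (p.1 + a) (p.2 + b) := fun a b =>
    hc.comp (f := fun p : ℝ × ℝ => (p.1 + a, p.2 + b)) (by fun_prop)
  have h0 : boxAvg η ε (fun t x => Δt⁻¹ * (f (t + Δt) (x + r) - f (t + 0) (x + r)) -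
      -(q * Δx⁻¹) * (f (t + 0) (x + Δx) - f (t + 0) (x + 0))) t x ≤ ℓ := by
    refine boxAvg_le (f := fun t x => Δt⁻¹ * (f (t + Δt) (x + r) - f (t + 0) (x + r)) -
      -(q * Δx⁻¹) * (f (t + 0) (x + Δx) - f (t + 0) (x + 0))) hη hε
      ((continuous_const.mul ((hcs _ _).sub (hcs _ _))).sub
        (continuous_const.mul ((hcs _ _).sub (hcs _ _)))) fun s hs y hy => ?_
    refine le_of_eq_of_le ?_ (h (t + s) (x + y) (add_nonneg ht hs.1) (add_nonneg hx hy.1))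
    rw [div_eq_mul_inv, div_eq_mul_inv, add_zero, add_zero]
    ring
  rw [boxAvg_sub (f := fun t x => Δt⁻¹ * (f (t + Δt) (x + r) - f (t + 0) (x + r)))
      (g := fun t x => -(q * Δx⁻¹) * (f (t + 0) (x + Δx) - f (t + 0) (x + 0)))
      (continuous_const.mul ((hcs _ _).sub (hcs _ _)))
      (continuous_const.mul ((hcs _ _).sub (hcs _ _))), boxAvg_const_mul, boxAvg_const_mul,
    boxAvg_sub (f := fun t x => f (t + Δt) (x + r)) (g := fun t x => f (t + 0) (x + r))
      (hcs _ _) (hcs _ _),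
    boxAvg_sub (f := fun t x => f (t + 0) (x + Δx)) (g := fun t x => f (t + 0) (x + 0))
      (hcs _ _) (hcs _ _), boxAvg_shift, boxAvg_shift, boxAvg_shift, boxAvg_shift,
    add_zero, add_zero] at h0
  obtain ⟨s, hs, hs1⟩ := exists_boxAvgT_eq_slope (η := η) (ε := ε) hc hΔt t (x + r)
  obtain ⟨y, hy, hy1⟩ := exists_boxAvgX_eq_slope (η := η) (ε := ε) hc hΔx t x
  have h1 : boxAvgT η ε f s (x + r) + q * boxAvgX η ε f t y ≤ ℓ := by
    rw [hs1, hy1]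
    refine le_of_eq_of_le ?_ h0
    rw [div_eq_mul_inv, div_eq_mul_inv]
    ring
  have h2 := abs_boxAvgT_sub_le_of_lipschitz hη hε hf t x s (x + r)
  have h3 := abs_boxAvgT_sub_le_of_lipschitz (f := fun y s => f s y) hε hη
    (fun t x t' x' => by rw [add_comm]; exact hf x t x' t') x t y t
  rw [← boxAvgX_eq_boxAvgT, ← boxAvgX_eq_boxAvgT, sub_self, abs_zero, mul_zero, add_zero] at h3
  have h4 : C * |t - s| + C * |x - (x + r)| ≤ C * Δt + C * Δx := by
    have h5 : |t - s| ≤ Δt := abs_le.2 ⟨by linarith [hs.2], by linarith [hs.1]⟩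
    have h6 : |x - (x + r)| ≤ Δx := abs_le.2 ⟨by linarith, by linarith⟩
    gcongr
  have h5 : |x - y| ≤ Δx := abs_le.2 ⟨by linarith [hy.2], by linarith [hy.1]⟩
  have h6 : boxAvgT η ε f t x - boxAvgT η ε f s (x + r) ≤ 2 * (C * Δt + C * Δx) / η :=
    (le_abs_self _).trans (h2.trans (by gcongr))
  have h7 : q * (boxAvgX η ε f t x - boxAvgX η ε f t y) ≤ |q| * (2 * (C * Δx) / ε) := by
    refine (le_abs_self _).trans ?_
    rw [abs_mul]
    exact mul_le_mul_of_nonneg_left (h3.trans (by gcongr)) (abs_nonneg q)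
  linarith

end LipschitzBoxAvg

/-- The numerical solution is uniformly approximated by smooth almost subsolutions. -/
lemma exists_smooth_approx_scheme {N : ℕ} {H : Fin N → ℝ → ℝ} {p₀ : Fin N → ℝ}
    {u₀ : Fin N → ℝ → ℝ}
    {γ : ℝ} {L : Fin N → ℝ → ℝ} (hL : ∀ α, LegendreDual γ (L α) (H α) (p₀ α)) {C₀ : ℝ}
    (hC₀ : 0 ≤ C₀) (hu₀ : ∀ α x y, 0 ≤ x → 0 ≤ y → |u₀ α x - u₀ α y| ≤ C₀ * |x - y|) :
    ∃ C, 0 ≤ C ∧ ∀ e, 0 < e → ∃ ρ > 0, ∀ Δx Δt U, IsSchemeSolution H p₀ u₀ Δx Δt U →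
      Δx ≤ ρ → Δt ≤ ρ → ∃ φ a b : Fin N → ℝ → ℝ → ℝ,
      (∀ α t x, HasDerivAt (fun s => φ α s x) (a α t x) t) ∧
      (∀ α t x, HasDerivAt (fun y => φ α t y) (b α t x) x) ∧
      (∀ α, Continuous fun q : ℝ × ℝ => a α q.1 q.2) ∧
      (∀ α, Continuous fun q : ℝ × ℝ => b α q.1 q.2) ∧
      (∀ α β t, φ α t 0 = φ β t 0) ∧
      (∀ α t x, 0 ≤ t → 0 ≤ x → a α t x + H α (b α t x) ≤ e) ∧
      (∀ α t x, 0 ≤ t → 0 ≤ x → φ α t x ≤ u₀ α x + C * t + e) ∧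
      ∀ (α : Fin N) (n i : ℕ), |φ α (n * Δt) (i * Δx) - U α n i| ≤ e := by
  obtain ⟨C, hC, hbd⟩ := exists_uniform_bounds hL hu₀
  obtain ⟨Q, hQ, hLQ⟩ := exists_nonneg_bound fun α => 2 * (C + |deriv (L α) 0|) / γ
  refine ⟨C, hC, fun e he => ?_⟩
  set η := e / (4 * (C + 1)) with hηdef
  have hη : 0 < η := by positivity
  set ε := min η (e * η / (8 * (C + 1))) with hεdef
  have hε : 0 < ε := lt_min hη (by positivity)
  have hCη : C * η ≤ e / 4 := by
    rw [hηdef, mul_div_assoc', div_le_div_iff₀ (by positivity) (by positivity)]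
    nlinarith
  have hCε : C * ε ≤ e / 4 := (mul_le_mul_of_nonneg_left (min_le_left _ _) hC).trans hCη
  have hCεη : 2 * (C * ε) / η ≤ e / 4 := by
    have h1 : ε * (8 * (C + 1)) ≤ e * η :=
      (le_div_iff₀ (by positivity)).1 (min_le_right η (e * η / (8 * (C + 1))))
    rw [div_le_iff₀ hη]
    nlinarith
  set ρ := min (e / (8 * (C + 1) * (1 / η + Q / ε))) (e / (4 * (C + C₀ + 1))) with hρdef
  have hρ : 0 < ρ := lt_min (by positivity) (by positivity)
  have hρ1 : 8 * (C + 1) * (1 / η + Q / ε) * ρ ≤ e := by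
    have h1 := (le_div_iff₀ (by positivity)).1
      (min_le_left (e / (8 * (C + 1) * (1 / η + Q / ε))) (e / (4 * (C + C₀ + 1))))
    linarith
  have hρ2 : (C + C₀) * ρ ≤ e / 4 := by
    have h1 := (le_div_iff₀ (by positivity)).1
      (min_le_right (e / (8 * (C + 1) * (1 / η + Q / ε))) (e / (4 * (C + C₀ + 1))))
    linarith
  refine ⟨ρ, hρ, fun Δx Δt U hU hΔxρ hΔtρ => ?_⟩
  have hΔx := hU.pos_x
  have hΔt := hU.pos_t
  set f : Fin N → ℝ → ℝ → ℝ := fun α => gridInterp Δx Δt (U α) with hfdef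
  have hfl : ∀ α t x t' x', |f α t x - f α t' x'| ≤ C * |t - t'| + C * |x - x'| := fun α =>
    abs_gridInterp_sub_le hΔx hΔt hC
      (fun n i => by
        have h1 := (hbd Δx Δt U hU n α i).1
        rwa [spaceSlope, abs_div, abs_of_pos hΔx, div_le_iff₀ hΔx] at h1)
      (fun n i => by
        have h1 := (hbd Δx Δt U hU n α i).2.1
        rwa [timeSlope, abs_div, abs_of_pos hΔt, div_le_iff₀ hΔt] at h1)
  have hf : ∀ α, Continuous fun q : ℝ × ℝ => f α q.1 q.2 := fun α =>
    continuous_of_abs_sub_le (hfl α)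
  have hcommon : ∀ α β t, f α t 0 = f β t 0 := fun α β t => by
    simp only [hfdef, gridInterp_zero]
    congr 1
    funext n
    exact (hU.scheme n).2.1 α β
  have htrace : ∀ α t, ∀ s ∈ Icc 0 η, ∀ y ∈ Icc 0 ε, |f α (t + s) y - f α (t + s) 0| ≤ C * ε :=
    fun α t s _ y hy => by
      refine (hfl α _ _ _ _).trans ?_
      rw [sub_self, abs_zero, mul_zero, zero_add, sub_zero, abs_of_nonneg hy.1]
      exact mul_le_mul_of_nonneg_left hy.2 hC
  have hφf : ∀ α t x, |juncAvg η ε (f α) t x - f α t x| ≤ 3 * (e / 4) := fun α t x => by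
    refine (abs_juncAvg_sub_le hη hε (hf α) (ω₁ := C * η + C * ε) (fun s hs y hy => ?_)
      (htrace α t)).trans (by linarith)
    refine (hfl α _ _ _ _).trans ?_
    rw [add_sub_cancel_left, add_sub_cancel_left, abs_of_nonneg hs.1, abs_of_nonneg hy.1]
    exact add_le_add (mul_le_mul_of_nonneg_left hs.2 hC) (mul_le_mul_of_nonneg_left hy.2 hC)
  refine ⟨fun α => juncAvg η ε (f α), fun α => juncAvgT η ε (f α), fun α => boxAvgX η ε (f α),
    fun α => hasDerivAt_juncAvg_left (hf α), fun α => hasDerivAt_juncAvg_right (hf α),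
    fun α => continuous_juncAvgT (hf α), fun α => continuous_boxAvgX (hf α), fun α β t => ?_,
    fun α t x ht hx => ?_, fun α t x ht hx => ?_, fun α n i => ?_⟩
  · beta_reduce
    rw [juncAvg_zero (hf α), juncAvg_zero (hf β)]
    congr 1
    funext s _
    exact hcommon α β s
  · have h1 : H α (boxAvgX η ε (f α) t x) ≤ e / 2 - boxAvgT η ε (f α) t x := by
      refine (hL α).ham_le_of_bounded (abs_boxAvgX_le_of_lipschitz hη hε (hfl α) t x)
        fun q hq => ?_
      have hqQ := hq.trans (hLQ α)
      suffices boxAvgT η ε (f α) t x + q * boxAvgX η ε (f α) t x ≤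
          L α q + 2 * (C * Δt + C * Δx) / η + |q| * (2 * (C * Δx) / ε) by
        have h2 : 2 * (C * Δt + C * Δx) / η + |q| * (2 * (C * Δx) / ε) ≤
            2 * (C * ρ + C * ρ) / η + Q * (2 * (C * ρ) / ε) := by gcongr
        have h3 : 2 * (C * ρ + C * ρ) / η + Q * (2 * (C * ρ) / ε) ≤
            4 * (C + 1) * (1 / η + Q / ε) * ρ := by
          have h4 : 4 * (C + 1) * (1 / η + Q / ε) * ρ -
            (2 * (C * ρ + C * ρ) / η + Q * (2 * (C * ρ) / ε)) =
              4 * ρ / η + (2 * C + 4) * ρ * Q / ε := by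
            field_simp
            ring
          have h5 : 0 ≤ 4 * ρ / η + (2 * C + 4) * ρ * Q / ε := by positivity
          linarith
        linarith
      rcases le_total q 0 with hq0 | hq0
      · refine boxAvgT_add_mul_boxAvgX_le_of_slopes hη hε hC (hfl α) hΔx hΔt le_rfl hΔx.le
          (fun t x ht hx => ?_) ht hx
        rw [add_zero]
        exact gridInterp_slopes_le hΔx hΔt (fun n i =>
          hU.scheme.slope_mul_add_timeSlope_le_of_nonpos hL hΔt α n i hq0) ht hx
      · refine boxAvgT_add_mul_boxAvgX_le_of_slopes hη hε hC (hfl α) hΔx hΔt hΔx.le le_rfl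
          (fun t x ht hx => ?_) ht hx
        exact gridInterp_shifted_slopes_le hΔx hΔt (fun n i =>
          hU.scheme.slope_mul_add_timeSlope_le_of_nonneg hL hΔt α n i hq0) ht hx
    have h2 := abs_le.1 (abs_juncAvgT_sub_boxAvgT_le (x := x) hη hε (htrace α t))
    linarith
  · have h1 := abs_le.1 (hφf α t x)
    have h2 := abs_le.1 (hfl α t x 0 (⌊x / Δx⌋₊ * Δx))
    have h3 : f α 0 (⌊x / Δx⌋₊ * Δx) = u₀ α (⌊x / Δx⌋₊ * Δx) := by
      have h4 := gridInterp_grid (V := U α) hΔx hΔt 0 ⌊x / Δx⌋₊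
      rw [Nat.cast_zero, zero_mul] at h4
      rw [hfdef]
      exact h4.trans (hU.init α _)
    have h4 : |x - ⌊x / Δx⌋₊ * Δx| ≤ ρ := by
      have h5 := (le_div_iff₀ hΔx).1 (Nat.floor_le (div_nonneg hx hΔx.le))
      have h6 := (div_lt_iff₀ hΔx).1 (Nat.lt_floor_add_one (x / Δx))
      exact abs_le.2 ⟨by linarith, by linarith⟩
    have h5 := abs_le.1 (hu₀ α x (⌊x / Δx⌋₊ * Δx) hx (by positivity))
    rw [sub_zero, abs_of_nonneg ht] at h2
    have h6 := mul_le_mul_of_nonneg_left h4 (add_nonneg hC hC₀)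
    linarith
  · have h1 := hφf α (n * Δt) (i * Δx)
    have h2 : f α (n * Δt) (i * Δx) = U α n i := gridInterp_grid hΔx hΔt n i
    rw [h2] at h1
    linarith

/-- Comparison with smooth strict subsolutions on a bounded box. -/
lemma IsViscSolCI.smooth_le_of_boundary {N : ℕ} (hN : 1 ≤ N) {T : ℝ} {H : Fin N → ℝ → ℝ}
    {p₀ : Fin N → ℝ} {u₀ : Fin N → ℝ → ℝ} {u : Fin N → ℝ → ℝ → ℝ} (hu : IsViscSolCI T H p₀ u₀ u)
    {γ : ℝ} {L : Fin N → ℝ → ℝ} (hL : ∀ α, LegendreDual γ (L α) (H α) (p₀ α))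
    {τ r : ℝ} (hτT : τ < T) {Φ a b : Fin N → ℝ → ℝ → ℝ}
    (hΦ : ∀ α, ∀ t ∈ Icc 0 τ, ∀ x, ContDiffAt ℝ 1 (fun q : ℝ × ℝ => Φ α q.1 q.2) (t, x))
    (ha : ∀ α, ∀ t ∈ Icc 0 τ, ∀ x, HasDerivAt (fun s => Φ α s x) (a α t x) t)
    (hb : ∀ α, ∀ t ∈ Icc 0 τ, ∀ x, HasDerivAt (fun y => Φ α t y) (b α t x) x)
    (hjunc : ∀ α β t, Φ α t 0 = Φ β t 0)
    (hsub : ∀ α, ∀ t ∈ Icc 0 τ, ∀ x, 0 ≤ x → a α t x + H α (b α t x) < 0)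
    (h_init : ∀ α, ∀ x ∈ Icc 0 r, Φ α 0 x ≤ u α 0 x)
    (h_final : ∀ α, ∀ x ∈ Icc 0 r, Φ α τ x ≤ u α τ x)
    (h_lat : ∀ α, ∀ t ∈ Icc 0 τ, Φ α t r ≤ u α t r)
    (α : Fin N) {t x : ℝ} (ht : t ∈ Icc 0 τ) (hx : x ∈ Icc 0 r) : Φ α t x ≤ u α t x := by
  have : Nonempty (Fin N) := ⟨⟨0, hN⟩⟩
  set K : Set (ℝ × ℝ) := Icc 0 τ ×ˢ Icc 0 r with hK
  have hKc : IsCompact K := isCompact_Icc.prod isCompact_Icc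
  set g : Fin N → ℝ × ℝ → ℝ := fun α q => Φ α q.1 q.2 - u α q.1 q.2 with hg
  have hgc : ∀ α, ContinuousOn (g α) K := fun α => by
    refine ContinuousOn.sub
      (fun q hq => (hΦ α q.1 hq.1 q.2).continuousAt.continuousWithinAt) ?_
    exact (hu.continuousOn α).mono fun q hq => ⟨⟨hq.1.1, hq.1.2.trans_lt hτT⟩, hq.2.1⟩
  choose P hPK hP using fun α => hKc.exists_isMaxOn ⟨(t, x), ht, hx⟩ (hgc α)
  obtain ⟨β, hβ⟩ := Finite.exists_max fun α => g α (P α)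
  have hmax : ∀ α, ∀ q ∈ K, g α q ≤ g β (P β) := fun α q hq => (hP α hq).trans (hβ α)
  by_contra! hlt
  have hpos : 0 < g β (P β) := (sub_pos.2 hlt).trans_le (hmax α (t, x) ⟨ht, hx⟩)
  obtain ⟨⟨s, y⟩, hsy⟩ : ∃ Q, Q = P β := ⟨_, rfl⟩
  set m := g β (P β) with hm
  have hmv : Φ β s y - u β s y = m := by rw [hm, ← hsy]
  have hmem : (s, y) ∈ K := hsy ▸ hPK β
  obtain ⟨⟨hs0, hsτ⟩, hy0, hyr⟩ := hmem
  simp only at hs0 hsτ hy0 hyr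
  have hs0' : 0 < s := hs0.lt_of_ne fun h => by
    subst h
    linarith [h_init β y ⟨hy0, hyr⟩]
  have hsτ' : s < τ := hsτ.lt_of_ne fun h => by
    subst h
    linarith [h_final β y ⟨hy0, hyr⟩]
  have hyr' : y < r := hyr.lt_of_ne fun h => by
    subst h
    linarith [h_lat β s ⟨hs0, hsτ⟩]
  have hsT : s ∈ Ioo 0 T := ⟨hs0', hsτ'.trans hτT⟩
  have hnear : ∀ᶠ q : ℝ × ℝ in 𝓝 (s, y), q.1 ∈ Icc 0 τ ∧ q.2 ≤ r :=
    (continuous_fst.continuousAt.eventually (Icc_mem_nhds hs0' hsτ')).and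
      (continuous_snd.continuousAt.eventually (Iic_mem_nhds hyr'))
  rcases hy0.eq_or_lt with rfl | hy0
  · obtain ⟨α', hα'⟩ := hu.super_junction hN hsT (φ := fun α t x => Φ α t x - m)
      (a := fun α => a α s 0) (b := fun α => b α s 0)
      (fun α => (hΦ α s ⟨hs0, hsτ⟩ 0).sub contDiffAt_const)
      (fun α => by
        filter_upwards [hnear] with q hq hq0
        have h1 := hmax α q ⟨hq.1, hq0, hq.2⟩
        simp only [hg] at h1
        linarith)
      (fun α β => Eventually.of_forall fun s => by simp only [hjunc α β s])
      (fun α => by linarith [hjunc α β s, hu.1.1.2.1 α β s])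
      (fun α => (ha α s ⟨hs0, hsτ⟩ 0).sub_const m) (fun α => (hb α s ⟨hs0, hsτ⟩ 0).sub_const m)
    linarith [hsub α' s ⟨hs0, hsτ⟩ 0 le_rfl, (hL α').Hm_le (b α' s 0)]
  · have h1 := hu.super_interior (α := β) (a := a β s y) (b := b β s y) hsT hy0
      (φ := fun t x => Φ β t x - m)
      ((hΦ β s ⟨hs0, hsτ⟩ y).sub contDiffAt_const)
      (by
        filter_upwards [hnear, continuous_snd.continuousAt.eventually (Ici_mem_nhds hy0)]
          with q hq hq0
        have h1 := hmax β q ⟨hq.1, hq0, hq.2⟩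
        simp only [hg] at h1
        linarith)
      (by linarith)
      ((ha β s ⟨hs0, hsτ⟩ y).sub_const m) ((hb β s ⟨hs0, hsτ⟩ y).sub_const m)
    linarith [hsub β s ⟨hs0, hsτ⟩ y hy0.le]

/-- A smooth approximation from below of the minimum. -/
noncomputable def softMin (a b : ℝ) : ℝ :=
  -Real.log (Real.exp (-a) + Real.exp (-b))

/-- The weight of the second argument in the derivative of `softMin`. -/
noncomputable def softMinWeight (a b : ℝ) : ℝ :=
  Real.exp (-b) / (Real.exp (-a) + Real.exp (-b))

section SoftMin

lemma softMin_le_left (a b : ℝ) : softMin a b ≤ a := by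
  have h : Real.log (Real.exp (-a)) ≤ Real.log (Real.exp (-a) + Real.exp (-b)) :=
    Real.log_le_log (Real.exp_pos _) (by linarith [Real.exp_pos (-b)])
  rw [Real.log_exp] at h
  unfold softMin
  linarith

lemma softMin_le_right (a b : ℝ) : softMin a b ≤ b := by
  unfold softMin
  rw [add_comm]
  exact softMin_le_left b a

lemma sub_exp_le_softMin (a b : ℝ) : a - Real.exp (a - b) ≤ softMin a b := by
  have h1 : Real.exp (-a) + Real.exp (-b) = Real.exp (-a) * (1 + Real.exp (a - b)) := by
    rw [mul_add, mul_one, ← Real.exp_add]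
    ring_nf
  have h2 : 0 < 1 + Real.exp (a - b) := by positivity
  have h3 := Real.log_le_sub_one_of_pos h2
  unfold softMin
  rw [h1, Real.log_mul (Real.exp_pos _).ne' h2.ne', Real.log_exp]
  linarith

lemma softMinWeight_nonneg (a b : ℝ) : 0 ≤ softMinWeight a b := by
  unfold softMinWeight
  positivity

lemma softMinWeight_le_one (a b : ℝ) : softMinWeight a b ≤ 1 := by
  unfold softMinWeight
  rw [div_le_one (by positivity)]
  linarith [Real.exp_pos (-a)]

lemma HasDerivAt.softMin {f g : ℝ → ℝ} {f' g' x : ℝ} (hf : HasDerivAt f f' x)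
    (hg : HasDerivAt g g' x) :
    HasDerivAt (fun y => softMin (f y) (g y))
      ((1 - softMinWeight (f x) (g x)) * f' + softMinWeight (f x) (g x) * g') x := by
  have h : Real.exp (-f x) + Real.exp (-g x) ≠ 0 := by positivity
  refine (((hf.fun_neg.exp.fun_add hg.fun_neg.exp).log h).fun_neg).congr_deriv ?_
  unfold softMinWeight
  field_simp
  ring

lemma ContDiffAt.softMin {f g : ℝ × ℝ → ℝ} {x : ℝ × ℝ} (hf : ContDiffAt ℝ 1 f x)
    (hg : ContDiffAt ℝ 1 g x) : ContDiffAt ℝ 1 (fun y => softMin (f y) (g y)) x := by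
  have h : Real.exp (-f x) + Real.exp (-g x) ≠ 0 := by positivity
  exact ((hf.neg.exp.add hg.neg.exp).log h).neg

end SoftMin

/-- An explicit subsolution, which decreases fast at infinity and blows up at time `t₀`. -/
noncomputable def barrier (L : ℝ → ℝ) (t₀ A t x : ℝ) : ℝ :=
  -((t₀ - t) * (L (-x / (t₀ - t)) - L 0 + A))

section Barrier

variable {γ : ℝ} {L H : ℝ → ℝ} {p₀ t₀ A t : ℝ}

lemma barrier_zero : barrier L t₀ A t 0 = -((t₀ - t) * A) := by
  simp [barrier]

lemma LegendreDual.differentiable_lagrangian (h : LegendreDual γ L H p₀) : Differentiable ℝ L :=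
  h.contDiff_lagrangian.differentiable (by norm_num)

lemma contDiffAt_barrier (h : LegendreDual γ L H p₀) (ht : t < t₀) (x : ℝ) :
    ContDiffAt ℝ 1 (fun q : ℝ × ℝ => barrier L t₀ A q.1 q.2) (t, x) := by
  have h0 : t₀ - t ≠ 0 := (sub_pos.2 ht).ne'
  have h1 : ContDiffAt ℝ 1 (fun q : ℝ × ℝ => t₀ - q.1) (t, x) := by fun_prop
  have h2 : ContDiffAt ℝ 1 (fun q : ℝ × ℝ => -q.2 / (t₀ - q.1)) (t, x) :=
    (contDiffAt_snd.neg).div h1 h0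
  have h3 : ContDiff ℝ 1 L := h.contDiff_lagrangian.of_le (by norm_num)
  exact (h1.mul (((h3.contDiffAt.comp (t, x) h2).sub contDiffAt_const).add contDiffAt_const)).neg

lemma hasDerivAt_barrier_left (h : LegendreDual γ L H p₀) (ht : t < t₀) (x : ℝ) :
    HasDerivAt (fun s => barrier L t₀ A s x) (L (-x / (t₀ - t)) - L 0 + A -
      -x / (t₀ - t) * deriv L (-x / (t₀ - t))) t := by
  have h0 : t₀ - t ≠ 0 := (sub_pos.2 ht).ne'
  have h1 : HasDerivAt (fun s => t₀ - s) (-1) t := (hasDerivAt_id t).const_sub t₀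
  have h2 : HasDerivAt (fun s => -x / (t₀ - s)) (-x / (t₀ - t) / (t₀ - t)) t := by
    refine ((hasDerivAt_const t (-x)).fun_div h1 h0).congr_deriv ?_
    field_simp
    ring
  have h3 := (h.differentiable_lagrangian (-x / (t₀ - t))).hasDerivAt.comp t h2
  refine ((h1.fun_mul ((h3.sub_const (L 0)).add_const A)).fun_neg).congr_deriv ?_
  simp only [Function.comp]
  field_simp
  ring

lemma hasDerivAt_barrier_right (h : LegendreDual γ L H p₀) (ht : t < t₀) (x : ℝ) :
    HasDerivAt (fun y => barrier L t₀ A t y) (deriv L (-x / (t₀ - t))) x := by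
  have h0 : t₀ - t ≠ 0 := (sub_pos.2 ht).ne'
  have h2 : HasDerivAt (fun y => -y / (t₀ - t)) (-1 / (t₀ - t)) x :=
    (hasDerivAt_id x).fun_neg.div_const _
  have h3 := (h.differentiable_lagrangian (-x / (t₀ - t))).hasDerivAt.comp x h2
  refine ((((h3.sub_const (L 0)).add_const A).const_mul (t₀ - t)).fun_neg).congr_deriv ?_
  field_simp

lemma barrier_subsolution (h : LegendreDual γ L H p₀) (hA : A ≤ L 0) (z : ℝ) :
    L z - L 0 + A - z * deriv L z + H (deriv L z) ≤ 0 := by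
  have h1 : H (deriv L z) ≤ z * deriv L z - L z := h.ham_le _ _ fun q => by
    have h2 := h.strong_tangent z q
    have h3 : 0 ≤ γ / 2 * (q - z) ^ 2 := by have := h.pos; positivity
    linarith
  linarith

/-- Strict convexity of the perspective of `L` along rays. -/
lemma perspective_add_le (h : LegendreDual γ L H p₀) {τ κ : ℝ} (hτ : 0 < τ) (hκ : 0 < κ) (y : ℝ) :
    (τ + κ) * L (-y / (τ + κ)) + κ * γ / 2 * (y / (τ + κ)) ^ 2 ≤ τ * L (-y / τ) + κ * L 0 := by
  have h1 := mul_le_mul_of_nonneg_left (h.strong_tangent (-y / (τ + κ)) (-y / τ)) hτ.le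
  have h2 := mul_le_mul_of_nonneg_left (h.strong_tangent (-y / (τ + κ)) 0) hκ.le
  have h3 : 0 ≤ τ * (γ / 2 * (-y / τ - -y / (τ + κ)) ^ 2) := by have := h.pos; positivity
  have h4 : τ * (deriv L (-y / (τ + κ)) * (-y / τ - -y / (τ + κ))) +
      κ * (deriv L (-y / (τ + κ)) * (0 - -y / (τ + κ))) = 0 := by
    field_simp
    ring
  have h5 : κ * (γ / 2 * (0 - -y / (τ + κ)) ^ 2) = κ * γ / 2 * (y / (τ + κ)) ^ 2 := by ring
  linarith

end Barrier

/-- The barrier is below any viscosity solution far away from the junction point. -/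
lemma IsViscSolCI.exists_barrier_le {N : ℕ} {T : ℝ} {H : Fin N → ℝ → ℝ}
    {p₀ : Fin N → ℝ} {u₀ : Fin N → ℝ → ℝ} {u : Fin N → ℝ → ℝ → ℝ} (hu : IsViscSolCI T H p₀ u₀ u)
    {γ : ℝ} {L : Fin N → ℝ → ℝ} (hL : ∀ α, LegendreDual γ (L α) (H α) (p₀ α))
    {τ t₀ t₁ : ℝ} (hτ : τ < t₀) (ht₀ : t₀ < t₁) (ht₁ : t₁ < T) (A c R : ℝ) :
    ∃ r, R ≤ r ∧ 0 < r ∧ ∀ α, ∀ t ∈ Icc 0 τ, barrier (L α) t₀ A t r + c ≤ u α t r := by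
  obtain ⟨D, hD0, hD⟩ := exists_nonneg_bound fun α => c + t₁ * (|L α 0| + |A|) - u α t₁ 0
  rcases lt_or_ge τ 0 with hτ0 | hτ0
  · exact ⟨max 1 R, le_max_right _ _, by positivity, fun α t ht =>
      absurd (ht.1.trans ht.2) hτ0.not_ge⟩
  by_cases hne : Nonempty (Fin N)
  swap
  · exact ⟨max 1 R, le_max_right _ _, by positivity, fun α => absurd ⟨α⟩ hne⟩
  obtain ⟨α₀⟩ := hne
  have hγ := (hL α₀).pos
  set κ := t₁ - t₀ with hκdef
  have hκ : 0 < κ := sub_pos.2 ht₀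
  have ht₁0 : 0 < t₁ := by linarith
  set r := max 1 (max R (2 * t₁ ^ 2 * D / (κ * γ))) with hr
  have hr1 : 1 ≤ r := le_max_left _ _
  refine ⟨r, (le_max_left _ _).trans (le_max_right _ _), by linarith, fun α t ht => ?_⟩
  have h1 := hu.le_add_lagrangian (hL α) ht.1 (by linarith [ht.2] : t < t₁) ht₁ le_rfl
    (by linarith : 0 ≤ r)
  have h2 := perspective_add_le (hL α) (by linarith [ht.2] : 0 < t₀ - t) hκ r
  have h3 : t₀ - t + κ = t₁ - t := by ring
  rw [h3] at h2
  rw [zero_sub] at h1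
  have hs : 0 < t₁ - t := by linarith [ht.2]
  have h4 : D ≤ κ * γ / 2 * (r / (t₁ - t)) ^ 2 := by
    have h5 : 2 * t₁ ^ 2 * D / (κ * γ) ≤ r := (le_max_right _ _).trans (le_max_right _ _)
    rw [div_le_iff₀ (by positivity)] at h5
    have h6 : r / t₁ ≤ r / (t₁ - t) :=
      div_le_div_of_nonneg_left (by linarith) hs (by linarith [ht.1])
    have h7 : D ≤ κ * γ / 2 * (r / t₁) ^ 2 := by
      rw [div_pow, mul_div_assoc', le_div_iff₀ (by positivity)]
      have h8 : r * (κ * γ) ≤ r ^ 2 * (κ * γ) := by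
        refine mul_le_mul_of_nonneg_right ?_ (by positivity)
        nlinarith
      linarith
    refine h7.trans ?_
    gcongr
  have h5 : κ * L α 0 + (t₀ - t) * (L α 0 - A) ≤ t₁ * (|L α 0| + |A|) := by
    have h6 : κ * L α 0 + (t₀ - t) * (L α 0 - A) = (t₁ - t) * L α 0 - (t₀ - t) * A := by ring
    have h7 : (t₁ - t) * L α 0 ≤ t₁ * |L α 0| :=
      (mul_le_mul_of_nonneg_left (le_abs_self _) hs.le).trans
        (mul_le_mul_of_nonneg_right (by linarith [ht.1]) (abs_nonneg _))
    have h8 : (t₀ - t) * -A ≤ t₁ * |A| :=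
      (mul_le_mul_of_nonneg_left (neg_le_abs _) (by linarith [ht.2])).trans
        (mul_le_mul_of_nonneg_right (by linarith [ht.1]) (abs_nonneg _))
    linarith
  have h6 := hD α
  unfold barrier
  linarith

/-- Smooth almost subsolutions on the whole half space are almost below any viscosity solution. -/
lemma IsViscSolCI.exists_smooth_le_add {N : ℕ} (hN : 1 ≤ N) {T : ℝ} {H : Fin N → ℝ → ℝ}
    {p₀ : Fin N → ℝ} {u₀ : Fin N → ℝ → ℝ} {u : Fin N → ℝ → ℝ → ℝ} (hu : IsViscSolCI T H p₀ u₀ u)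
    {γ : ℝ} {L : Fin N → ℝ → ℝ} (hL : ∀ α, LegendreDual γ (L α) (H α) (p₀ α))
    {T' R δ : ℝ} (hT'0 : 0 ≤ T') (hT' : T' < T) (hδ : 0 < δ) (B : ℝ) :
    ∃ e > 0, ∀ φ a b : Fin N → ℝ → ℝ → ℝ,
      (∀ α t x, HasDerivAt (fun s => φ α s x) (a α t x) t) →
      (∀ α t x, HasDerivAt (fun y => φ α t y) (b α t x) x) →
      (∀ α, Continuous fun q : ℝ × ℝ => a α q.1 q.2) →
      (∀ α, Continuous fun q : ℝ × ℝ => b α q.1 q.2) →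
      (∀ α β t, φ α t 0 = φ β t 0) →
      (∀ α t x, 0 ≤ t → 0 ≤ x → a α t x + H α (b α t x) ≤ e) →
      (∀ α x, 0 ≤ x → φ α 0 x ≤ u₀ α x + e) →
      (∀ α, ∀ t ∈ Icc 0 T', ∀ x ∈ Icc 0 R, φ α t x ≤ B) →
      ∀ α, ∀ t ∈ Icc 0 T', ∀ x ∈ Icc 0 R, φ α t x ≤ u α t x + δ := by
  obtain ⟨τ, hτ⟩ : ∃ τ, τ = T' + (T - T') / 4 := ⟨_, rfl⟩
  obtain ⟨t₀, ht₀⟩ : ∃ t₀, t₀ = T' + (T - T') / 2 := ⟨_, rfl⟩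
  obtain ⟨t₁, ht₁⟩ : ∃ t₁, t₁ = T' + 3 * (T - T') / 4 := ⟨_, rfl⟩
  have hT'τ : T' < τ := by linarith
  have hτt₀ : τ < t₀ := by linarith
  have ht₀t₁ : t₀ < t₁ := by linarith
  have ht₁T : t₁ < T := by linarith
  have hT : 0 < T := by linarith
  obtain ⟨B₁, -, hB₁⟩ := exists_nonneg_bound fun α => -L α 0
  set w : Fin N → ℝ → ℝ → ℝ := fun α => barrier (L α) t₀ (-B₁) with hw
  have hwc : ∀ α, ContinuousOn (fun q : ℝ × ℝ => w α q.1 q.2) (Iic τ ×ˢ univ) := fun α q hq =>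
    (contDiffAt_barrier (hL α) ((mem_Iic.1 hq.1).trans_lt hτt₀) q.2).continuousAt.continuousWithinAt
  have hMw : ∀ α, ∃ M, ∀ q ∈ Icc 0 T' ×ˢ Icc 0 R, |w α q.1 q.2| ≤ M := fun α =>
    (isCompact_Icc.prod isCompact_Icc).exists_bound_of_continuousOn
      ((hwc α).mono fun q hq => ⟨hq.1.2.trans hT'τ.le, trivial⟩)
  choose Mw' hMw' using hMw
  obtain ⟨Mw, -, hMw⟩ := exists_nonneg_bound Mw'
  set c := B + Mw - Real.log (δ / 4) with hc
  obtain ⟨r, hRr, hr0, hr⟩ := hu.exists_barrier_le hL hτt₀ ht₀t₁ ht₁T (-B₁) c R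
  have hMs : ∀ α, ∃ M, ∀ x ∈ Icc 0 r, |w α τ x + c - u α τ x| ≤ M := fun α => by
    have hcw : ContinuousOn (fun x => w α τ x) (Icc 0 r) :=
      (hwc α).comp (f := fun x : ℝ => (τ, x)) (by fun_prop) fun x _ =>
        ⟨mem_Iic.2 le_rfl, trivial⟩
    have hcu : ContinuousOn (fun x => u α τ x) (Icc 0 r) :=
      (hu.continuousOn α).comp (f := fun x : ℝ => (τ, x)) (by fun_prop) fun x hx =>
        ⟨⟨by linarith, by linarith⟩, hx.1⟩
    exact isCompact_Icc.exists_bound_of_continuousOn ((hcw.add continuousOn_const).sub hcu)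
  choose Ms' hMs' using hMs
  obtain ⟨Ms, hMs0, hMs⟩ := exists_nonneg_bound Ms'
  set m := Ms / (δ / 4 * (τ - T')) with hm
  have hm0 : 0 ≤ m := div_nonneg hMs0 (mul_nonneg (by linarith) (by linarith))
  have hmτ : Ms ≤ δ / 4 * Real.exp (m * (τ - T')) := by
    have h1 : δ / 4 * (m * (τ - T')) = Ms := by
      have : τ - T' ≠ 0 := by linarith
      rw [hm]
      field_simp
    have h2 := Real.add_one_le_exp (m * (τ - T'))
    rw [← h1]
    exact mul_le_mul_of_nonneg_left (by linarith) (by linarith)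
  set e := δ / (8 * (1 + T)) with he
  have he0 : 0 < e := by positivity
  have heT : 2 * e * (1 + T) = δ / 4 := by
    rw [he]
    field_simp
    norm_num
  refine ⟨e, he0, fun φ a b ha hb hac hbc hjunc hsub hinit hbd => ?_⟩
  have hφ : ∀ α, ContDiff ℝ 1 fun q : ℝ × ℝ => φ α q.1 q.2 := fun α =>
    contDiff_one_of_partials (ha α) (hb α) (hac α) (hbc α)
  set pen : ℝ → ℝ := fun t => 2 * e * (1 + t) + δ / 4 * Real.exp (m * (t - T')) with hpen
  have hpen0 : ∀ t, 0 ≤ t → 2 * e ≤ pen t := fun t ht => by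
    have h1 : 0 ≤ δ / 4 * Real.exp (m * (t - T')) := by positivity
    have h2 : 0 ≤ 2 * e * t := by positivity
    simp only [hpen]
    linarith
  have hpend : ∀ t, HasDerivAt pen (2 * e + δ / 4 * (m * Real.exp (m * (t - T')))) t := fun t => by
    have h1 : HasDerivAt (fun t => m * (t - T')) m t := by
      simpa using ((hasDerivAt_id t).sub_const T').const_mul m
    refine ((((hasDerivAt_id t).const_add 1).const_mul (2 * e)).fun_add
      (h1.exp.const_mul (δ / 4))).congr_deriv ?_
    ring
  set Φ : Fin N → ℝ → ℝ → ℝ := fun α t x => softMin (φ α t x) (w α t x + c) - pen t with hΦ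
  have hΦw : ∀ α t x, 0 ≤ t → Φ α t x ≤ w α t x + c := fun α t x ht => by
    have h1 := softMin_le_right (φ α t x) (w α t x + c)
    have h2 := hpen0 t ht
    simp only [hΦ]
    linarith
  set θ : Fin N → ℝ → ℝ → ℝ := fun α t x => softMinWeight (φ α t x) (w α t x + c) with hθ
  have key : ∀ α, ∀ t ∈ Icc 0 τ, ∀ x ∈ Icc 0 r, Φ α t x ≤ u α t x := by
    intro α t ht x hx
    refine hu.smooth_le_of_boundary hN hL (by linarith : τ < T) (Φ := Φ)
      (a := fun α t x => (1 - θ α t x) * a α t x +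
        θ α t x * (L α (-x / (t₀ - t)) - L α 0 + -B₁ -
          -x / (t₀ - t) * deriv (L α) (-x / (t₀ - t))) -
        (2 * e + δ / 4 * (m * Real.exp (m * (t - T')))))
      (b := fun α t x => (1 - θ α t x) * b α t x +
        θ α t x * deriv (L α) (-x / (t₀ - t)))
      (fun α t ht x => ?_) (fun α t ht x => ?_) (fun α t ht x => ?_) (fun α β t => ?_)
      (fun α t ht x hx => ?_) (fun α x hx => ?_) (fun α x hx => ?_) (fun α t ht => ?_) α ht hx
    · refine ContDiffAt.sub (ContDiffAt.softMin (hφ α).contDiffAt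
        ((contDiffAt_barrier (hL α) (ht.2.trans_lt hτt₀) x).add contDiffAt_const)) ?_
      have : ContDiff ℝ 1 fun q : ℝ × ℝ => pen q.1 := by
        simp only [hpen]
        fun_prop
      exact this.contDiffAt
    · exact ((ha α t x).softMin ((hasDerivAt_barrier_left (hL α) (ht.2.trans_lt hτt₀) x).add_const
        c)).sub (hpend t)
    · exact ((hb α t x).softMin ((hasDerivAt_barrier_right (hL α) (ht.2.trans_lt hτt₀) x).add_const
        c)).sub_const _
    · simp only [hΦ, hw, barrier_zero, hjunc α β t]
    · have h0 : 0 ≤ θ α t x := softMinWeight_nonneg _ _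
      have h1 : θ α t x ≤ 1 := softMinWeight_le_one _ _
      have h2 := (hL α).convex_comb h0 h1 (b α t x) (deriv (L α) (-x / (t₀ - t)))
      have h3 := mul_le_mul_of_nonneg_left (hsub α t x ht.1 hx) (sub_nonneg.2 h1)
      have h4 := mul_le_mul_of_nonneg_left (barrier_subsolution (hL α)
        (by linarith [hB₁ α] : -B₁ ≤ L α 0) (-x / (t₀ - t))) h0
      have h5 : 0 ≤ δ / 4 * (m * Real.exp (m * (t - T'))) := by positivity
      have h6 : 0 ≤ θ α t x * e := by positivity
      linarith
    · have h1 := softMin_le_left (φ α 0 x) (w α 0 x + c)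
      have h2 := hpen0 0 le_rfl
      simp only [hΦ]
      linarith [hinit α x hx.1, hu.initial α hx.1]
    · have h1 := softMin_le_right (φ α τ x) (w α τ x + c)
      have h2 := (abs_le.1 ((hMs' α x hx).trans (hMs α))).2
      have h3 : 0 ≤ 2 * e * (1 + τ) := mul_nonneg (by positivity) (by linarith)
      simp only [hΦ, hpen]
      linarith
    · exact (hΦw α t r ht.1).trans (hr α t ht)
  intro α t ht x hx
  have h1 := key α t ⟨ht.1, ht.2.trans hT'τ.le⟩ x ⟨hx.1, hx.2.trans hRr⟩
  have h2 := sub_exp_le_softMin (φ α t x) (w α t x + c)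
  have h3 : Real.exp (φ α t x - (w α t x + c)) ≤ δ / 4 := by
    rw [← Real.exp_log (by positivity : 0 < δ / 4), Real.exp_le_exp]
    have h4 := (abs_le.1 ((hMw' α (t, x) ⟨ht, hx⟩).trans (hMw α))).1
    have h5 := hbd α t ht x hx
    simp only at h4
    linarith
  have h4 : 2 * e * (1 + t) ≤ δ / 4 := by
    rw [← heT]
    exact mul_le_mul_of_nonneg_left (by linarith [ht.2]) (by positivity)
  have h5 : Real.exp (m * (t - T')) ≤ 1 :=
    Real.exp_le_one_iff.2 (mul_nonpos_of_nonneg_of_nonpos hm0 (by linarith [ht.2]))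
  have h6 := mul_le_mul_of_nonneg_left h5 (by positivity : 0 ≤ δ / 4)
  simp only [hΦ, hpen] at h1
  linarith

/-- Upper bound of the numerical solution by the viscosity solution, up to a small error. -/
lemma IsViscSolCI.scheme_le_add {N : ℕ} (hN : 1 ≤ N) {T : ℝ} {H : Fin N → ℝ → ℝ}
    {p₀ : Fin N → ℝ} {u₀ : Fin N → ℝ → ℝ} {u : Fin N → ℝ → ℝ → ℝ} (hu : IsViscSolCI T H p₀ u₀ u)
    {γ : ℝ} {L : Fin N → ℝ → ℝ} (hL : ∀ α, LegendreDual γ (L α) (H α) (p₀ α)) {C₀ : ℝ}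
    (hC₀ : 0 ≤ C₀) (hu₀ : ∀ α x y, 0 ≤ x → 0 ≤ y → |u₀ α x - u₀ α y| ≤ C₀ * |x - y|)
    {T' R δ : ℝ} (hT'0 : 0 ≤ T') (hT' : T' < T) (hδ : 0 < δ) :
    ∃ ρ > 0, ∀ Δx Δt U, IsSchemeSolution H p₀ u₀ Δx Δt U → Δx ≤ ρ → Δt ≤ ρ →
      ∀ (α : Fin N) (n i : ℕ), n * Δt ≤ T' → i * Δx ≤ R →
        U α n i ≤ u α (n * Δt) (i * Δx) + δ := by
  obtain ⟨C, hC, happrox⟩ := exists_smooth_approx_scheme hL hC₀ hu₀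
  obtain ⟨M, -, hM⟩ := exists_nonneg_bound fun α => u₀ α 0
  obtain ⟨e, he, hcomp⟩ := hu.exists_smooth_le_add (R := R) hN hL hT'0 hT' (half_pos hδ)
    (M + C₀ * R + C * T' + 1)
  obtain ⟨ρ, hρ, h⟩ := happrox (min 1 (min e (δ / 2))) (by positivity)
  refine ⟨ρ, hρ, fun Δx Δt U hU hΔx hΔt α n i hn hi => ?_⟩
  obtain ⟨φ, a, b, ha, hb, hac, hbc, hjunc, hsub, hinit, hφU⟩ := h Δx Δt U hU hΔx hΔt
  have hx := hU.pos_x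
  have ht := hU.pos_t
  have h1 : min 1 (min e (δ / 2)) ≤ 1 := min_le_left _ _
  have h2 : min 1 (min e (δ / 2)) ≤ e := (min_le_right _ _).trans (min_le_left _ _)
  have h3 : min 1 (min e (δ / 2)) ≤ δ / 2 := (min_le_right _ _).trans (min_le_right _ _)
  have h4 := hcomp φ a b ha hb hac hbc hjunc (fun α t x ht hx => (hsub α t x ht hx).trans h2)
    (fun α x hx => by linarith [hinit α 0 x le_rfl hx])
    (fun α t ht x hx => by
      have h5 := (abs_le.1 (hu₀ α x 0 hx.1 le_rfl)).2
      rw [sub_zero, abs_of_nonneg hx.1] at h5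
      have h6 := mul_le_mul_of_nonneg_left hx.2 hC₀
      have h7 := mul_le_mul_of_nonneg_left ht.2 hC
      linarith [hinit α t x ht.1 hx.1, hM α])
    α (n * Δt) ⟨by positivity, hn⟩ (i * Δx) ⟨by positivity, hi⟩
  linarith [(abs_le.1 (hφU α n i)).1]

/-- **Full convergence of the numerical solution under the uniqueness assumption**
(Theorem 2.9). Assume (A0)-(A1′) and let `T > 0`. Let `u` be the unique viscosity
solution of (HJ)-(CI) on `[0,T) × J`. Then for any sequence of mesh parameters
`ε_k = (Δt_k, Δx_k) → 0` satisfying the CFL condition (CFL′), the numerical solutions of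
the scheme (NS) with initial condition `U^{α,0}_i = u₀^α(iΔx_k)` converge to `u`
uniformly on every compact subset of `[0,T) × J`. -/
theorem full_convergence_of_scheme {N : ℕ} (hN : 1 ≤ N)
    (H : Fin N → ℝ → ℝ) (p₀ : Fin N → ℝ)
    (hA1 : ∀ α, A1cond (H α) (p₀ α))
    (hA1' : A1primeCond H p₀)
    (u₀ : Fin N → ℝ → ℝ) (hA0 : A0cond u₀)
    (T : ℝ) (hT : 0 < T)
    (u : Fin N → ℝ → ℝ → ℝ)
    (hu : IsViscSolCI T H p₀ u₀ u)
    (Δx Δt : ℕ → ℝ)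
    (hΔx : ∀ k, 0 < Δx k) (hΔt : ∀ k, 0 < Δt k)
    (hΔx0 : Tendsto Δx atTop (nhds 0)) (hΔt0 : Tendsto Δt atTop (nhds 0))
    (U : ℕ → Fin N → ℕ → ℕ → ℝ)
    (hU : ∀ k, SchemeNS H p₀ (Δx k) (Δt k) (U k))
    (hinit : ∀ k (α : Fin N) (i : ℕ), U k α 0 i = u₀ α (i * Δx k))
    (hCFL : ∀ k, CFLprime H p₀ (Δx k) (Δt k) (U k)) :
    ∀ T' R δ : ℝ, T' < T → 0 < δ →
      ∃ K : ℕ, ∀ k, K ≤ k → ∀ (α : Fin N) (n i : ℕ),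
        (n : ℝ) * Δt k ≤ T' → (i : ℝ) * Δx k ≤ R →
        |u α ((n : ℝ) * Δt k) ((i : ℝ) * Δx k) - U k α n i| ≤ δ := by
  intro T' R δ hT' hδ
  obtain ⟨γ, L, hL⟩ := legendreDual_of_A1 hA1 hA1'
  choose C hC using hA0.1
  obtain ⟨C₀, hC₀, hCC₀⟩ := exists_nonneg_bound fun α => (C α : ℝ)
  have hu₀ : ∀ α x y, 0 ≤ x → 0 ≤ y → |u₀ α x - u₀ α y| ≤ C₀ * |x - y| := fun α x y hx hy =>
    ((hC α).dist_le_mul x hx y hy).trans (mul_le_mul_of_nonneg_right (hCC₀ α) dist_nonneg)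
  have hT'0 : 0 ≤ max T' 0 := le_max_right _ _
  have hT'T : max T' 0 < T := max_lt hT' hT
  obtain ⟨ρ₁, hρ₁, h₁⟩ := hu.le_scheme_add hL hC₀ hu₀ hT'0 hT'T (le_max_right R 0) hδ
  obtain ⟨ρ₂, hρ₂, h₂⟩ := hu.scheme_le_add (R := R) hN hL hC₀ hu₀ hT'0 hT'T hδ
  have hρ : 0 < min ρ₁ ρ₂ := lt_min hρ₁ hρ₂
  obtain ⟨K, hK⟩ := eventually_atTop.1
    ((hΔx0.eventually (Iic_mem_nhds hρ)).and (hΔt0.eventually (Iic_mem_nhds hρ)))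
  refine ⟨K, fun k hk α n i hn hi => ?_⟩
  obtain ⟨hx, ht⟩ := hK k hk
  have hS : IsSchemeSolution H p₀ u₀ (Δx k) (Δt k) (U k) :=
    ⟨hΔx k, hΔt k, hU k, hinit k, hCFL k⟩
  have hle₁ := h₁ _ _ _ hS (hx.trans (min_le_left _ _)) (ht.trans (min_le_left _ _)) α n i
    (hn.trans (le_max_left _ _)) (hi.trans (le_max_left _ _))
  have hle₂ := h₂ _ _ _ hS (hx.trans (min_le_right _ _)) (ht.trans (min_le_right _ _)) α n i
    (hn.trans (le_max_left _ _)) hi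
  exact abs_le.2 ⟨by linarith, hle₁⟩
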